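/- Let 1 < ρ ≤ 3/2 and set l = 2(ρ−1). Suppose v : ℝ² → ℝ is a C² solution of Δv(y) + (1+|y|²)^l e^{v(y)} = 0 on ℝ², the function y ↦ (1+|y|²)^l e^{v(y)} is integrable on ℝ² with ∫_{ℝ²} (1+|y|²)^l e^{v(y)} dy = 8πρ, and the gradient of v vanishes at the origin, ∇v(0) = 0. Then v(y) = −2ρ log(1+|y|²) + log(8ρ) for all y ∈ ℝ². -/

import Mathlib

open MeasureTheory Real

/-- The Euclidean Laplacian on `ℝ²`: the sum of the two pure second partial
derivatives in the standard coordinate directions. -/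
noncomputable def planeLaplacian (v : EuclideanSpace ℝ (Fin 2) → ℝ)
    (y : EuclideanSpace ℝ (Fin 2)) : ℝ :=
  ∑ i : Fin 2,
    fderiv ℝ (fun z => fderiv ℝ v z (EuclideanSpace.single i 1)) y
      (EuclideanSpace.single i 1)

set_option linter.unusedSectionVars false

namespace MF

section calculus

variable {F : Type*} [NormedAddCommGroup F] [NormedSpace ℝ F]

/-- partial derivative in the real direction -/
noncomputable def dx (f : ℂ → F) (z : ℂ) : F := fderiv ℝ f z 1
/-- partial derivative in the imaginary direction -/
noncomputable def dy (f : ℂ → F) (z : ℂ) : F := fderiv ℝ f z Complex.I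
/-- Laplacian -/
noncomputable def lap (f : ℂ → F) (z : ℂ) : F := dx (dx f) z + dy (dy f) z

lemma contDiff_dx {f : ℂ → F} {n : ℕ} (hf : ContDiff ℝ (n + 1) f) : ContDiff ℝ n (dx f) := by
  unfold dx
  exact (hf.fderiv_right (m := n) le_rfl).clm_apply contDiff_const

lemma contDiff_dy {f : ℂ → F} {n : ℕ} (hf : ContDiff ℝ (n + 1) f) : ContDiff ℝ n (dy f) := by
  unfold dy
  exact (hf.fderiv_right (m := n) le_rfl).clm_apply contDiff_const

lemma fderiv_eq_dx_dy (f : ℂ → F) (z h : ℂ) :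
    fderiv ℝ f z h = h.re • dx f z + h.im • dy f z := by
  unfold dx dy
  conv_lhs => rw [show h = h.re • (1 : ℂ) + h.im • Complex.I by
    apply Complex.ext <;> simp]
  rw [map_add, map_smul, map_smul]

lemma dx_dy_comm {f : ℂ → F} (hf : ContDiff ℝ 2 f) : dx (dy f) = dy (dx f) := by
  funext z
  have hd : DifferentiableAt ℝ (fderiv ℝ f) z :=
    ((hf.fderiv_right (m := 1) (by norm_num)).differentiable (by norm_num)) z
  have h := (hf.contDiffAt (x := z)).isSymmSndFDerivAt (by simp)
  have h1 : ∀ a b : ℂ, fderiv ℝ (fun w => fderiv ℝ f w a) z b = fderiv ℝ (fderiv ℝ f) z b a := by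
    intro a b
    rw [fderiv_clm_apply hd (differentiableAt_const a)]
    simp
  unfold dx dy
  rw [h1, h1]
  exact h.eq _ _

lemma hasDerivAt_dx {f : ℂ → F} {z : ℂ} (hf : DifferentiableAt ℝ f z) (g : ℝ → ℂ) (t : ℝ)
    (hg : HasDerivAt g 1 t) (hz : g t = z) : HasDerivAt (fun s => f (g s)) (dx f z) t := by
  subst hz
  exact hf.hasFDerivAt.comp_hasDerivAt t hg

lemma hasDerivAt_dy {f : ℂ → F} {z : ℂ} (hf : DifferentiableAt ℝ f z) (g : ℝ → ℂ) (t : ℝ)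
    (hg : HasDerivAt g Complex.I t) (hz : g t = z) :
    HasDerivAt (fun s => f (g s)) (dy f z) t := by
  subst hz
  exact hf.hasFDerivAt.comp_hasDerivAt t hg

/-- horizontal line -/
lemma hasDerivAt_hor (t θ : ℝ) : HasDerivAt (fun s : ℝ => (s : ℂ) + θ * Complex.I) 1 t := by
  simpa using (Complex.ofRealCLM.hasDerivAt (x := t)).add_const ((θ : ℂ) * Complex.I)

lemma hasDerivAt_ver (t θ : ℝ) :
    HasDerivAt (fun s : ℝ => (t : ℂ) + s * Complex.I) Complex.I θ := by
  simpa using ((Complex.ofRealCLM.hasDerivAt (x := θ)).mul_const Complex.I).const_add (t : ℂ)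

lemma dx_add {f g : ℂ → F} (hf : Differentiable ℝ f) (hg : Differentiable ℝ g) :
    dx (fun z => f z + g z) = fun z => dx f z + dx g z := by
  funext z; unfold dx; rw [fderiv_fun_add (hf z) (hg z)]; rfl

lemma dy_add {f g : ℂ → F} (hf : Differentiable ℝ f) (hg : Differentiable ℝ g) :
    dy (fun z => f z + g z) = fun z => dy f z + dy g z := by
  funext z; unfold dy; rw [fderiv_fun_add (hf z) (hg z)]; rfl

lemma dx_mul {f g : ℂ → ℝ} (hf : Differentiable ℝ f) (hg : Differentiable ℝ g) :
    dx (fun z => f z * g z) = fun z => dx f z * g z + f z * dx g z := by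
  funext z; unfold dx; rw [fderiv_fun_mul (hf z) (hg z)]; simp; ring

lemma dy_mul {f g : ℂ → ℝ} (hf : Differentiable ℝ f) (hg : Differentiable ℝ g) :
    dy (fun z => f z * g z) = fun z => dy f z * g z + f z * dy g z := by
  funext z; unfold dy; rw [fderiv_fun_mul (hf z) (hg z)]; simp; ring

lemma dx_comp {f : ℂ → ℝ} {g g' : ℝ → ℝ} (hf : Differentiable ℝ f)
    (hg : ∀ z, HasDerivAt g (g' (f z)) (f z)) :
    dx (fun z => g (f z)) = fun z => g' (f z) * dx f z := by
  funext z; unfold dx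
  rw [(show HasFDerivAt (fun z => g (f z)) _ z from
    (hg z).comp_hasFDerivAt z (hf z).hasFDerivAt).fderiv]; simp

lemma dy_comp {f : ℂ → ℝ} {g g' : ℝ → ℝ} (hf : Differentiable ℝ f)
    (hg : ∀ z, HasDerivAt g (g' (f z)) (f z)) :
    dy (fun z => g (f z)) = fun z => g' (f z) * dy f z := by
  funext z; unfold dy
  rw [(show HasFDerivAt (fun z => g (f z)) _ z from
    (hg z).comp_hasFDerivAt z (hf z).hasFDerivAt).fderiv]; simp

/-- functions of the real part only -/
lemma dx_re {g g' : ℝ → ℝ} (hg : ∀ t, HasDerivAt g (g' t) t) :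
    dx (fun z : ℂ => g z.re) = fun z => g' z.re := by
  funext z; unfold dx
  rw [(show HasFDerivAt (fun z : ℂ => g z.re) _ z from
    (hg z.re).comp_hasFDerivAt z Complex.reCLM.hasFDerivAt).fderiv]; simp

lemma dy_re {g g' : ℝ → ℝ} (hg : ∀ t, HasDerivAt g (g' t) t) :
    dy (fun z : ℂ => g z.re) = fun _ => 0 := by
  funext z; unfold dy
  rw [(show HasFDerivAt (fun z : ℂ => g z.re) _ z from
    (hg z.re).comp_hasFDerivAt z Complex.reCLM.hasFDerivAt).fderiv]; simp

/-- composition with a translation -/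
lemma dx_shift (f : ℂ → F) (w z : ℂ) : dx (fun y => f (w + y)) z = dx f (w + z) := by
  unfold dx; rw [fderiv_comp_add_left]

lemma dy_shift (f : ℂ → F) (w z : ℂ) : dy (fun y => f (w + y)) z = dy f (w + z) := by
  unfold dy; rw [fderiv_comp_add_left]

lemma lap_shift (f : ℂ → F) (w z : ℂ) : lap (fun y => f (w + y)) z = lap f (w + z) := by
  unfold lap
  rw [show dx (fun y => f (w + y)) = fun y => dx f (w + y) from funext (dx_shift f w),
    show dy (fun y => f (w + y)) = fun y => dy f (w + y) from funext (dy_shift f w),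
    dx_shift, dy_shift]

lemma continuous_lap {f : ℂ → F} (hf : ContDiff ℝ 2 f) : Continuous (lap f) := by
  have h1 : ContDiff ℝ 1 (dx f) := contDiff_dx (n := 1) (by exact_mod_cast hf)
  have h2 : ContDiff ℝ 1 (dy f) := contDiff_dy (n := 1) (by exact_mod_cast hf)
  have h3 : ContDiff ℝ 0 (dx (dx f)) := contDiff_dx (n := 0) (by exact_mod_cast h1)
  have h4 : ContDiff ℝ 0 (dy (dy f)) := contDiff_dy (n := 0) (by exact_mod_cast h2)
  exact h3.continuous.add h4.continuous

end calculus

/-- Laplacian of a composition with a one-variable function -/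
lemma lap_comp {f : ℂ → ℝ} {g g' g'' : ℝ → ℝ} (hf : ContDiff ℝ 2 f)
    (hg : ∀ z, HasDerivAt g (g' (f z)) (f z)) (hg' : ∀ z, HasDerivAt g' (g'' (f z)) (f z)) (z : ℂ) :
    lap (fun z => g (f z)) z = g' (f z) * lap f z
      + g'' (f z) * (dx f z ^ 2 + dy f z ^ 2) := by
  have h1 : ContDiff ℝ 1 (dx f) := contDiff_dx (n := 1) (by exact_mod_cast hf)
  have h2 : ContDiff ℝ 1 (dy f) := contDiff_dy (n := 1) (by exact_mod_cast hf)
  have hfd : Differentiable ℝ f := hf.differentiable (by norm_num)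
  have hgd : Differentiable ℝ (fun z => g' (f z)) := fun z =>
    ((hg' z).comp_hasFDerivAt z (hfd z).hasFDerivAt).differentiableAt
  unfold lap
  rw [dx_comp hfd hg, dy_comp hfd hg, dx_mul hgd (h1.differentiable (by norm_num)),
    dy_mul hgd (h2.differentiable (by norm_num)), dx_comp hfd hg', dy_comp hfd hg']
  ring

end MF

namespace MF

/-- integral over a vertical period -/
noncomputable def circ (S : ℂ → ℝ) (t : ℝ) : ℝ :=
  ∫ θ in (0:ℝ)..(2 * π), S ((t : ℂ) + θ * Complex.I)

/-- periodicity in the imaginary direction -/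
def Per (S : ℂ → ℝ) : Prop := ∀ z : ℂ, S (z + 2 * π * Complex.I) = S z

lemma Per.dx {S : ℂ → ℝ} (h : Per S) : Per (dx S) := by
  intro z
  unfold MF.dx
  rw [← fderiv_comp_add_right]
  rw [show (fun x => S (x + 2 * π * Complex.I)) = S from funext h]

lemma Per.dy {S : ℂ → ℝ} (h : Per S) : Per (dy S) := by
  intro z
  unfold MF.dy
  rw [← fderiv_comp_add_right]
  rw [show (fun x => S (x + 2 * π * Complex.I)) = S from funext h]

lemma continuous_ver (t : ℝ) : Continuous fun θ : ℝ => (t : ℂ) + θ * Complex.I := by fun_prop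

lemma circ_integrable {S : ℂ → ℝ} (hS : Continuous S) (t a b : ℝ) :
    IntervalIntegrable (fun θ : ℝ => S ((t : ℂ) + θ * Complex.I)) volume a b :=
  (hS.comp (continuous_ver t)).intervalIntegrable _ _

lemma two_pi_nonneg : (0:ℝ) ≤ 2 * π := by positivity

lemma circ_hasDerivAt {S : ℂ → ℝ} (hS : ContDiff ℝ 1 S) (t : ℝ) :
    HasDerivAt (circ S) (circ (dx S) t) t := by
  have hd : Differentiable ℝ S := hS.differentiable (by norm_num)
  have hc : Continuous (dx S) := (contDiff_dx (n := 0) (by exact_mod_cast hS)).continuous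
  have hcomp : IsCompact ((fun p : ℝ × ℝ => (p.1 : ℂ) + p.2 * Complex.I) ''
      (Set.Icc (t - 1) (t + 1) ×ˢ Set.Icc 0 (2 * π))) :=
    (isCompact_Icc.prod isCompact_Icc).image (by fun_prop)
  obtain ⟨C, hC⟩ := (hcomp.image hc).isBounded.exists_norm_le
  have := intervalIntegral.hasDerivAt_integral_of_dominated_loc_of_deriv_le (μ := volume)
    (F := fun (s : ℝ) (θ : ℝ) => S ((s : ℂ) + θ * Complex.I))
    (F' := fun (s : ℝ) (θ : ℝ) => dx S ((s : ℂ) + θ * Complex.I))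
    (x₀ := t) (a := 0) (b := 2 * π) (s := Set.Ioo (t - 1) (t + 1)) (bound := fun _ => C)
    (Ioo_mem_nhds (by linarith) (by linarith))
    (Filter.Eventually.of_forall fun s => (hS.continuous.comp (continuous_ver s)).aestronglyMeasurable)
    (circ_integrable hS.continuous t 0 (2*π))
    ((hc.comp (continuous_ver t)).aestronglyMeasurable)
    (Filter.Eventually.of_forall fun θ hθ s hs => hC _ (by
      refine ⟨_, ⟨(s, θ), ⟨Set.Ioo_subset_Icc_self hs, ?_⟩, rfl⟩, rfl⟩
      rw [Set.uIoc_of_le two_pi_nonneg] at hθ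
      exact Set.Ioc_subset_Icc_self hθ))
    (by simp)
    (Filter.Eventually.of_forall fun θ hθ s hs =>
      hasDerivAt_dx (hd _) _ s (hasDerivAt_hor s θ) rfl)
  exact this.2

lemma circ_dy {S : ℂ → ℝ} (hS : ContDiff ℝ 1 S) (hp : Per S) (t : ℝ) : circ (dy S) t = 0 := by
  have hd : Differentiable ℝ S := hS.differentiable (by norm_num)
  have hc : Continuous (dy S) := (contDiff_dy (n := 0) (by exact_mod_cast hS)).continuous
  unfold circ
  rw [intervalIntegral.integral_eq_sub_of_hasDerivAt
    (fun θ _ => hasDerivAt_dy (hd _) _ θ (hasDerivAt_ver t θ) rfl) (circ_integrable hc t _ _)]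
  have := hp (t : ℂ)
  push_cast
  simp [this]

lemma circ_add {S T : ℂ → ℝ} (hS : Continuous S) (hT : Continuous T) (t : ℝ) :
    circ (fun z => S z + T z) t = circ S t + circ T t :=
  intervalIntegral.integral_add (circ_integrable hS t _ _) (circ_integrable hT t _ _)

lemma circ_lap {S : ℂ → ℝ} (hS : ContDiff ℝ 2 S) (hp : Per S) (t : ℝ) :
    circ (lap S) t = circ (dx (dx S)) t := by
  have h1 : ContDiff ℝ 1 (dx S) := contDiff_dx (n := 1) (by exact_mod_cast hS)
  have h2 : ContDiff ℝ 1 (dy S) := contDiff_dy (n := 1) (by exact_mod_cast hS)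
  have h3 : ContDiff ℝ 0 (dx (dx S)) := contDiff_dx (n := 0) (by exact_mod_cast h1)
  have h4 : ContDiff ℝ 0 (dy (dy S)) := contDiff_dy (n := 0) (by exact_mod_cast h2)
  have := circ_add h3.continuous h4.continuous t
  rw [circ_dy h2 hp.dy, add_zero] at this
  exact this

lemma circ_hasDerivAt2 {S : ℂ → ℝ} (hS : ContDiff ℝ 2 S) (hp : Per S) (t : ℝ) :
    HasDerivAt (circ (dx S)) (circ (lap S) t) t := by
  rw [circ_lap hS hp]
  exact circ_hasDerivAt (contDiff_dx (n := 1) (by exact_mod_cast hS)) t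

lemma circ_mono {S T : ℂ → ℝ} (hS : Continuous S) (hT : Continuous T) (t : ℝ)
    (h : ∀ z : ℂ, z.re = t → S z ≤ T z) : circ S t ≤ circ T t := by
  unfold circ
  apply intervalIntegral.integral_mono_on two_pi_nonneg (circ_integrable hS t _ _)
    (circ_integrable hT t _ _)
  intro θ _
  apply h; simp

lemma circ_const (c t : ℝ) : circ (fun _ => c) t = 2 * π * c := by
  simp [circ]

lemma circ_nonneg {S : ℂ → ℝ} (t : ℝ)
    (h : ∀ z : ℂ, z.re = t → 0 ≤ S z) : 0 ≤ circ S t := by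
  unfold circ
  apply intervalIntegral.integral_nonneg two_pi_nonneg
  intro θ _
  apply h; simp

lemma circ_continuous {S : ℂ → ℝ} (hS : Continuous S) : Continuous (circ S) := by
  unfold circ
  apply intervalIntegral.continuous_parametric_intervalIntegral_of_continuous'
  fun_prop

lemma Per.int {S : ℂ → ℝ} (h : Per S) (n : ℤ) (z : ℂ) : S (z + n * (2 * π * Complex.I)) = S z := by
  have : Function.Periodic S (2 * π * Complex.I) := h
  exact this.int_mul n z

/-- a nonnegative continuous periodic function with zero circular integral vanishes -/
lemma circ_eq_zero {S : ℂ → ℝ} (hS : Continuous S) (hp : Per S) (h0 : ∀ z, 0 ≤ S z) (t : ℝ)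
    (h : circ S t = 0) (z : ℂ) (hz : z.re = t) : S z = 0 := by
  have key : ∀ θ ∈ Set.Icc (0:ℝ) (2 * π), S ((t : ℂ) + θ * Complex.I) = 0 := by
    by_contra hne
    push Not at hne
    obtain ⟨θ, hθ, hne⟩ := hne
    have : 0 < ∫ θ in (0:ℝ)..(2 * π), S ((t : ℂ) + θ * Complex.I) :=
      intervalIntegral.integral_pos (by positivity)
        (hS.comp (continuous_ver t)).continuousOn (fun x _ => h0 _)
        ⟨θ, hθ, lt_of_le_of_ne (h0 _) (Ne.symm hne)⟩
    unfold circ at h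
    linarith
  obtain ⟨n, hn, -⟩ := existsUnique_add_zsmul_mem_Ico (show (0:ℝ) < 2 * π by positivity) z.im 0
  have h1 := key (z.im + n • (2 * π)) ⟨hn.1, by linarith [hn.2]⟩
  rw [← hp.int n z, ← h1]
  congr 1
  apply Complex.ext <;> simp [hz]

lemma circ_eq_shift {S : ℂ → ℝ} (hp : Per S) (t a : ℝ) :
    ∫ θ in a..(a + 2 * π), S ((t : ℂ) + θ * Complex.I) = circ S t := by
  have : Function.Periodic (fun θ : ℝ => S ((t : ℂ) + θ * Complex.I)) (2 * π) := by
    intro θ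
    have := hp ((t : ℂ) + θ * Complex.I)
    show S _ = S _
    rw [← this]; push_cast; ring_nf
  have h := this.intervalIntegral_add_eq a 0
  rw [h]; simp [circ]

end MF

namespace MF

open Complex in
lemma cis_symm (p : ℝ × ℝ) : Complex.polarCoord.symm p = p.1 * Complex.exp (p.2 * I) := by
  rw [Complex.polarCoord_symm_apply, Complex.exp_mul_I]
  push_cast; ring

lemma hasDerivAt_cis (θ : ℝ) :
    HasDerivAt (fun t : ℝ => Complex.exp (t * Complex.I)) (Complex.I * Complex.exp (θ * Complex.I)) θ := by
  have h : HasDerivAt (fun t : ℝ => (t : ℂ) * Complex.I) Complex.I θ := by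
    simpa using (Complex.ofRealCLM.hasDerivAt (x := θ)).mul_const Complex.I
  convert h.cexp using 1; ring

/-- Integration in polar coordinates as iterated integral: set-up of integrability -/
lemma polar_integrable {F : ℝ × ℝ → ℂ} (hF : Continuous F) (R : ℝ) (hR : ∀ r θ, R < r → F (r, θ) = 0) :
    IntegrableOn F (Set.Ioi 0 ×ˢ Set.Ioo (-π) π) (volume.prod volume) := by
  have h1 : IntegrableOn F (Set.Icc 0 R ×ˢ Set.Icc (-π) π) (volume.prod volume) :=
    hF.continuousOn.integrableOn_compact (isCompact_Icc.prod isCompact_Icc)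
  refine h1.of_forall_sdiff_eq_zero (measurableSet_Ioi.prod measurableSet_Ioo) ?_
  rintro ⟨r, θ⟩ ⟨⟨h2, h3⟩, h4⟩
  apply hR
  by_contra h5
  exact h4 ⟨⟨le_of_lt h2, not_lt.1 h5⟩, Set.Ioo_subset_Icc_self h3⟩

theorem cauchy_pompeiu {ψ : ℂ → ℂ} (hψ : ContDiff ℝ 1 ψ) (hs : HasCompactSupport ψ) :
    ∫ z : ℂ, z⁻¹ * (dx ψ z + Complex.I * dy ψ z) = - (2 * π * ψ 0) := by
  have hd : Differentiable ℝ ψ := hψ.differentiable (by norm_num)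
  have hcx : Continuous (dx ψ) := (contDiff_dx (n := 0) (by exact_mod_cast hψ)).continuous
  have hcy : Continuous (dy ψ) := (contDiff_dy (n := 0) (by exact_mod_cast hψ)).continuous
  -- bounded support
  obtain ⟨R, hR⟩ := (hs.isCompact.isBounded).subset_closedBall 0
  have hz0 : ∀ z : ℂ, R < ‖z‖ → z ∉ tsupport ψ := by
    intro z hz h
    have := hR h
    simp at this; linarith
  have hz1 : ∀ z : ℂ, R < ‖z‖ → ψ z = 0 := fun z hz => image_eq_zero_of_notMem_tsupport (hz0 z hz)
  have hz2 : ∀ z : ℂ, R < ‖z‖ → fderiv ℝ ψ z = 0 := fun z hz => by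
    have : z ∉ tsupport (fderiv ℝ ψ) := fun h => hz0 z hz (tsupport_fderiv_subset ℝ h)
    exact image_eq_zero_of_notMem_tsupport this
  let e : ℝ → ℂ := fun θ => Complex.exp (θ * Complex.I)
  have he : Continuous e := by fun_prop
  let P : ℝ × ℝ → ℂ := fun p => Real.cos p.2 • dx ψ (p.1 * e p.2) + Real.sin p.2 • dy ψ (p.1 * e p.2)
  let Q : ℝ × ℝ → ℂ := fun p => -Real.sin p.2 • dx ψ (p.1 * e p.2) + Real.cos p.2 • dy ψ (p.1 * e p.2)
  have hP : Continuous P := by fun_prop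
  have hQ : Continuous Q := by fun_prop
  have hn : ∀ r θ : ℝ, 0 ≤ r → ‖(r : ℂ) * e θ‖ = r := by
    intro r θ hr
    simp [e, Complex.norm_exp_ofReal_mul_I, abs_of_nonneg hr]
  let R' := max R 0
  have hz3 : ∀ r θ : ℝ, R' < r → dx ψ (r * e θ) = 0 ∧ dy ψ (r * e θ) = 0 := by
    intro r θ hr
    have hr0 : 0 ≤ r := le_of_lt (lt_of_le_of_lt (le_max_right _ _) hr)
    have hr1 : R < r := lt_of_le_of_lt (le_max_left _ _) hr
    unfold dx dy
    rw [hz2 _ (by rw [hn r θ hr0]; exact hr1)]; simp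
  have hPi := polar_integrable hP R' (fun r θ hr => by simp [P, hz3 r θ hr])
  have hQi := polar_integrable hQ R' (fun r θ hr => by simp [Q, hz3 r θ hr])
  rw [← Complex.integral_comp_polarCoord_symm]
  have htar : polarCoord.target = Set.Ioi (0:ℝ) ×ˢ Set.Ioo (-π) π := rfl
  rw [htar]
  have hstep : ∀ p ∈ Set.Ioi (0:ℝ) ×ˢ Set.Ioo (-π) π,
      p.1 • ((Complex.polarCoord.symm p)⁻¹ * (dx ψ (Complex.polarCoord.symm p)
        + Complex.I * dy ψ (Complex.polarCoord.symm p))) = P p + Complex.I * Q p := by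
    rintro ⟨r, θ⟩ ⟨hr, -⟩
    have hr : (0:ℝ) < r := hr
    rw [cis_symm]
    have hr' : (r : ℂ) ≠ 0 := by exact_mod_cast hr.ne'
    have he1 : (e θ)⁻¹ = Real.cos θ - Real.sin θ * Complex.I := by
      show (Complex.exp (θ * Complex.I))⁻¹ = _
      rw [← Complex.exp_neg, ← neg_mul, Complex.exp_mul_I]
      simp; ring
    show (r : ℝ) • (((r : ℂ) * e θ)⁻¹ * (dx ψ (r * e θ) + Complex.I * dy ψ (r * e θ))) =
      (Real.cos θ • dx ψ (r * e θ) + Real.sin θ • dy ψ (r * e θ)) + 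
      Complex.I * (-Real.sin θ • dx ψ (r * e θ) + Real.cos θ • dy ψ (r * e θ))
    rw [mul_inv, he1]
    simp only [Complex.real_smul]
    rw [← mul_assoc, ← mul_assoc, mul_inv_cancel₀ hr']
    push_cast
    linear_combination (- Complex.sin θ * dy ψ (r * e θ)) * Complex.I_mul_I
  rw [setIntegral_congr_fun (measurableSet_Ioi.prod measurableSet_Ioo) hstep]
  rw [Measure.volume_eq_prod, integral_add hPi (hQi.const_mul _), integral_const_mul]
  have hg : ∀ r θ : ℝ, HasDerivAt (fun r : ℝ => ψ (r * e θ)) (P (r, θ)) r := by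
    intro r θ
    have h1 : HasDerivAt (fun r : ℝ => (r : ℂ) * e θ) (e θ) r := by
      simpa using (Complex.ofRealCLM.hasDerivAt (x := r)).mul_const (e θ)
    have h2 := (hd (r * e θ)).hasFDerivAt.comp_hasDerivAt r h1
    rw [fderiv_eq_dx_dy] at h2
    refine HasDerivAt.congr_deriv h2 ?_
    simp [P, e, Complex.exp_ofReal_mul_I_re, Complex.exp_ofReal_mul_I_im]
  have hh : ∀ r θ : ℝ, HasDerivAt (fun θ : ℝ => ψ (r * e θ)) (r • Q (r, θ)) θ := by
    intro r θ
    have h1 : HasDerivAt (fun θ : ℝ => (r : ℂ) * e θ) (r * (Complex.I * e θ)) θ :=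
      (hasDerivAt_cis θ).const_mul _
    have h2 := (hd (r * e θ)).hasFDerivAt.comp_hasDerivAt θ h1
    rw [fderiv_eq_dx_dy] at h2
    refine HasDerivAt.congr_deriv h2 ?_
    simp [Q, e, Complex.exp_ofReal_mul_I_re, Complex.exp_ofReal_mul_I_im]
    ring
  have i1 : ∫ p in Set.Ioi (0:ℝ) ×ˢ Set.Ioo (-π) π, P p ∂(volume.prod volume) = -(2 * π * ψ 0) := by
    rw [← setIntegral_prod_swap, setIntegral_prod]
    · have : ∀ θ : ℝ, ∫ r in Set.Ioi (0:ℝ), P (Prod.swap (θ, r)) = - ψ 0 := by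
        intro θ
        have := integral_Ioi_of_hasDerivAt_of_tendsto' (a := 0) (m := 0)
          (f := fun r : ℝ => ψ (r * e θ)) (f' := fun r => P (r, θ)) (fun r _ => hg r θ) ?_ ?_
        · simpa using this
        · have h1 : IntegrableOn (fun r => P (r, θ)) (Set.Icc 0 R') :=
            (hP.comp (by fun_prop : Continuous fun r : ℝ => (r, θ))).continuousOn.integrableOn_compact isCompact_Icc
          refine h1.of_forall_sdiff_eq_zero measurableSet_Ioi ?_
          rintro r ⟨h2, h4⟩
          have : R' < r := by
            by_contra h5
            exact h4 ⟨le_of_lt h2, not_lt.1 h5⟩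
          simp [P, hz3 r θ this]
        · apply tendsto_const_nhds.congr'
          filter_upwards [Filter.eventually_gt_atTop R'] with r hr
          have hr0 : 0 ≤ r := le_of_lt (lt_of_le_of_lt (le_max_right _ _) hr)
          have hr1 : R < r := lt_of_le_of_lt (le_max_left _ _) hr
          rw [hz1]
          rw [hn r θ hr0]; exact hr1
      simp_rw [this]
      simp [Measure.real]
      rw [ENNReal.toReal_ofReal (by positivity)]
      push_cast; ring_nf; simp
    · exact hPi.swap
  have i2 : ∫ p in Set.Ioi (0:ℝ) ×ˢ Set.Ioo (-π) π, Q p ∂(volume.prod volume) = 0 := by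
    rw [setIntegral_prod _ hQi]
    apply setIntegral_eq_zero_of_forall_eq_zero
    intro r hr
    have hr : (0:ℝ) < r := hr
    rw [← integral_Ioc_eq_integral_Ioo, ← intervalIntegral.integral_of_le (by linarith [pi_pos])]
    have := intervalIntegral.integral_eq_sub_of_hasDerivAt (a := -π) (b := π)
      (fun θ _ => hh r θ) (by
        apply Continuous.intervalIntegrable
        fun_prop)
    rw [intervalIntegral.integral_smul] at this
    have h2 : (r : ℝ) • ∫ θ in (-π)..π, Q (r, θ) = 0 := by
      rw [this]
      simp [e, Complex.exp_pi_mul_I, Complex.exp_neg]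
    exact (smul_eq_zero.1 h2).resolve_left hr.ne'
  rw [i1, i2]; simp

end MF

namespace MF

lemma inv_locInt : LocallyIntegrable (fun z : ℂ => z⁻¹) volume := by
  apply locallyIntegrable_of_norm_le_rpow (C := 1) (α := 1)
  rotate_left 3
  · simp
  · simp
  · refine Filter.Eventually.of_forall fun z => ?_
    rw [norm_inv, Real.rpow_neg (norm_nonneg _), Real.rpow_one]; simp
  · exact measurable_inv.aestronglyMeasurable

/-- the complex gradient `u_x - i u_y` -/
noncomputable def cg (u : ℂ → ℝ) (z : ℂ) : ℂ := ((dx u z : ℝ) : ℂ) - Complex.I * ((dy u z : ℝ) : ℂ)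

/-- the d-bar operator -/
noncomputable def db (f : ℂ → ℂ) (z : ℂ) : ℂ := dx f z + Complex.I * dy f z

lemma contDiff_cg {u : ℂ → ℝ} {n : ℕ} (hu : ContDiff ℝ (n + 1) u) : ContDiff ℝ n (cg u) := by
  unfold cg
  have h1 := Complex.ofRealCLM.contDiff.comp (contDiff_dx hu)
  have h2 := Complex.ofRealCLM.contDiff.comp (contDiff_dy hu)
  exact h1.sub (contDiff_const.mul h2)

lemma dx_ofReal {f : ℂ → ℝ} (hf : Differentiable ℝ f) :
    dx (fun z => (f z : ℂ)) = fun z => ((dx f z : ℝ) : ℂ) := by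
  funext z; unfold dx
  rw [(show HasFDerivAt (fun z => (f z : ℂ)) _ z from
    Complex.ofRealCLM.hasFDerivAt.comp z (hf z).hasFDerivAt).fderiv]; simp

lemma dy_ofReal {f : ℂ → ℝ} (hf : Differentiable ℝ f) :
    dy (fun z => (f z : ℂ)) = fun z => ((dy f z : ℝ) : ℂ) := by
  funext z; unfold dy
  rw [(show HasFDerivAt (fun z => (f z : ℂ)) _ z from
    Complex.ofRealCLM.hasFDerivAt.comp z (hf z).hasFDerivAt).fderiv]; simp

lemma db_add {f g : ℂ → ℂ} {z : ℂ} (hf : DifferentiableAt ℝ f z) (hg : DifferentiableAt ℝ g z) :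
    db (fun z => f z + g z) z = db f z + db g z := by
  unfold db dx dy; rw [fderiv_fun_add hf hg]; simp; ring

lemma db_sub {f g : ℂ → ℂ} {z : ℂ} (hf : DifferentiableAt ℝ f z) (hg : DifferentiableAt ℝ g z) :
    db (fun z => f z - g z) z = db f z - db g z := by
  unfold db dx dy; rw [fderiv_fun_sub hf hg]; simp; ring

lemma db_mul {f g : ℂ → ℂ} {z : ℂ} (hf : DifferentiableAt ℝ f z) (hg : DifferentiableAt ℝ g z) :
    db (fun z => f z * g z) z = db f z * g z + f z * db g z := by
  unfold db dx dy; rw [fderiv_fun_mul hf hg]; simp; ring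

lemma db_const_mul {f : ℂ → ℂ} {z : ℂ} (c : ℂ) (hf : DifferentiableAt ℝ f z) :
    db (fun z => c * f z) z = c * db f z := by
  unfold db dx dy; rw [fderiv_const_mul hf]; simp; ring

lemma db_cg {u : ℂ → ℝ} (hu : ContDiff ℝ 2 u) (z : ℂ) : db (cg u) z = ((lap u z : ℝ) : ℂ) := by
  have h1 : Differentiable ℝ (dx u) :=
    (contDiff_dx (n := 1) (by exact_mod_cast hu)).differentiable (by norm_num)
  have h2 : Differentiable ℝ (dy u) :=
    (contDiff_dy (n := 1) (by exact_mod_cast hu)).differentiable (by norm_num)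
  have e1 : Differentiable ℝ fun z => ((dx u z : ℝ) : ℂ) := Complex.ofRealCLM.differentiable.comp h1
  have e2 : Differentiable ℝ fun z => ((dy u z : ℝ) : ℂ) := Complex.ofRealCLM.differentiable.comp h2
  show db (fun z => ((dx u z : ℝ) : ℂ) - Complex.I * ((dy u z : ℝ) : ℂ)) z = _
  rw [db_sub (e1 z) ((e2 z).const_mul _), db_const_mul _ (e2 z)]
  unfold db lap
  rw [dx_ofReal h1, dy_ofReal h1, dx_ofReal h2, dy_ofReal h2, dx_dy_comm hu]
  push_cast
  linear_combination (-((dy (dy u) z : ℝ) : ℂ)) * Complex.I_mul_I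

/-- solving the d-bar equation by convolution -/
lemma solve_db {h : ℂ → ℂ} {n : ℕ} (hn : 1 ≤ n) (hh : ContDiff ℝ n h) (hs : HasCompactSupport h) :
    ∃ q : ℂ → ℂ, ContDiff ℝ n q ∧ ∀ z, db q z = h z := by
  let L := ContinuousLinearMap.mul ℝ ℂ
  have h1 : ContDiff ℝ 1 h := hh.of_le (by exact_mod_cast hn)
  have hc : Continuous (fderiv ℝ h) := h1.continuous_fderiv (by norm_num)
  let q0 : ℂ → ℂ := convolution (fun z : ℂ => z⁻¹) h L volume
  have hq0 : ContDiff ℝ n q0 := by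
    have := hs.contDiff_convolution_right L (n := (n : ℕ∞)) inv_locInt (by exact_mod_cast hh)
    exact_mod_cast this
  have hD : ∀ z w, fderiv ℝ q0 z w = ∫ t : ℂ, t⁻¹ * fderiv ℝ h (z - t) w := by
    intro z w
    rw [(hs.hasFDerivAt_convolution_right L inv_locInt h1 z).fderiv,
      convolution_precompR_apply L inv_locInt (hs.fderiv ℝ) hc]
    rfl
  have hint : ∀ z w, Integrable fun t : ℂ => t⁻¹ * fderiv ℝ h (z - t) w := by
    intro z w
    have hcs : HasCompactSupport fun t : ℂ => fderiv ℝ h (z - t) w := by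
      have a1 : HasCompactSupport fun t : ℂ => fderiv ℝ h t w := hs.fderiv_apply ℝ w
      exact a1.comp_homeomorph (Homeomorph.subLeft z)
    have := inv_locInt.integrable_smul_left_of_hasCompactSupport
      (g := fun t : ℂ => fderiv ℝ h (z - t) w) (by fun_prop) hcs
    simpa [mul_comm] using this
  have hdb : ∀ z, db q0 z = 2 * π * h z := by
    intro z
    have hψ : ContDiff ℝ 1 (fun t => h (z - t)) := h1.comp (by fun_prop)
    have hψs : HasCompactSupport (fun t => h (z - t)) := hs.comp_homeomorph (Homeomorph.subLeft z)
    have hf : ∀ t w, fderiv ℝ (fun t => h (z - t)) t w = - fderiv ℝ h (z - t) w := by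
      intro t w
      have a1 : HasFDerivAt (fun t : ℂ => z - t) (-(ContinuousLinearMap.id ℝ ℂ)) t :=
        (hasFDerivAt_id t).const_sub z
      have a2 := ((h1.differentiable (by norm_num) (z - t)).hasFDerivAt.comp t a1).fderiv
      have a3 : (h ∘ fun t => z - t) = fun t => h (z - t) := rfl
      rw [a3] at a2
      rw [a2]; simp
    have hcp := cauchy_pompeiu hψ hψs
    unfold db dx dy
    rw [hD, hD, ← integral_const_mul, ← integral_add (hint z 1) ((hint z Complex.I).const_mul _)]
    unfold dx dy at hcp
    simp only [sub_zero] at hcp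
    rw [← neg_inj, ← hcp, ← integral_neg]
    congr 1
    funext t
    rw [hf, hf]
    ring
  refine ⟨fun z => (2 * π : ℂ)⁻¹ * q0 z, contDiff_const.mul hq0, fun z => ?_⟩
  have : (2 * π : ℂ) ≠ 0 := by
    simp [Real.pi_ne_zero]
  rw [db_const_mul _ (hq0.differentiable (by exact_mod_cast (by omega)) z), hdb]
  field_simp

theorem elliptic {u : ℂ → ℝ} (hu : ContDiff ℝ 2 u) {n : ℕ} (hn : 1 ≤ n)
    (hf : ContDiff ℝ n (lap u)) : ContDiff ℝ (n + 1) u := by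
  have hg : ContDiff ℝ n (cg u) := by
    rw [contDiff_iff_contDiffAt]
    intro z0
    let χ : ContDiffBump z0 := ⟨1, 2, by norm_num, by norm_num⟩
    let h : ℂ → ℂ := fun z => ((χ z * lap u z : ℝ) : ℂ)
    have hh : ContDiff ℝ n h := Complex.ofRealCLM.contDiff.comp (χ.contDiff.mul hf)
    have hs : HasCompactSupport h := by
      have : HasCompactSupport fun z => χ z * lap u z := χ.hasCompactSupport.mul_right
      exact this.comp_left (g := fun x : ℝ => (x : ℂ)) (by simp)
    obtain ⟨q, hq, hdb⟩ := solve_db hn hh hs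
    have hqd : Differentiable ℝ q := hq.differentiable (by exact_mod_cast (by omega))
    have hgd : Differentiable ℝ (cg u) :=
      (contDiff_cg (n := 1) (by exact_mod_cast hu)).differentiable (by norm_num)
    have hhol : DifferentiableOn ℂ (fun z => cg u z - q z) (Metric.ball z0 1) := by
      intro z hz
      apply DifferentiableAt.differentiableWithinAt
      rw [differentiableAt_complex_iff_differentiableAt_real]
      refine ⟨(hgd z).sub (hqd z), ?_⟩
      have h1 : db (fun z => cg u z - q z) z = 0 := by
        rw [db_sub (hgd z) (hqd z), db_cg hu, hdb]
        have : χ z = 1 := χ.one_of_mem_closedBall (Metric.ball_subset_closedBall hz)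
        simp [h, this]
      unfold db dx dy at h1
      rw [smul_eq_mul]
      linear_combination (-Complex.I) * h1 + (fderiv ℝ (fun z => cg u z - q z) z Complex.I) * Complex.I_mul_I
    have h2 : ContDiffOn ℂ n (fun z => cg u z - q z) (Metric.ball z0 1) :=
      hhol.contDiffOn Metric.isOpen_ball
    have h3 : ContDiffAt ℝ n (fun z => cg u z - q z) z0 :=
      (h2.contDiffAt (Metric.ball_mem_nhds z0 one_pos)).restrict_scalars ℝ
    have h4 := h3.add hq.contDiffAt
    refine h4.congr_of_eventuallyEq (Filter.Eventually.of_forall fun z => ?_)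
    simp
  have hx : ContDiff ℝ n (dx u) := by
    have := Complex.reCLM.contDiff.comp hg
    convert this using 1
    funext z; simp [cg]
  have hy : ContDiff ℝ n (dy u) := by
    have := (Complex.imCLM.contDiff.comp hg).neg
    convert this using 1
    funext z; simp [cg]
  rw [contDiff_succ_iff_fderiv]
  refine ⟨hu.differentiable (by norm_num), by simp, ?_⟩
  have : fderiv ℝ u = fun z => dx u z • Complex.reCLM + dy u z • Complex.imCLM := by
    funext z; ext h
    simp [fderiv_eq_dx_dy, mul_comm] 
  rw [this]
  exact (hx.smul contDiff_const).add (hy.smul contDiff_const)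

end MF

namespace MF

/-- integration by parts against a compactly supported function -/
lemma ibp {η : ℂ → ℂ} (hη : ContDiff ℝ 1 η) (hs : HasCompactSupport η) {u : ℂ → ℝ}
    (hu : ContDiff ℝ 1 u) (w : ℂ) :
    ∫ z : ℂ, η z * ((fderiv ℝ u z w : ℝ) : ℂ) = -∫ z : ℂ, fderiv ℝ η z w * (u z : ℂ) := by
  have hu' : ContDiff ℝ 1 fun z => (u z : ℂ) := Complex.ofRealCLM.contDiff.comp hu
  have hc : Continuous (fderiv ℝ u) := hu.continuous_fderiv (by norm_num)
  have hc' : Continuous (fderiv ℝ η) := hη.continuous_fderiv (by norm_num)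
  have hf : ∀ z, fderiv ℝ (fun z => (u z : ℂ)) z w = ((fderiv ℝ u z w : ℝ) : ℂ) := by
    intro z
    rw [(show HasFDerivAt (fun z => (u z : ℂ)) _ z from
      Complex.ofRealCLM.hasFDerivAt.comp z (hu.differentiable (by norm_num) z).hasFDerivAt).fderiv]
    simp
  have := integral_mul_fderiv_eq_neg_fderiv_mul_of_integrable (μ := (volume : Measure ℂ)) (𝕜 := ℂ)
    (f := η) (g := fun z => (u z : ℂ)) (v := w) ?_ ?_ ?_
    (fun x _ => hη.differentiable (by norm_num) x) (fun x _ => hu'.differentiable (by norm_num) x)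
  · simpa only [hf] using this
  · apply Continuous.integrable_of_hasCompactSupport
    · have := hu.continuous
      fun_prop
    · exact (hs.fderiv_apply ℝ w).mul_right
  · simp only [hf]
    apply Continuous.integrable_of_hasCompactSupport
    · have := hη.continuous
      fun_prop
    · exact hs.mul_right
  · apply Continuous.integrable_of_hasCompactSupport
    · have := hη.continuous
      have := hu.continuous
      fun_prop
    · exact hs.mul_right

lemma bound_ibp {η' : ℂ → ℂ} {K : ℝ} (hK : ∀ z, ‖η' z‖ ≤ K)
    (h0 : ∀ z, z ∉ Metric.closedBall (0:ℂ) 1 → η' z = 0) {u : ℂ → ℝ} (hu : Continuous u) :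
    ‖∫ z : ℂ, η' z * (u z : ℂ)‖ ≤ K * ∫ z in Metric.closedBall (0:ℂ) 1, |u z| := by
  rw [← setIntegral_eq_integral_of_forall_compl_eq_zero (s := Metric.closedBall (0:ℂ) 1)
    (fun z hz => by rw [h0 z hz, zero_mul]), ← integral_const_mul]
  apply norm_integral_le_of_norm_le
  · exact (((continuous_const.mul hu.abs)).continuousOn.integrableOn_compact (isCompact_closedBall 0 1))
  · refine Filter.Eventually.of_forall fun z => ?_
    rw [norm_mul, Complex.norm_real, Real.norm_eq_abs]
    exact mul_le_mul_of_nonneg_right (hK z) (abs_nonneg _)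

theorem grad_est : ∃ C : ℝ, 0 < C ∧ ∀ (u : ℂ → ℝ) (_ : ContDiff ℝ 2 u) (z0 : ℂ) (M : ℝ),
    (∀ z ∈ Metric.closedBall z0 1, |lap u z| ≤ M) →
    |dx u z0| ≤ C * (M + ∫ z in Metric.closedBall (0:ℂ) 1, |u (z0 + z)|) ∧
    |dy u z0| ≤ C * (M + ∫ z in Metric.closedBall (0:ℂ) 1, |u (z0 + z)|) := by
  let χ : ContDiffBump (0:ℂ) := ⟨1/2, 1, by norm_num, by norm_num⟩
  let X : ℂ → ℂ := fun z => (χ z : ℂ)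
  have hX : ContDiff ℝ 2 X := Complex.ofRealCLM.contDiff.comp χ.contDiff
  have hXs : HasCompactSupport X := χ.hasCompactSupport.comp_left (g := fun x : ℝ => (x : ℂ)) (by simp)
  have hXt : ∀ z, z ∉ Metric.closedBall (0:ℂ) 1 → z ∉ tsupport X := by
    intro z hz h
    apply hz
    have h1 : tsupport X ⊆ tsupport χ := closure_mono (by
      intro z hz; simp only [Function.mem_support] at hz ⊢
      intro h; apply hz; simp [X, h])
    have := h1 h
    rwa [χ.tsupport_eq] at this
  have hdbX : ContDiff ℝ 1 (db X) :=
    (contDiff_dx (n := 1) (by exact_mod_cast hX)).add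
      (contDiff_const.mul (contDiff_dy (n := 1) (by exact_mod_cast hX)))
  have hdbX0 : ∀ z ∉ tsupport X, db X z = 0 := by
    intro z hz
    have : fderiv ℝ X z = 0 := 
      image_eq_zero_of_notMem_tsupport (fun h => hz (tsupport_fderiv_subset ℝ h))
    simp [db, dx, dy, this]
  let η : ℂ → ℂ := fun z => z⁻¹ * db X z
  have hη : ContDiff ℝ 1 η := by
    rw [contDiff_iff_contDiffAt]
    intro z
    by_cases hz : z = 0
    · subst hz
      have : η =ᶠ[nhds 0] fun _ => 0 := by
        filter_upwards [Metric.ball_mem_nhds (0:ℂ) (show (0:ℝ) < 1/2 by norm_num)] with z hz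
        have h1 : X =ᶠ[nhds z] fun _ => 1 := by
          filter_upwards [Metric.isOpen_ball.mem_nhds hz] with w hw
          have : χ w = 1 := χ.one_of_mem_closedBall (Metric.ball_subset_closedBall hw)
          simp [X, this]
        have h2 : fderiv ℝ X z = 0 := by rw [h1.fderiv_eq]; simp
        simp [η, db, dx, dy, h2]
      exact contDiffAt_const.congr_of_eventuallyEq this
    · exact (contDiffAt_inv ℝ hz).mul hdbX.contDiffAt
  have hη0 : ∀ z, z ∉ tsupport X → η z = 0 := by
    intro z hz
    simp [η, hdbX0 z hz]
  have hηt : tsupport η ⊆ tsupport X := closure_minimal (by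
    intro z hz; by_contra h; exact hz (hη0 z h)) (isClosed_tsupport _)
  have hηs : HasCompactSupport η := hXs.of_isClosed_subset (isClosed_tsupport _) hηt
  have hηf0 : ∀ w z, z ∉ Metric.closedBall (0:ℂ) 1 → fderiv ℝ η z w = 0 := by
    intro w z hz
    have : fderiv ℝ η z = 0 := 
      image_eq_zero_of_notMem_tsupport (fun h => hXt z hz (hηt (tsupport_fderiv_subset ℝ h)))
    simp [this]
  have hKw : ∀ w, ∃ K, ∀ z, ‖fderiv ℝ η z w‖ ≤ K := fun w =>
    (hηs.fderiv_apply ℝ w).exists_bound_of_continuous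
      (by have := hη.continuous_fderiv (by norm_num); fun_prop)
  obtain ⟨K1, hK1⟩ := hKw 1
  obtain ⟨K2, hK2⟩ := hKw Complex.I
  let C1 : ℝ := ∫ z in Metric.closedBall (0:ℂ) 1, ‖z⁻¹‖
  have hC1 : 0 ≤ C1 := integral_nonneg fun z => norm_nonneg _
  have hK10 : 0 ≤ K1 := le_trans (norm_nonneg _) (hK1 0)
  have hK20 : 0 ≤ K2 := le_trans (norm_nonneg _) (hK2 0)
  refine ⟨C1 + K1 + K2 + 1, by linarith, ?_⟩
  intro u hu z0 M hM
  have hM0 : 0 ≤ M := le_trans (abs_nonneg _) (hM z0 (by simp))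
  let U : ℂ → ℝ := fun z => u (z0 + z)
  have hU : ContDiff ℝ 2 U := hu.comp (by fun_prop)
  have hU1 : ContDiff ℝ 1 U := hU.of_le (by norm_num)
  have hcg : ContDiff ℝ 1 (cg U) := contDiff_cg (n := 1) (by exact_mod_cast hU)
  have hcg0 : cg U 0 = cg u z0 := by
    unfold cg
    rw [dx_shift, dy_shift]; simp
  set J := ∫ z in Metric.closedBall (0:ℂ) 1, |U z| with hJ
  have hJ0 : 0 ≤ J := integral_nonneg fun z => abs_nonneg _
  have hcp := cauchy_pompeiu (ψ := fun z => X z * cg U z) ((hX.of_le (by norm_num)).mul hcg) hXs.mul_right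
  have hX0 : X 0 = 1 := by
    have : χ 0 = 1 := χ.one_of_mem_closedBall (by simp [χ.rIn_pos.le])
    simp [X, this]
  rw [hX0, one_mul, hcg0] at hcp
  have hlapc := continuous_lap hU
  have hXc := hX.continuous
  have i1 : Integrable fun z : ℂ => z⁻¹ * (X z * ((lap U z : ℝ) : ℂ)) := by
    have := inv_locInt.integrable_smul_left_of_hasCompactSupport
      (g := fun z : ℂ => X z * ((lap U z : ℝ) : ℂ)) (by fun_prop) hXs.mul_right
    simpa [mul_comm] using this
  have i2 : ∀ w, Integrable fun z : ℂ => η z * ((fderiv ℝ U z w : ℝ) : ℂ) := by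
    intro w
    apply Continuous.integrable_of_hasCompactSupport
    · have := hη.continuous
      have := hU1.continuous_fderiv (by norm_num)
      fun_prop
    · exact hηs.mul_right
  have hsplit : ∫ z : ℂ, z⁻¹ * (dx (fun z => X z * cg U z) z + Complex.I * dy (fun z => X z * cg U z) z)
      = (∫ z : ℂ, z⁻¹ * (X z * ((lap U z : ℝ) : ℂ))) + ((∫ z : ℂ, η z * ((fderiv ℝ U z 1 : ℝ) : ℂ))
        - Complex.I * ∫ z : ℂ, η z * ((fderiv ℝ U z Complex.I : ℝ) : ℂ)) := by
    have i3 : Integrable fun z : ℂ => η z * ((fderiv ℝ U z 1 : ℝ) : ℂ)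
        - Complex.I * (η z * ((fderiv ℝ U z Complex.I : ℝ) : ℂ)) := (i2 1).sub ((i2 _).const_mul _)
    rw [← integral_const_mul, ← integral_sub (i2 1) ((i2 _).const_mul _), ← integral_add i1 i3]
    congr 1; funext z
    have h1 := db_mul (f := X) (g := cg U) (z := z) (hX.differentiable (by norm_num) z)
      (hcg.differentiable (by norm_num) z)
    have h2 : dx (fun z => X z * cg U z) z + Complex.I * dy (fun z => X z * cg U z) z
      = db (fun z => X z * cg U z) z := rfl
    rw [h2, h1, db_cg hU]
    simp only [η, cg, dx, dy]
    ring
  have b1 : ‖∫ z : ℂ, z⁻¹ * (X z * ((lap U z : ℝ) : ℂ))‖ ≤ C1 * M := by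
    rw [← setIntegral_eq_integral_of_forall_compl_eq_zero (s := Metric.closedBall (0:ℂ) 1)
      (fun z hz => by rw [image_eq_zero_of_notMem_tsupport (hXt z hz)]; simp)]
    rw [← integral_mul_const]
    apply norm_integral_le_of_norm_le
    · have : IntegrableOn (fun z : ℂ => z⁻¹) (Metric.closedBall 0 1) :=
        inv_locInt.integrableOn_isCompact (isCompact_closedBall 0 1)
      exact this.norm.mul_const M
    · rw [ae_restrict_iff' Metric.isClosed_closedBall.measurableSet]
      refine Filter.Eventually.of_forall fun z hz => ?_
      rw [norm_mul, norm_mul]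
      apply mul_le_mul_of_nonneg_left _ (norm_nonneg _)
      have h1 : ‖X z‖ ≤ 1 := by
        simp only [X, Complex.norm_real, Real.norm_eq_abs, abs_of_nonneg (χ.nonneg)]
        exact χ.le_one
      have h2 : ‖((lap U z : ℝ) : ℂ)‖ ≤ M := by
        rw [Complex.norm_real, Real.norm_eq_abs]
        show |lap (fun y => u (z0 + y)) z| ≤ M
        rw [lap_shift]
        apply hM
        simpa using hz
      calc _ ≤ 1 * M := mul_le_mul h1 h2 (norm_nonneg _) zero_le_one
        _ = M := one_mul M
  have b2 : ∀ w K, (∀ z, ‖fderiv ℝ η z w‖ ≤ K) →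
      ‖∫ z : ℂ, η z * ((fderiv ℝ U z w : ℝ) : ℂ)‖ ≤ K * J := by
    intro w K hK
    rw [ibp hη hηs hU1, norm_neg]
    exact bound_ibp hK (hηf0 w) hU.continuous
  have b3 : ‖cg u z0‖ ≤ (C1 + K1 + K2 + 1) * (M + J) := by
    have e1 : 2 * π * ‖cg u z0‖ ≤ C1 * M + (K1 * J + K2 * J) := by
      have : 2 * π * ‖cg u z0‖ = ‖-(2 * (π:ℂ) * cg u z0)‖ := by
        rw [norm_neg, norm_mul, norm_mul, Complex.norm_real]
        simp [abs_of_nonneg pi_pos.le]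
      rw [this, ← hcp, hsplit]
      refine (norm_add_le _ _).trans (add_le_add b1 ((norm_sub_le _ _).trans (add_le_add (b2 _ _ hK1) ?_)))
      rw [norm_mul, Complex.norm_I, one_mul]
      exact b2 _ _ hK2
    have e2 : ‖cg u z0‖ ≤ 2 * π * ‖cg u z0‖ := by
      have := pi_gt_three
      nlinarith [norm_nonneg (cg u z0)]
    nlinarith [mul_nonneg hC1 hJ0, mul_nonneg hK10 hM0, mul_nonneg hK20 hM0]
  have c1 : |dx u z0| ≤ ‖cg u z0‖ := by
    have := Complex.abs_re_le_norm (cg u z0)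
    simpa [cg] using this
  have c2 : |dy u z0| ≤ ‖cg u z0‖ := by
    have := Complex.abs_im_le_norm (cg u z0)
    simpa [cg] using this
  exact ⟨c1.trans b3, c2.trans b3⟩

end MF

namespace MF

lemma polar_integrableOn {f : ℂ → ℝ} (hf : Integrable f) :
    IntegrableOn (fun p : ℝ × ℝ => p.1 * f (Complex.polarCoord.symm p))
      (Set.Ioi 0 ×ˢ Set.Ioo (-π) π) := by
  have h1 : Integrable (fun p : ℝ × ℝ => f (Complex.measurableEquivRealProd.symm p)) :=
    (Complex.volume_preserving_equiv_real_prod.symm).integrable_comp_of_integrable hf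
  have h2 : IntegrableOn (fun p : ℝ × ℝ => f (Complex.measurableEquivRealProd.symm p))
      (polarCoord.symm '' polarCoord.target) := h1.integrableOn
  rw [integrableOn_image_iff_integrableOn_abs_det_fderiv_smul volume
    polarCoord.open_target.measurableSet
    (fun p _ => (hasFDerivAt_polarCoord_symm p).hasFDerivWithinAt) polarCoord.symm.injOn] at h2
  refine h2.congr_fun ?_ polarCoord.open_target.measurableSet
  rintro ⟨r, θ⟩ ⟨hr, -⟩
  have hr : (0:ℝ) < r := hr
  simp only [det_fderivPolarCoordSymm, smul_eq_mul, abs_of_pos hr,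
    Complex.measurableEquivRealProd_symm_polarCoord_symm_apply]

/-- integral in logarithmic polar coordinates -/
lemma polar_circ {f : ℂ → ℝ} (hf : Integrable f) :
    IntegrableOn (fun r : ℝ => r * circ (fun z => f (Complex.exp z)) (log r)) (Set.Ioi 0) ∧
    ∫ z, f z = ∫ r in Set.Ioi (0:ℝ), r * circ (fun z => f (Complex.exp z)) (log r) := by
  have hi := polar_integrableOn hf
  have hper : Per (fun z => f (Complex.exp z)) := by
    intro z
    simp only [Complex.exp_periodic z]
  have key : ∀ r ∈ Set.Ioi (0:ℝ), ∫ θ in Set.Ioo (-π) π, r * f (Complex.polarCoord.symm (r, θ))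
      = r * circ (fun z => f (Complex.exp z)) (log r) := by
    intro r hr
    have hr : (0:ℝ) < r := hr
    rw [integral_const_mul, ← integral_Ioc_eq_integral_Ioo,
      ← intervalIntegral.integral_of_le (by linarith [pi_pos]), ← circ_eq_shift hper (log r) (-π)]
    congr 1
    rw [show -π + 2 * π = π by ring]
    congr 1; funext θ
    rw [cis_symm, Complex.exp_add, ← Complex.ofReal_exp, exp_log hr]
  rw [Measure.volume_eq_prod] at hi
  refine ⟨?_, ?_⟩
  · have h2 := hi.integrable
    rw [← Measure.prod_restrict] at h2
    replace h2 := h2.integral_prod_left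
    refine Integrable.congr h2 ?_
    rw [Filter.EventuallyEq, ae_restrict_iff' measurableSet_Ioi]
    exact Filter.Eventually.of_forall fun r hr => key r hr
  · rw [← Complex.integral_comp_polarCoord_symm]
    rw [show polarCoord.target = Set.Ioi (0:ℝ) ×ˢ Set.Ioo (-π) π from rfl]
    simp only [smul_eq_mul]
    rw [Measure.volume_eq_prod, setIntegral_prod _ hi]
    exact setIntegral_congr_fun measurableSet_Ioi key

section expcomp

lemma hasFDerivAt_cexp (z : ℂ) :
    HasFDerivAt Complex.exp (Complex.exp z • (1 : ℂ →L[ℝ] ℂ)) z := by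
  exact ((Complex.hasDerivAt_exp z).hasFDerivAt.restrictScalars ℝ).congr_fderiv
    (by ext w <;> simp [mul_comm])

lemma contDiff_cexp {n : WithTop ℕ∞} : ContDiff ℝ n Complex.exp :=
  (Complex.contDiff_exp (𝕜 := ℂ)).restrict_scalars ℝ

lemma exp_re_hasF : dx (fun z : ℂ => (Complex.exp z).re) = (fun z => (Complex.exp z).re) ∧
    dy (fun z : ℂ => (Complex.exp z).re) = (fun z => -(Complex.exp z).im) := by
  constructor <;> funext z <;> simp only [dx, dy] <;>
  rw [(show HasFDerivAt (fun z => (Complex.exp z).re) _ z from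
    Complex.reCLM.hasFDerivAt.comp z (hasFDerivAt_cexp z)).fderiv] <;> simp

lemma exp_im_hasF : dx (fun z : ℂ => (Complex.exp z).im) = (fun z => (Complex.exp z).im) ∧
    dy (fun z : ℂ => (Complex.exp z).im) = (fun z => (Complex.exp z).re) := by
  constructor <;> funext z <;> simp only [dx, dy] <;>
  rw [(show HasFDerivAt (fun z => (Complex.exp z).im) _ z from
    Complex.imCLM.hasFDerivAt.comp z (hasFDerivAt_cexp z)).fderiv] <;> simp

variable {f : ℂ → ℝ}

lemma dx_exp (hf : Differentiable ℝ f) : dx (fun z => f (Complex.exp z)) =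
    fun z => (Complex.exp z).re * dx f (Complex.exp z) + (Complex.exp z).im * dy f (Complex.exp z) := by
  funext z
  show fderiv ℝ _ z 1 = _
  rw [(show HasFDerivAt (fun z => f (Complex.exp z)) _ z from
    (hf _).hasFDerivAt.comp z (hasFDerivAt_cexp z)).fderiv]
  simp [fderiv_eq_dx_dy]

lemma dy_exp (hf : Differentiable ℝ f) : dy (fun z => f (Complex.exp z)) =
    fun z => -(Complex.exp z).im * dx f (Complex.exp z) + (Complex.exp z).re * dy f (Complex.exp z) := by
  funext z
  show fderiv ℝ _ z Complex.I = _
  rw [(show HasFDerivAt (fun z => f (Complex.exp z)) _ z from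
    (hf _).hasFDerivAt.comp z (hasFDerivAt_cexp z)).fderiv]
  simp [fderiv_eq_dx_dy]

lemma exp_re_im_sq (z : ℂ) : (Complex.exp z).re ^ 2 + (Complex.exp z).im ^ 2 = exp (2 * z.re) := by
  have h := Complex.norm_exp z
  have h2 := Complex.sq_norm (Complex.exp z)
  rw [Complex.normSq_apply, h, ← exp_nat_mul] at h2
  push_cast at h2
  rw [h2]; ring

lemma contDiff_exp_comp {n : WithTop ℕ∞} (hf : ContDiff ℝ n f) :
    ContDiff ℝ n (fun z => f (Complex.exp z)) := hf.comp contDiff_cexp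

lemma per_exp (f : ℂ → ℝ) : Per (fun z => f (Complex.exp z)) := by
  intro z
  simp only [Complex.exp_periodic z]

/-- second derivatives in logarithmic polar coordinates -/
lemma second_exp (hf : ContDiff ℝ 2 f) (z : ℂ) :
    dx (dx (fun z => f (Complex.exp z))) z =
      ((Complex.exp z).re * dx f (Complex.exp z) + (Complex.exp z).im * dy f (Complex.exp z)) +
      (Complex.exp z).re ^ 2 * dx (dx f) (Complex.exp z)
      + 2 * (Complex.exp z).re * (Complex.exp z).im * dy (dx f) (Complex.exp z)
      + (Complex.exp z).im ^ 2 * dy (dy f) (Complex.exp z)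
    ∧ dy (dy (fun z => f (Complex.exp z))) z =
      -((Complex.exp z).re * dx f (Complex.exp z) + (Complex.exp z).im * dy f (Complex.exp z)) +
      (Complex.exp z).im ^ 2 * dx (dx f) (Complex.exp z)
      - 2 * (Complex.exp z).re * (Complex.exp z).im * dy (dx f) (Complex.exp z)
      + (Complex.exp z).re ^ 2 * dy (dy f) (Complex.exp z)
    ∧ dx (dy (fun z => f (Complex.exp z))) z =
      (-(Complex.exp z).im * dx f (Complex.exp z) + (Complex.exp z).re * dy f (Complex.exp z)) -
      (Complex.exp z).re * (Complex.exp z).im * dx (dx f) (Complex.exp z)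
      + ((Complex.exp z).re ^ 2 - (Complex.exp z).im ^ 2) * dy (dx f) (Complex.exp z)
      + (Complex.exp z).re * (Complex.exp z).im * dy (dy f) (Complex.exp z) := by
  have hfd : Differentiable ℝ f := hf.differentiable (by norm_num)
  have h1 : Differentiable ℝ (dx f) :=
    (contDiff_dx (n := 1) (by exact_mod_cast hf)).differentiable (by norm_num)
  have h2 : Differentiable ℝ (dy f) :=
    (contDiff_dy (n := 1) (by exact_mod_cast hf)).differentiable (by norm_num)
  have hE : Differentiable ℝ Complex.exp := contDiff_cexp.differentiable (n := 1) (by norm_num)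
  have hr : Differentiable ℝ (fun z : ℂ => (Complex.exp z).re) := Complex.reCLM.differentiable.comp hE
  have hi : Differentiable ℝ (fun z : ℂ => (Complex.exp z).im) := Complex.imCLM.differentiable.comp hE
  have hi' : Differentiable ℝ (fun z : ℂ => -(Complex.exp z).im) := hi.neg
  have hx : Differentiable ℝ (fun z : ℂ => dx f (Complex.exp z)) := h1.comp hE
  have hy : Differentiable ℝ (fun z : ℂ => dy f (Complex.exp z)) := h2.comp hE
  have hcomm : dx (dy f) = dy (dx f) := dx_dy_comm hf
  have n1 : dx (fun z : ℂ => -(Complex.exp z).im) = fun z => -(Complex.exp z).im := by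
    have := exp_im_hasF.1
    funext z
    have := congrFun this z
    unfold dx at *
    rw [fderiv_fun_neg]; simpa using this
  have n2 : dy (fun z : ℂ => -(Complex.exp z).im) = fun z => -(Complex.exp z).re := by
    have := exp_im_hasF.2
    funext z
    have := congrFun this z
    unfold dy at *
    rw [fderiv_fun_neg]; simpa using this
  rw [dx_exp hfd, dy_exp hfd]
  rw [dx_add (hr.fun_mul hx) (hi.fun_mul hy), dy_add (hi'.fun_mul hx) (hr.fun_mul hy),
    dx_add (hi'.fun_mul hx) (hr.fun_mul hy)]
  rw [dx_mul hr hx, dx_mul hi hy, dy_mul hi' hx, dy_mul hr hy, dx_mul hi' hx, dx_mul hr hy]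
  rw [dx_exp h1, dx_exp h2, dy_exp h1, dy_exp h2, n1, n2, exp_im_hasF.1, exp_re_hasF.1, exp_re_hasF.2, hcomm]
  refine ⟨?_, ?_, ?_⟩ <;> ring

lemma lap_exp (hf : ContDiff ℝ 2 f) (z : ℂ) :
    lap (fun z => f (Complex.exp z)) z = exp (2 * z.re) * lap f (Complex.exp z) := by
  obtain ⟨h1, h2, -⟩ := second_exp hf z
  unfold lap
  rw [h1, h2, ← exp_re_im_sq]
  ring

end expcomp

end MF

namespace MF

lemma circ_abs_le {S : ℂ → ℝ} {t c : ℝ} (h : ∀ z : ℂ, z.re = t → |S z| ≤ c) :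
    |circ S t| ≤ 2 * π * c := by
  unfold circ
  have := intervalIntegral.norm_integral_le_of_norm_le_const (a := 0) (b := 2 * π) (C := c)
    (f := fun θ : ℝ => S ((t : ℂ) + θ * Complex.I)) (fun θ _ => by
      rw [Real.norm_eq_abs]; apply h; simp)
  rw [Real.norm_eq_abs, sub_zero, abs_of_nonneg two_pi_nonneg] at this
  linarith

lemma circ_sub {S T : ℂ → ℝ} (hS : Continuous S) (hT : Continuous T) (t : ℝ) :
    circ (fun z => S z - T z) t = circ S t - circ T t :=
  intervalIntegral.integral_sub (circ_integrable hS t _ _) (circ_integrable hT t _ _)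

lemma circ_mul (c : ℝ) (S : ℂ → ℝ) (t : ℝ) :
    circ (fun z => c * S z) t = c * circ S t :=
  intervalIntegral.integral_const_mul _ _

lemma dx_exp_bound {f : ℂ → ℝ} (hf : ContDiff ℝ 1 f) :
    ∃ K : ℝ, 0 ≤ K ∧ ∀ z : ℂ, z.re ≤ 0 → |dx (fun z => f (Complex.exp z)) z| ≤ K * exp z.re := by
  have hd : Differentiable ℝ f := hf.differentiable (by norm_num)
  have hcx : Continuous (dx f) := (contDiff_dx (n := 0) (by exact_mod_cast hf)).continuous
  have hcy : Continuous (dy f) := (contDiff_dy (n := 0) (by exact_mod_cast hf)).continuous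
  obtain ⟨K1, hK1⟩ := (isCompact_closedBall (0:ℂ) 1).exists_bound_of_continuousOn hcx.continuousOn
  obtain ⟨K2, hK2⟩ := (isCompact_closedBall (0:ℂ) 1).exists_bound_of_continuousOn hcy.continuousOn
  have hK10 : 0 ≤ K1 := le_trans (norm_nonneg _) (hK1 0 (by simp))
  have hK20 : 0 ≤ K2 := le_trans (norm_nonneg _) (hK2 0 (by simp))
  refine ⟨K1 + K2, by linarith, fun z hz => ?_⟩
  have hm : Complex.exp z ∈ Metric.closedBall (0:ℂ) 1 := by
    simp [Complex.norm_exp, hz]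
  rw [dx_exp hd]
  have h1 := Complex.abs_re_le_norm (Complex.exp z)
  have h2 := Complex.abs_im_le_norm (Complex.exp z)
  rw [Complex.norm_exp] at h1 h2
  have h3 := hK1 _ hm
  have h4 := hK2 _ hm
  rw [Real.norm_eq_abs] at h3 h4
  refine (abs_add_le _ _).trans ?_
  rw [abs_mul, abs_mul]
  have := mul_le_mul h1 h3 (abs_nonneg _) (exp_pos _).le
  have := mul_le_mul h2 h4 (abs_nonneg _) (exp_pos _).le
  linarith

lemma circ_dx_exp_tendsto {f : ℂ → ℝ} (hf : ContDiff ℝ 1 f) :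
    Filter.Tendsto (circ (dx (fun z => f (Complex.exp z)))) Filter.atBot (nhds 0) := by
  obtain ⟨K, hK0, hK⟩ := dx_exp_bound hf
  have h1 : Filter.Tendsto (fun t : ℝ => 2 * π * (K * exp t)) Filter.atBot (nhds 0) := by
    have := (Real.tendsto_exp_atBot.const_mul K).const_mul (2 * π)
    simpa using this
  refine squeeze_zero_norm' ?_ h1
  filter_upwards [Filter.eventually_le_atBot 0] with t ht
  rw [Real.norm_eq_abs]
  apply circ_abs_le
  intro z hz
  have := hK z (by rw [hz]; exact ht)
  rwa [hz] at this

lemma circ_exp_tendsto {f : ℂ → ℝ} (hf : Continuous f) :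
    Filter.Tendsto (circ (fun z => f (Complex.exp z))) Filter.atBot (nhds (2 * π * f 0)) := by
  rw [Metric.tendsto_nhds]
  intro ε hε
  have h1 := Metric.continuousAt_iff.1 (hf.continuousAt (x := 0)) (ε / (4 * π)) (by positivity)
  obtain ⟨δ, hδ, h1⟩ := h1
  have h2 : ∀ᶠ t : ℝ in Filter.atBot, exp t < δ :=
    (Real.tendsto_exp_atBot.eventually (gt_mem_nhds hδ))
  filter_upwards [h2] with t ht
  rw [Real.dist_eq, ← circ_const (f 0) t, ← circ_sub (S := fun z => f (Complex.exp z)) (hf.comp Complex.continuous_exp) continuous_const]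
  have := circ_abs_le (S := fun z => f (Complex.exp z) - f 0) (t := t) (c := ε / (4 * π)) (by
    intro z hz
    have := h1 (x := Complex.exp z) (by rw [dist_zero_right, Complex.norm_exp, hz]; exact ht)
    rw [Real.dist_eq] at this
    exact this.le)
  refine lt_of_le_of_lt this ?_
  have : 2 * π * (ε / (4 * π)) = ε / 2 := by field_simp; norm_num
  rw [this]; linarith

lemma sub_mean_circ {G : ℂ → ℝ} (hG : ContDiff ℝ 2 G) {s : ℝ}
    (h : ∀ z ∈ Metric.ball (0:ℂ) s, 0 ≤ lap G z) {t : ℝ} (ht : exp t < s) :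
    2 * π * G 0 ≤ circ (fun z => G (Complex.exp z)) t := by
  let S : ℂ → ℝ := fun z => G (Complex.exp z)
  have hS : ContDiff ℝ 2 S := contDiff_exp_comp hG
  have hS1 : ContDiff ℝ 1 S := hS.of_le (by norm_num)
  have hP : Per S := per_exp G
  have hmono : MonotoneOn (circ (dx S)) (Set.Iic t) := by
    apply monotoneOn_of_deriv_nonneg (convex_Iic t)
    · exact fun x _ => (circ_hasDerivAt2 hS hP x).continuousAt.continuousWithinAt
    · exact fun x _ => (circ_hasDerivAt2 hS hP x).differentiableAt.differentiableWithinAt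
    · intro x hx
      rw [interior_Iic] at hx
      rw [(circ_hasDerivAt2 hS hP x).deriv]
      apply circ_nonneg
      intro z hz
      rw [lap_exp hG]
      apply mul_nonneg (exp_pos _).le
      apply h
      simp only [Metric.mem_ball, dist_zero_right, Complex.norm_exp, hz]
      exact lt_trans (exp_lt_exp.2 hx) ht
  have hnn : ∀ x ∈ Set.Iic t, 0 ≤ circ (dx S) x := by
    intro x hx
    refine le_of_tendsto (circ_dx_exp_tendsto (hG.of_le (by norm_num))) ?_
    filter_upwards [Filter.eventually_le_atBot x] with y hy
    exact hmono (le_trans hy hx) hx hy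
  have hmono2 : MonotoneOn (circ S) (Set.Iic t) := by
    apply monotoneOn_of_deriv_nonneg (convex_Iic t)
    · exact fun x _ => (circ_hasDerivAt hS1 x).continuousAt.continuousWithinAt
    · exact fun x _ => (circ_hasDerivAt hS1 x).differentiableAt.differentiableWithinAt
    · intro x hx
      rw [interior_Iic] at hx
      rw [(circ_hasDerivAt hS1 x).deriv]
      exact hnn x (Set.Iio_subset_Iic_self hx)
  refine le_of_tendsto (circ_exp_tendsto hG.continuous) ?_
  filter_upwards [Filter.eventually_le_atBot t] with y hy
  exact hmono2 hy Set.self_mem_Iic hy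

lemma sub_mean0 {G : ℂ → ℝ} (hG : ContDiff ℝ 2 G) {s : ℝ} (hs : 0 < s)
    (h : ∀ z ∈ Metric.ball (0:ℂ) s, 0 ≤ lap G z) :
    π * s ^ 2 * G 0 ≤ ∫ z in Metric.ball (0:ℂ) s, G z := by
  let f : ℂ → ℝ := (Metric.ball (0:ℂ) s).indicator G
  have hf : Integrable f := by
    rw [integrable_indicator_iff Metric.isOpen_ball.measurableSet]
    exact (hG.continuous.continuousOn.integrableOn_compact (isCompact_closedBall 0 s)).mono_set
      Metric.ball_subset_closedBall
  obtain ⟨h1, h2⟩ := polar_circ hf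
  have h3 : ∫ z, f z = ∫ z in Metric.ball (0:ℂ) s, G z :=
    integral_indicator Metric.isOpen_ball.measurableSet
  rw [← h3, h2]
  have hin : ∀ r : ℝ, 0 < r → r < s → circ (fun z => f (Complex.exp z)) (log r) =
      circ (fun z => G (Complex.exp z)) (log r) := by
    intro r hr hrs
    unfold circ
    congr 1; funext θ
    apply Set.indicator_of_mem
    simp [Complex.norm_exp, exp_log hr, hrs]
  have hout : ∀ r : ℝ, 0 < r → s ≤ r → circ (fun z => f (Complex.exp z)) (log r) = 0 := by
    intro r hr hrs
    unfold circ
    rw [show (fun θ : ℝ => f (Complex.exp ((log r : ℂ) + θ * Complex.I))) = fun _ => 0 from ?_]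
    · simp
    funext θ
    apply Set.indicator_of_notMem
    simp [Complex.norm_exp, exp_log hr, hrs]
  have h4 : ∫ r in Set.Ioi (0:ℝ), (Set.Ioo 0 s).indicator (fun r => r * (2 * π * G 0)) r = π * s ^ 2 * G 0 := by
    rw [setIntegral_indicator measurableSet_Ioo,
      Set.inter_eq_self_of_subset_right Set.Ioo_subset_Ioi_self, ← integral_Ioc_eq_integral_Ioo,
      ← intervalIntegral.integral_of_le hs.le, intervalIntegral.integral_mul_const, integral_id]
    ring
  rw [← h4]
  apply setIntegral_mono_on _ h1 measurableSet_Ioi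
  · intro r hr
    have hr : (0:ℝ) < r := hr
    by_cases hrs : r < s
    · rw [Set.indicator_of_mem (show r ∈ Set.Ioo 0 s from ⟨hr, hrs⟩), hin r hr hrs]
      apply mul_le_mul_of_nonneg_left _ hr.le
      exact sub_mean_circ hG h (by rw [exp_log hr]; exact hrs)
    · rw [Set.indicator_of_notMem (fun h => hrs h.2), hout r hr (not_lt.1 hrs)]; simp
  · apply Integrable.integrableOn
    rw [integrable_indicator_iff measurableSet_Ioo]
    exact (Continuous.integrableOn_Icc (by fun_prop)).mono_set Set.Ioo_subset_Icc_self

lemma sub_mean {G : ℂ → ℝ} (hG : ContDiff ℝ 2 G) (z0 : ℂ) {s : ℝ} (hs : 0 < s)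
    (h : ∀ z ∈ Metric.ball z0 s, 0 ≤ lap G z) :
    π * s ^ 2 * G z0 ≤ ∫ z in Metric.ball (0:ℂ) s, G (z0 + z) := by
  have := sub_mean0 (G := fun z => G (z0 + z)) (hG.comp (by fun_prop)) hs (by
    intro z hz
    rw [lap_shift]
    apply h
    simpa using hz)
  simpa using this

end MF

namespace MF

lemma ball_le_circ {G : ℂ → ℝ} (hG : Continuous G) (hp : Per G) (h0 : ∀ z, 0 ≤ G z) (y : ℂ) :
    ∫ z in Metric.closedBall (0:ℂ) 1, G (y + z) ≤ ∫ t in (y.re - 1)..(y.re + 1), circ G t := by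
  let B : Set ℂ := Complex.measurableEquivRealProd ⁻¹' (Set.Icc (-1:ℝ) 1 ×ˢ Set.Icc (-π) π)
  have hGy : Continuous fun z => G (y + z) := by fun_prop
  have hBc : IsCompact B := by
    have : IsCompact (Complex.equivRealProdCLM.symm '' (Set.Icc (-1:ℝ) 1 ×ˢ Set.Icc (-π) π)) :=
      (isCompact_Icc.prod isCompact_Icc).image Complex.equivRealProdCLM.symm.continuous
    convert this using 1
    ext z
    simp only [B, Set.mem_preimage, Set.mem_image]
    constructor
    · intro h
      exact ⟨_, h, by apply Complex.ext <;> simp⟩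
    · rintro ⟨p, hp, rfl⟩
      simpa using hp
  have hsub : Metric.closedBall (0:ℂ) 1 ⊆ B := by
    intro z hz
    have hz : ‖z‖ ≤ 1 := by simpa using hz
    have h1 := abs_le.1 ((Complex.abs_re_le_norm z).trans hz)
    have h2 := abs_le.1 ((Complex.abs_im_le_norm z).trans hz)
    have := pi_gt_three
    refine ⟨⟨h1.1, h1.2⟩, ⟨?_, ?_⟩⟩
    · show -π ≤ z.im
      linarith [h2.1]
    · show z.im ≤ π
      linarith [h2.2]
  have h1 : ∫ z in Metric.closedBall (0:ℂ) 1, G (y + z) ≤ ∫ z in B, G (y + z) := by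
    apply setIntegral_mono_set (hGy.continuousOn.integrableOn_compact hBc)
    · exact Filter.Eventually.of_forall fun z => h0 _
    · exact hsub.eventuallyLE
  refine h1.trans (le_of_eq ?_)
  have h2 := Complex.volume_preserving_equiv_real_prod.setIntegral_preimage_emb
    Complex.measurableEquivRealProd.measurableEmbedding
    (fun p : ℝ × ℝ => G (y + (p.1 + p.2 * Complex.I))) (Set.Icc (-1:ℝ) 1 ×ˢ Set.Icc (-π) π)
  have h3 : ∀ z : ℂ, ((Complex.measurableEquivRealProd z).1 : ℂ) + (Complex.measurableEquivRealProd z).2 * Complex.I = z := by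
    intro z; apply Complex.ext <;> simp
  simp only [h3] at h2
  rw [h2, Measure.volume_eq_prod, setIntegral_prod]
  · have h4 : ∀ a : ℝ, ∫ b in Set.Icc (-π) π, G (y + (a + b * Complex.I)) = circ G (y.re + a) := by
      intro a
      rw [integral_Icc_eq_integral_Ioc, ← intervalIntegral.integral_of_le (by linarith [pi_pos]),
        ← circ_eq_shift hp (y.re + a) (y.im - π)]
      have := intervalIntegral.integral_comp_add_left (a := -π) (b := π)
        (fun θ : ℝ => G (((y.re + a : ℝ) : ℂ) + θ * Complex.I)) y.im
      rw [show y.im - π = y.im + -π by ring, show y.im + -π + 2 * π = y.im + π by ring, ← this]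
      congr 1; funext b; congr 1
      apply Complex.ext <;> simp
    simp only [h4]
    rw [integral_Icc_eq_integral_Ioc, ← intervalIntegral.integral_of_le (by norm_num),
      intervalIntegral.integral_comp_add_left (fun t => circ G t)]
    ring_nf
  · exact (Continuous.continuousOn (by fun_prop)).integrableOn_compact (isCompact_Icc.prod isCompact_Icc)

lemma lap_normSq (c : ℝ) (z : ℂ) : lap (fun z : ℂ => c * (z.re * z.re + z.im * z.im)) z = 4 * c := by
  have hr : Differentiable ℝ (fun z : ℂ => z.re) := Complex.reCLM.differentiable
  have hi : Differentiable ℝ (fun z : ℂ => z.im) := Complex.imCLM.differentiable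
  have e1 : dx (fun z : ℂ => z.re) = fun _ => 1 := by
    funext z; unfold dx; rw [(show HasFDerivAt (fun z : ℂ => z.re) _ z from Complex.reCLM.hasFDerivAt).fderiv]; simp
  have e2 : dy (fun z : ℂ => z.re) = fun _ => 0 := by
    funext z; unfold dy; rw [(show HasFDerivAt (fun z : ℂ => z.re) _ z from Complex.reCLM.hasFDerivAt).fderiv]; simp
  have e3 : dx (fun z : ℂ => z.im) = fun _ => 0 := by
    funext z; unfold dx; rw [(show HasFDerivAt (fun z : ℂ => z.im) _ z from Complex.imCLM.hasFDerivAt).fderiv]; simp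
  have e4 : dy (fun z : ℂ => z.im) = fun _ => 1 := by
    funext z; unfold dy; rw [(show HasFDerivAt (fun z : ℂ => z.im) _ z from Complex.imCLM.hasFDerivAt).fderiv]; simp
  have hc : ∀ d : ℝ, dx (fun _ : ℂ => d) = fun _ => 0 := by intro d; funext z; simp [dx]
  have hc' : ∀ d : ℝ, dy (fun _ : ℂ => d) = fun _ => 0 := by intro d; funext z; simp [dy]
  have k : Differentiable ℝ (fun _ : ℂ => c) := differentiable_const c
  have k1 : Differentiable ℝ (fun _ : ℂ => (1:ℝ)) := differentiable_const 1
  unfold lap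
  have d1 : dx (fun z : ℂ => c * (z.re * z.re + z.im * z.im)) = fun z => (2 * c) * z.re := by
    rw [dx_mul k ((hr.fun_mul hr).fun_add (hi.fun_mul hi)), dx_add (hr.fun_mul hr) (hi.fun_mul hi),
      dx_mul hr hr, dx_mul hi hi, e1, e3, hc]
    funext z; ring
  have d2 : dy (fun z : ℂ => c * (z.re * z.re + z.im * z.im)) = fun z => (2 * c) * z.im := by
    rw [dy_mul k ((hr.fun_mul hr).fun_add (hi.fun_mul hi)), dy_add (hr.fun_mul hr) (hi.fun_mul hi),
      dy_mul hr hr, dy_mul hi hi, e2, e4, hc']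
    funext z; ring
  rw [d1, d2, dx_mul (differentiable_const _) hr, dy_mul (differentiable_const _) hi, e1, e4, hc, hc']
  ring

lemma lap_add {f g : ℂ → ℝ} (hf : ContDiff ℝ 2 f) (hg : ContDiff ℝ 2 g) (z : ℂ) :
    lap (fun z => f z + g z) z = lap f z + lap g z := by
  have a1 := (contDiff_dx (n := 1) (f := f) (by exact_mod_cast hf)).differentiable (by norm_num)
  have a2 := (contDiff_dy (n := 1) (f := f) (by exact_mod_cast hf)).differentiable (by norm_num)
  have a3 := (contDiff_dx (n := 1) (f := g) (by exact_mod_cast hg)).differentiable (by norm_num)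
  have a4 := (contDiff_dy (n := 1) (f := g) (by exact_mod_cast hg)).differentiable (by norm_num)
  unfold lap
  rw [dx_add (hf.differentiable (by norm_num)) (hg.differentiable (by norm_num)),
    dy_add (hf.differentiable (by norm_num)) (hg.differentiable (by norm_num)),
    dx_add a1 a3, dy_add a2 a4]
  ring

/-- sub-mean value with quadratic error -/
lemma sub_mean_err {G : ℂ → ℝ} (hG : ContDiff ℝ 2 G) (x : ℂ) {s A : ℝ} (hs : 0 < s)
    (h : ∀ z ∈ Metric.ball x s, -(16 * A ^ 2) ≤ lap G z) :
    π * s ^ 2 * G x ≤ (∫ z in Metric.ball (0:ℂ) s, G (x + z)) + 4 * π * A ^ 2 * s ^ 4 := by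
  let N : ℂ → ℝ := fun z => (4 * A ^ 2) * (z.re * z.re + z.im * z.im)
  have hr : ContDiff ℝ 2 (fun z : ℂ => z.re) := Complex.reCLM.contDiff
  have hi : ContDiff ℝ 2 (fun z : ℂ => z.im) := Complex.imCLM.contDiff
  have hN : ContDiff ℝ 2 N := contDiff_const.mul ((hr.mul hr).add (hi.mul hi))
  have hG1 : ContDiff ℝ 2 (fun z => G (x + z)) := hG.comp (by fun_prop)
  have h1 := sub_mean0 (G := fun z => G (x + z) + N z) (hG1.add hN) hs (by
    intro z hz
    rw [lap_add hG1 hN, lap_normSq, lap_shift]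
    have := h (x + z) (by simpa using hz)
    linarith)
  have i0 : ∀ f : ℂ → ℝ, Continuous f → IntegrableOn f (Metric.ball (0:ℂ) s) := fun f hf =>
    (hf.continuousOn.integrableOn_compact (isCompact_closedBall 0 s)).mono_set
      Metric.ball_subset_closedBall
  rw [integral_add (i0 _ hG1.continuous) (i0 _ hN.continuous)] at h1
  have h2 : ∫ z in Metric.ball (0:ℂ) s, N z ≤ ∫ z in Metric.ball (0:ℂ) s, 4 * A ^ 2 * s ^ 2 := by
    apply setIntegral_mono_on (i0 _ hN.continuous) (i0 _ continuous_const) Metric.isOpen_ball.measurableSet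
    intro z hz
    have hz : ‖z‖ < s := by simpa using hz
    have h3 := Complex.sq_norm z
    rw [Complex.normSq_apply] at h3
    simp only [N]
    rw [← h3]
    have := norm_nonneg z
    gcongr
  have h4 : ∫ z in Metric.ball (0:ℂ) s, 4 * A ^ 2 * s ^ 2 = 4 * π * A ^ 2 * s ^ 4 := by
    rw [setIntegral_const, Measure.real, Complex.volume_ball]
    simp [hs.le]
    ring
  have h5 : N 0 = 0 := by simp [N]
  simp only [h5, add_zero] at h1
  linarith

/-- epsilon regularity -/
theorem eps_reg {G : ℂ → ℝ} (hG : ContDiff ℝ 2 G) (hpos : ∀ z, 0 < G z)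
    (hlap : ∀ z, -(G z) ^ 2 ≤ lap G z) (y : ℂ) {m : ℝ}
    (hm : ∫ z in Metric.closedBall (0:ℂ) 1, G (y + z) ≤ m) (hm' : m < π / 16) :
    G y ≤ 8 / π * m := by
  have hGc := hG.continuous
  obtain ⟨x, hx, hmax⟩ := (isCompact_closedBall y 1).exists_isMaxOn (by simp)
    (f := fun z => (1 - dist z y) ^ 2 * G z) (Continuous.continuousOn (by fun_prop))
  have hmax : ∀ z ∈ Metric.closedBall y 1, (1 - dist z y) ^ 2 * G z ≤ (1 - dist x y) ^ 2 * G x := hmax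
  set σ := 1 - dist x y with hσ
  have hy := hmax y (by simp)
  simp at hy
  have hσ0 : 0 < σ := by
    have h1 : 0 ≤ σ := by
      have : dist x y ≤ 1 := hx
      linarith
    rcases h1.lt_or_eq with h | h
    · exact h
    · rw [← h] at hy
      have := hpos y
      simp at hy; linarith
  set A := G x with hA
  have hA0 : 0 < A := hpos x
  have key : ∀ s : ℝ, 0 < s → s ≤ σ / 2 → π * s ^ 2 * A ≤ m + 4 * π * A ^ 2 * s ^ 4 := by
    intro s hs hs'
    have h1 := sub_mean_err hG x (s := s) (A := A) hs (by
      intro z hz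
      have hz : dist z x < s := hz
      have h2 := dist_triangle z x y
      have h3 := hmax z (by show dist z y ≤ 1; linarith)
      have h4 : σ / 2 ≤ 1 - dist z y := by linarith
      have h5 : G z ≤ 4 * A := by
        have h6 : (σ / 2) ^ 2 * G z ≤ σ ^ 2 * A := by
          refine le_trans ?_ h3
          have := (hpos z).le
          gcongr
        have : σ ^ 2 * G z ≤ σ ^ 2 * (4 * A) := by nlinarith
        exact le_of_mul_le_mul_left this (by positivity)
      have h7 := hlap z
      have := hpos z
      nlinarith)
    refine h1.trans (add_le_add_left (le_trans ?_ hm) _)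
    have e : ∫ z in Metric.ball (0:ℂ) s, G (x + z) = ∫ z in Metric.ball x s, G z := by
      have := (measurePreserving_add_left (volume : Measure ℂ) x).setIntegral_preimage_emb
        (measurableEmbedding_addLeft x) G (Metric.ball x s)
      rw [← this]
      congr 2
      ext z; simp
    have e' : ∫ z in Metric.closedBall (0:ℂ) 1, G (y + z) = ∫ z in Metric.closedBall y 1, G z := by
      have := (measurePreserving_add_left (volume : Measure ℂ) y).setIntegral_preimage_emb
        (measurableEmbedding_addLeft y) G (Metric.closedBall y 1)
      rw [← this]
      congr 2
      ext z; simp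
    rw [e, e']
    apply setIntegral_mono_set (hGc.continuousOn.integrableOn_compact (isCompact_closedBall y 1))
    · exact Filter.Eventually.of_forall fun z => (hpos z).le
    · have hsub : Metric.ball x s ⊆ Metric.closedBall y 1 := by
        intro z hz
        have hz : dist z x < s := hz
        have h2 := dist_triangle z x y
        show dist z y ≤ 1
        linarith
      exact hsub.eventuallyLE
  have hpi := pi_pos
  rcases le_or_gt (A * σ ^ 2) (1 / 2) with hc | hc
  · have h1 := key (σ / 2) (by linarith) le_rfl
    have h2 : 4 * π * A ^ 2 * (σ / 2) ^ 4 ≤ π * (σ/2) ^ 2 * A / 2 := by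
      have : 4 * π * A ^ 2 * (σ / 2) ^ 4 = π * (σ/2) ^ 2 * A * (A * σ ^ 2) := by ring
      rw [this]
      have : 0 ≤ π * (σ/2) ^ 2 * A := by positivity
      nlinarith
    have h3 : π * (σ ^ 2 * A) ≤ 8 * m := by nlinarith
    have h4 : σ ^ 2 * A ≤ 8 / π * m := by
      rw [div_mul_eq_mul_div, le_div_iff₀ hpi]; linarith
    linarith
  · exfalso
    have h8 : (0:ℝ) < 1 / (8 * A) := by positivity
    have hs2 : √(1 / (8 * A)) ^ 2 = 1 / (8 * A) := sq_sqrt h8.le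
    have h1 := key (√(1 / (8 * A))) (sqrt_pos.2 h8) (by
      rw [sqrt_le_iff]
      refine ⟨by linarith, ?_⟩
      rw [div_le_iff₀ (by positivity)]
      nlinarith)
    have hs4 : √(1 / (8 * A)) ^ 4 = (1 / (8 * A)) ^ 2 := by
      calc √(1 / (8 * A)) ^ 4 = (√(1 / (8 * A)) ^ 2) ^ 2 := by ring
        _ = _ := by rw [hs2]
    rw [hs4, hs2] at h1
    have e1 : π * (1 / (8 * A)) * A = π / 8 := by field_simp
    have e2 : 4 * π * A ^ 2 * (1 / (8 * A)) ^ 2 = π / 16 := by field_simp; norm_num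
    rw [e1, e2] at h1
    linarith

end MF

namespace MF

lemma circ_cs {f g : ℂ → ℝ} (hf : Continuous f) (hg : Continuous g) (t : ℝ) :
    circ (fun z => f z * g z) t ^ 2 ≤ circ (fun z => f z ^ 2) t * circ (fun z => g z ^ 2) t := by
  have h : ∀ x : ℝ, 0 ≤ circ (fun z => f z ^ 2) t * (x * x) + 2 * circ (fun z => f z * g z) t * x
      + circ (fun z => g z ^ 2) t := by
    intro x
    have h1 : 0 ≤ circ (fun z => (x * f z + g z) ^ 2) t := circ_nonneg t fun z _ => sq_nonneg _
    have h2 : circ (fun z => (x * f z + g z) ^ 2) t = circ (fun z => f z ^ 2) t * (x * x)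
        + 2 * circ (fun z => f z * g z) t * x + circ (fun z => g z ^ 2) t := by
      rw [show (fun z => (x * f z + g z) ^ 2) = fun z => ((x * x) * (f z ^ 2) + (2 * x) * (f z * g z))
        + g z ^ 2 by funext z; ring]
      rw [circ_add (by fun_prop) (by fun_prop), circ_add (by fun_prop) (by fun_prop),
        circ_mul, circ_mul]
      ring
    linarith
  have := discrim_le_zero h
  unfold discrim at this
  nlinarith

lemma circ_abs_sq {f : ℂ → ℝ} (hf : Continuous f) (t : ℝ) :
    circ (fun z => |f z|) t ≤ √(2 * π * circ (fun z => f z ^ 2) t) := by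
  apply Real.le_sqrt_of_sq_le
  have := circ_cs (f := fun _ => 1) (g := fun z => |f z|) (by fun_prop) (by fun_prop) t
  simp only [one_mul, sq_abs, one_pow, circ_const, mul_one] at this
  exact this

/-- Wirtinger inequality -/
lemma wirtinger {f f' : ℝ → ℝ} (hf : ∀ x, HasDerivAt f (f' x) x) (hf' : Continuous f')
    (hper : f (2 * π) = f 0) (h0 : ∫ x in (0:ℝ)..(2 * π), f x = 0) :
    ∫ x in (0:ℝ)..(2 * π), f x ^ 2 ≤ ∫ x in (0:ℝ)..(2 * π), f' x ^ 2 := by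
  have hab : (0:ℝ) < 2 * π := by positivity
  have hfc : Continuous f := continuous_iff_continuousAt.2 fun x => (hf x).continuousAt
  let F : ℝ → ℂ := fun x => (f x : ℂ)
  let F' : ℝ → ℂ := fun x => (f' x : ℂ)
  have hF : ∀ x, HasDerivAt F (F' x) x := fun x => (hf x).ofReal_comp
  have hFc : Continuous F := Complex.continuous_ofReal.comp hfc
  have hFc' : Continuous F' := Complex.continuous_ofReal.comp hf'
  have mem : ∀ g : ℝ → ℂ, Continuous g → MemLp g 2 (volume.restrict (Set.Ioc 0 (2 * π))) := by
    intro g hg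
    obtain ⟨C, hC⟩ := (isCompact_Icc (a := (0:ℝ)) (b := 2 * π)).exists_bound_of_continuousOn
      hg.continuousOn
    apply MemLp.of_bound hg.aestronglyMeasurable C
    rw [ae_restrict_iff' measurableSet_Ioc]
    exact Filter.Eventually.of_forall fun x hx => hC x ⟨hx.1.le, hx.2⟩
  have s1 := hasSum_sq_fourierCoeffOn hab (mem F hFc)
  have s2 := hasSum_sq_fourierCoeffOn hab (mem F' hFc')
  have key : ∀ n : ℤ, ‖fourierCoeffOn hab F n‖ ^ 2 ≤ ‖fourierCoeffOn hab F' n‖ ^ 2 := by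
    intro n
    by_cases hn : n = 0
    · subst hn
      rw [fourierCoeffOn_eq_integral]
      have : ∫ x in (0:ℝ)..(2 * π), (fourier (-0) (x : AddCircle (2 * π - 0)) : ℂ) • F x = 0 := by
        simp only [neg_zero, fourier_zero, one_smul, F]
        rw [intervalIntegral.integral_ofReal, h0]; simp
      rw [this]; simp
    · have h := fourierCoeffOn_of_hasDerivAt hab hn (fun x _ => hF x)
        (hFc'.intervalIntegrable _ _)
      have e : F (2 * π) - F 0 = 0 := by simp [F, hper]
      rw [e] at h
      have h2 : ‖fourierCoeffOn hab F n‖ = ‖fourierCoeffOn hab F' n‖ / |(n:ℝ)| := by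
        rw [h]
        have : (1 / (-2 * π * Complex.I * n) * (fourier (-n) ((0:ℝ) : AddCircle (2 * π - 0)) * 0
            - (((2 * π : ℝ) : ℂ) - ((0:ℝ):ℂ)) * fourierCoeffOn hab F' n) : ℂ)
            = fourierCoeffOn hab F' n / (Complex.I * n) := by
          have hpi : (π : ℂ) ≠ 0 := by exact_mod_cast pi_ne_zero
          have hn' : (n : ℂ) ≠ 0 := by exact_mod_cast hn
          push_cast
          field_simp
          ring
        rw [this, norm_div, norm_mul, Complex.norm_I, one_mul, Complex.norm_intCast]
      rw [h2, div_pow, sq_abs]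
      have hn1 : (1:ℝ) ≤ (n:ℝ) ^ 2 := by
        have : (1:ℤ) ≤ n ^ 2 := by have := sq_pos_of_ne_zero hn; omega
        exact_mod_cast this
      exact div_le_self (sq_nonneg _) hn1
  have h3 := hasSum_le key s1 s2
  simp only [sub_zero, smul_eq_mul, F, F', Complex.norm_real, Real.norm_eq_abs, sq_abs] at h3
  exact le_of_mul_le_mul_left h3 (by positivity)

lemma circ_wirtinger {f : ℂ → ℝ} (hf : ContDiff ℝ 1 f) (hp : Per f) {t : ℝ} (h0 : circ f t = 0) :
    circ (fun z => f z ^ 2) t ≤ circ (fun z => dy f z ^ 2) t := by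
  have hd : Differentiable ℝ f := hf.differentiable (by norm_num)
  have hc : Continuous (dy f) := (contDiff_dy (n := 0) (by exact_mod_cast hf)).continuous
  refine wirtinger (f := fun θ : ℝ => f ((t : ℂ) + θ * Complex.I))
    (f' := fun θ : ℝ => dy f ((t : ℂ) + θ * Complex.I)) ?_ (hc.comp (continuous_ver t)) ?_ h0
  · intro x
    exact hasDerivAt_dy (hd _) _ x (hasDerivAt_ver t x) rfl
  · have := hp (t : ℂ)
    simpa using this

/-- oscillation on circles -/
lemma circ_osc {f : ℂ → ℝ} (hf : ContDiff ℝ 1 f) (hp : Per f) (z : ℂ) :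
    |2 * π * f z - circ f z.re| ≤ 2 * π * circ (fun w => |dy f w|) z.re := by
  have hd : Differentiable ℝ f := hf.differentiable (by norm_num)
  have hc : Continuous (dy f) := (contDiff_dy (n := 0) (by exact_mod_cast hf)).continuous
  have hpa : Per (fun w => |dy f w|) := fun w => by
    show |dy f _| = |dy f _|
    rw [hp.dy w]
  set t := z.re with ht
  have hz : z = (t : ℂ) + z.im * Complex.I := by rw [ht, Complex.re_add_im]
  have hab : z.im ≤ z.im + 2 * π := by linarith [pi_pos]
  have key : ∀ θ ∈ Set.uIoc z.im (z.im + 2 * π), ‖f z - f ((t : ℂ) + θ * Complex.I)‖ ≤ circ (fun w => |dy f w|) t := by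
    intro θ hθ
    rw [Set.uIoc_of_le hab] at hθ
    have h1 : ∫ s in z.im..θ, dy f ((t : ℂ) + s * Complex.I) = f ((t : ℂ) + θ * Complex.I) - f z := by
      rw [intervalIntegral.integral_eq_sub_of_hasDerivAt (f := fun s : ℝ => f ((t : ℂ) + s * Complex.I))
        (fun x _ => hasDerivAt_dy (hd _) _ x (hasDerivAt_ver t x) rfl) (circ_integrable hc t _ _), ← hz]
    rw [Real.norm_eq_abs, abs_sub_comm, ← h1]
    calc |∫ s in z.im..θ, dy f ((t : ℂ) + s * Complex.I)|
        ≤ ∫ s in z.im..θ, |dy f ((t : ℂ) + s * Complex.I)| :=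
          intervalIntegral.abs_integral_le_integral_abs hθ.1.le
      _ ≤ ∫ s in z.im..(z.im + 2 * π), |dy f ((t : ℂ) + s * Complex.I)| := by
          apply intervalIntegral.integral_mono_interval le_rfl hθ.1.le hθ.2
          · exact Filter.Eventually.of_forall fun s => abs_nonneg _
          · exact circ_integrable (S := fun w => |dy f w|) hc.abs t _ _
      _ = circ (fun w => |dy f w|) t := circ_eq_shift hpa t z.im
  have h2 := intervalIntegral.norm_integral_le_of_norm_le_const key
  have h3 : ∫ θ in z.im..(z.im + 2 * π), (f z - f ((t : ℂ) + θ * Complex.I)) = 2 * π * f z - circ f t := by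
    rw [intervalIntegral.integral_sub (by simp) (circ_integrable hf.continuous t _ _), circ_eq_shift hp]
    simp
  rw [h3, Real.norm_eq_abs, add_sub_cancel_left, abs_of_pos (by positivity : 0 < 2 * π)] at h2
  linarith

/-- decay under a second order differential inequality and linear growth -/
lemma ode_decay {f f' f'' : ℝ → ℝ} {κ T C : ℝ} (hκ : 0 < κ)
    (h1 : ∀ t, HasDerivAt f (f' t) t) (h2 : ∀ t, HasDerivAt f' (f'' t) t)
    (h3 : ∀ t ≥ T, κ ^ 2 * f t ≤ f'' t) (h4 : ∀ t ≥ T, f t ≤ C * (1 + |t|)) :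
    ∀ t ≥ T, f t ≤ f T * exp (-κ * (t - T)) := by
  have hE : ∀ c t : ℝ, HasDerivAt (fun t => exp (c * t)) (c * exp (c * t)) t := by
    intro c t
    have := ((hasDerivAt_id t).const_mul c).exp
    simpa [mul_comm] using this
  -- a weighted first order combination is monotone
  let g : ℝ → ℝ := fun t => exp (-κ * t) * (f' t + κ * f t)
  have hg : ∀ t, HasDerivAt g (exp (-κ * t) * (f'' t - κ ^ 2 * f t)) t := by
    intro t
    have := (hE (-κ) t).fun_mul ((h2 t).fun_add ((h1 t).const_mul κ))
    refine HasDerivAt.congr_deriv this ?_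
    ring
  have hgm : MonotoneOn g (Set.Ici T) := by
    apply monotoneOn_of_hasDerivWithinAt_nonneg (convex_Ici T)
      (fun t _ => (hg t).continuousAt.continuousWithinAt)
      (fun t _ => (hg t).hasDerivWithinAt)
    intro t ht
    rw [interior_Ici] at ht
    have := h3 t (le_of_lt ht)
    exact mul_nonneg (exp_pos _).le (by linarith)
  let F : ℝ → ℝ := fun t => exp (κ * t) * f t
  have hF : ∀ t, HasDerivAt F (exp (κ * t) * (f' t + κ * f t)) t := by
    intro t
    have := (hE κ t).fun_mul (h1 t)
    refine HasDerivAt.congr_deriv this ?_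
    ring
  have hgF : ∀ t, exp (κ * t) * (f' t + κ * f t) = exp (2 * κ * t) * g t := by
    intro t
    show _ = exp (2 * κ * t) * (exp (-κ * t) * (f' t + κ * f t))
    rw [← mul_assoc, ← exp_add]; ring_nf
  have hneg : ∀ t ≥ T, g t ≤ 0 := by
    intro t0 ht0
    by_contra hc
    push Not at hc
    set c := g t0
    -- F - c/(2κ) exp(2κ t) is monotone on [t0, ∞)
    have hm : MonotoneOn (fun t => F t - c / (2 * κ) * exp (2 * κ * t)) (Set.Ici t0) := by
      apply monotoneOn_of_hasDerivWithinAt_nonneg (convex_Ici t0)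
        (f' := fun t => exp (2 * κ * t) * g t - c / (2 * κ) * (2 * κ * exp (2 * κ * t)))
      · intro t _
        exact ((hF t).fun_sub ((hE (2 * κ) t).const_mul _)).continuousAt.continuousWithinAt
      · intro t _
        have := ((hF t).fun_sub ((hE (2 * κ) t).const_mul (c / (2 * κ))))
        rw [hgF] at this
        exact this.hasDerivWithinAt
      · intro t ht
        rw [interior_Ici] at ht
        have hle : c ≤ g t := hgm (Set.mem_Ici.2 ht0) (Set.mem_Ici.2 (ht0.trans (le_of_lt ht))) (le_of_lt ht)
        have e : c / (2 * κ) * (2 * κ * exp (2 * κ * t)) = exp (2 * κ * t) * c := by field_simp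
        rw [e, ← mul_sub]
        exact mul_nonneg (exp_pos _).le (by linarith)
    set D := F t0 - c / (2 * κ) * exp (2 * κ * t0)
    have hb : ∀ t ≥ t0, D + c / (2 * κ) * exp (2 * κ * t) ≤ exp (κ * t) * (C * (1 + |t|)) := by
      intro t ht
      have h5 := hm (Set.mem_Ici.2 le_rfl) (Set.mem_Ici.2 ht) ht
      have h6 := mul_le_mul_of_nonneg_left (h4 t (ht0.le.trans ht)) (exp_pos (κ * t)).le
      simp only at h5
      have : F t = exp (κ * t) * f t := rfl
      linarith
    have hb2 : ∀ t ≥ max t0 0, c / (2 * κ) ≤ (C * (1 + t)) * exp (-(κ * t)) - D * exp (-(2 * κ * t)) := by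
      intro t ht
      have h5 := hb t (le_trans (le_max_left _ _) ht)
      have ht' : 0 ≤ t := le_trans (le_max_right _ _) ht
      rw [abs_of_nonneg ht'] at h5
      have h6 := mul_le_mul_of_nonneg_right h5 (exp_pos (-(2 * κ * t))).le
      have e1 : exp (2 * κ * t) * exp (-(2 * κ * t)) = 1 := by rw [← exp_add]; simp
      have e2 : exp (κ * t) * exp (-(2 * κ * t)) = exp (-(κ * t)) := by rw [← exp_add]; ring_nf
      have e3 : (D + c / (2 * κ) * exp (2 * κ * t)) * exp (-(2 * κ * t)) = D * exp (-(2 * κ * t)) + c / (2 * κ) := by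
        linear_combination (c / (2 * κ)) * e1
      have e4 : exp (κ * t) * (C * (1 + t)) * exp (-(2 * κ * t)) = C * (1 + t) * exp (-(κ * t)) := by
        rw [← e2]; ring
      rw [e3, e4] at h6
      linarith
    have lim : Filter.Tendsto (fun t : ℝ => (C * (1 + t)) * exp (-(κ * t)) - D * exp (-(2 * κ * t)))
        Filter.atTop (nhds 0) := by
      have l1 : ∀ c > 0, Filter.Tendsto (fun t : ℝ => exp (-(c * t))) Filter.atTop (nhds 0) := by
        intro c hc
        exact Real.tendsto_exp_neg_atTop_nhds_zero.comp (Filter.tendsto_id.const_mul_atTop hc)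
      have l2 : Filter.Tendsto (fun t : ℝ => t * exp (-(κ * t))) Filter.atTop (nhds 0) := by
        have := (Real.tendsto_pow_mul_exp_neg_atTop_nhds_zero 1).comp (Filter.tendsto_id.const_mul_atTop hκ)
        have := this.const_mul (κ⁻¹)
        rw [mul_zero] at this
        refine Filter.Tendsto.congr (fun t => ?_) this
        show κ⁻¹ * ((κ * t) ^ 1 * exp (-(κ * t))) = _
        field_simp
      have := (((l1 κ hκ).add l2).const_mul C).sub ((l1 (2 * κ) (by positivity)).const_mul D)
      simp only [add_zero, mul_zero, sub_zero] at this
      refine Filter.Tendsto.congr (fun t => ?_) this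
      ring
    have h7 := ge_of_tendsto lim ((Filter.eventually_ge_atTop (max t0 0)).mono hb2)
    have : 0 < c / (2 * κ) := by positivity
    linarith
  have hFa : AntitoneOn F (Set.Ici T) := by
    apply antitoneOn_of_hasDerivWithinAt_nonpos (convex_Ici T)
      (fun t _ => (hF t).continuousAt.continuousWithinAt)
      (fun t _ => (hF t).hasDerivWithinAt)
    intro t ht
    rw [interior_Ici] at ht
    rw [hgF]
    exact mul_nonpos_of_nonneg_of_nonpos (exp_pos _).le (hneg t (le_of_lt ht))
  intro t ht
  have h8 : exp (κ * t) * f t ≤ exp (κ * T) * f T := hFa (Set.mem_Ici.2 le_rfl) (Set.mem_Ici.2 ht) ht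
  have h9 := mul_le_mul_of_nonneg_left h8 (exp_pos (-(κ * t))).le
  have e1 : exp (-(κ * t)) * (exp (κ * t) * f t) = f t := by rw [← mul_assoc, ← exp_add]; simp
  have e2 : exp (-(κ * t)) * (exp (κ * T) * f T) = f T * exp (-κ * (t - T)) := by
    rw [← mul_assoc, ← exp_add]; ring_nf
  linarith

end MF

namespace MF

lemma cd_dx {f : ℂ → ℝ} (n : ℕ) (hf : ContDiff ℝ ((n + 1 : ℕ) : WithTop ℕ∞) f) : ContDiff ℝ n (dx f) :=
  contDiff_dx (n := n) (by exact_mod_cast hf)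
lemma cd_dy {f : ℂ → ℝ} (n : ℕ) (hf : ContDiff ℝ ((n + 1 : ℕ) : WithTop ℕ∞) f) : ContDiff ℝ n (dy f) :=
  contDiff_dy (n := n) (by exact_mod_cast hf)

lemma lap_mul {f g : ℂ → ℝ} (hf : ContDiff ℝ 2 f) (hg : ContDiff ℝ 2 g) (z : ℂ) :
    lap (fun z => f z * g z) z
      = f z * lap g z + 2 * (dx f z * dx g z + dy f z * dy g z) + g z * lap f z := by
  have hf0 := hf.differentiable (by norm_num)
  have hg0 := hg.differentiable (by norm_num)
  have a1 := (cd_dx (f := f) 1 (by exact_mod_cast hf)).differentiable (by norm_num)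
  have a2 := (cd_dy (f := f) 1 (by exact_mod_cast hf)).differentiable (by norm_num)
  have a3 := (cd_dx (f := g) 1 (by exact_mod_cast hg)).differentiable (by norm_num)
  have a4 := (cd_dy (f := g) 1 (by exact_mod_cast hg)).differentiable (by norm_num)
  unfold lap
  rw [dx_mul hf0 hg0, dy_mul hf0 hg0, dx_add (a1.fun_mul hg0) (hf0.fun_mul a3),
    dy_add (a2.fun_mul hg0) (hf0.fun_mul a4), dx_mul a1 hg0, dx_mul hf0 a3, dy_mul a2 hg0, dy_mul hf0 a4]
  ring

lemma lap_dx {f : ℂ → ℝ} (hf : ContDiff ℝ 3 f) : lap (dx f) = dx (lap f) := by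
  have h2 : ContDiff ℝ 2 f := hf.of_le (by norm_num)
  have x2 : ContDiff ℝ 2 (dx f) := cd_dx 2 (by exact_mod_cast hf)
  have y2 : ContDiff ℝ 2 (dy f) := cd_dy 2 (by exact_mod_cast hf)
  have xx := (cd_dx (f := dx f) 1 (by exact_mod_cast x2)).differentiable (by norm_num)
  have yy := (cd_dy (f := dy f) 1 (by exact_mod_cast y2)).differentiable (by norm_num)
  rw [show lap f = fun z => dx (dx f) z + dy (dy f) z from rfl, dx_add xx yy]
  funext z
  unfold lap
  rw [dx_dy_comm y2, dx_dy_comm h2]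

lemma lap_dy {f : ℂ → ℝ} (hf : ContDiff ℝ 3 f) : lap (dy f) = dy (lap f) := by
  have h2 : ContDiff ℝ 2 f := hf.of_le (by norm_num)
  have x2 : ContDiff ℝ 2 (dx f) := cd_dx 2 (by exact_mod_cast hf)
  have y2 : ContDiff ℝ 2 (dy f) := cd_dy 2 (by exact_mod_cast hf)
  have xx := (cd_dx (f := dx f) 1 (by exact_mod_cast x2)).differentiable (by norm_num)
  have yy := (cd_dy (f := dy f) 1 (by exact_mod_cast y2)).differentiable (by norm_num)
  rw [show lap f = fun z => dx (dx f) z + dy (dy f) z from rfl, dy_add xx yy]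
  funext z
  unfold lap
  rw [← dx_dy_comm x2, ← dx_dy_comm h2]

/-- conformal weight on the cylinder -/
noncomputable def K (l t : ℝ) : ℝ := exp (2 * t) * (1 + exp (2 * t)) ^ l
/-- its logarithmic derivative minus four -/
noncomputable def J (l t : ℝ) : ℝ := -2 + 2 * l * (exp (2 * t) / (1 + exp (2 * t)))
noncomputable def J2 (l t : ℝ) : ℝ := 4 * l * (exp (2 * t) / (1 + exp (2 * t)) ^ 2)
noncomputable def kap (l t : ℝ) : ℝ := exp (-2 * t) * (1 + exp (2 * t)) ^ l

lemma hasDerivAt_exp2 (c t : ℝ) : HasDerivAt (fun t => exp (c * t)) (c * exp (c * t)) t := by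
  have := ((hasDerivAt_id t).const_mul c).exp
  simpa [mul_comm] using this

lemma hasDerivAt_pow (l t : ℝ) : HasDerivAt (fun t => (1 + exp (2 * t)) ^ l)
    (2 * l * (exp (2 * t) / (1 + exp (2 * t))) * (1 + exp (2 * t)) ^ l) t := by
  have hp : 0 < 1 + exp (2 * t) := by positivity
  have := ((hasDerivAt_exp2 2 t).const_add 1).rpow_const (p := l) (Or.inl hp.ne')
  refine HasDerivAt.congr_deriv this ?_
  rw [rpow_sub_one hp.ne']
  field_simp

lemma hasDerivAt_K (l t : ℝ) : HasDerivAt (K l) (K l t * (J l t + 4)) t := by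
  have := (hasDerivAt_exp2 2 t).fun_mul (hasDerivAt_pow l t)
  refine HasDerivAt.congr_deriv this ?_
  unfold K J; ring

lemma hasDerivAt_kap (l t : ℝ) : HasDerivAt (kap l) (kap l t * J l t) t := by
  have := (hasDerivAt_exp2 (-2) t).fun_mul (hasDerivAt_pow l t)
  refine HasDerivAt.congr_deriv this ?_
  unfold kap J; ring

lemma hasDerivAt_J (l t : ℝ) : HasDerivAt (J l) (J2 l t) t := by
  have hp : 0 < 1 + exp (2 * t) := by positivity
  have := (((hasDerivAt_exp2 2 t).fun_div ((hasDerivAt_exp2 2 t).const_add 1) hp.ne').const_mul (2 * l)).const_add (-2)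
  refine HasDerivAt.congr_deriv this ?_
  unfold J2; field_simp; ring

lemma K_pos (l t : ℝ) : 0 < K l t := by unfold K; positivity
lemma kap_pos (l t : ℝ) : 0 < kap l t := by unfold kap; positivity
lemma K_eq (l t : ℝ) : kap l t = K l t * exp (-4 * t) := by
  unfold K kap
  rw [mul_right_comm, ← exp_add]; ring_nf

lemma contDiff_exp2 {n : WithTop ℕ∞} (c : ℝ) : ContDiff ℝ n (fun t : ℝ => exp (c * t)) := by fun_prop

lemma contDiff_pow {n : WithTop ℕ∞} (l : ℝ) : ContDiff ℝ n (fun t : ℝ => (1 + exp (2 * t)) ^ l) :=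
  ContDiff.rpow_const_of_ne (by fun_prop) (fun t => by positivity)

lemma contDiff_K {n : WithTop ℕ∞} (l : ℝ) : ContDiff ℝ n (K l) := (contDiff_exp2 2).mul (contDiff_pow l)
lemma contDiff_kap {n : WithTop ℕ∞} (l : ℝ) : ContDiff ℝ n (kap l) := (contDiff_exp2 (-2)).mul (contDiff_pow l)

lemma contDiff_re {n : WithTop ℕ∞} {g : ℝ → ℝ} (hg : ContDiff ℝ n g) : ContDiff ℝ n (fun z : ℂ => g z.re) :=
  hg.comp Complex.reCLM.contDiff

structure Cyl (l : ℝ) (V : ℂ → ℝ) : Prop where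
  smooth : ContDiff ℝ 4 V
  per : Per V
  eq : ∀ z, lap V z = -(K l z.re * exp (V z))

noncomputable def GG (l : ℝ) (V : ℂ → ℝ) (z : ℂ) : ℝ := K l z.re * exp (V z)

namespace Cyl
variable {l : ℝ} {V : ℂ → ℝ} (h : Cyl l V)
include h

lemma s3 : ContDiff ℝ 3 V := h.smooth.of_le (by norm_num)
lemma s2 : ContDiff ℝ 2 V := h.smooth.of_le (by norm_num)
lemma s1 : ContDiff ℝ 1 V := h.smooth.of_le (by norm_num)
lemma s0 : Differentiable ℝ V := h.smooth.differentiable (by norm_num)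
lemma phi3 : ContDiff ℝ 3 (dy V) := cd_dy 3 (by exact_mod_cast h.smooth)
lemma phi2 : ContDiff ℝ 2 (dy V) := h.phi3.of_le (by norm_num)
lemma phi1 : ContDiff ℝ 1 (dy V) := h.phi3.of_le (by norm_num)
lemma phi0 : Differentiable ℝ (dy V) := h.phi3.differentiable (by norm_num)
lemma p2 : ContDiff ℝ 2 (dx (dy V)) := cd_dx 2 (by exact_mod_cast h.phi3)
lemma q2 : ContDiff ℝ 2 (dy (dy V)) := cd_dy 2 (by exact_mod_cast h.phi3)
lemma p0 : Differentiable ℝ (dx (dy V)) := h.p2.differentiable (by norm_num)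
lemma q0 : Differentiable ℝ (dy (dy V)) := h.q2.differentiable (by norm_num)
lemma G4 : ContDiff ℝ 4 (GG l V) := (contDiff_re (contDiff_K l)).mul h.smooth.exp
lemma G2 : ContDiff ℝ 2 (GG l V) := h.G4.of_le (by norm_num)
lemma G0 : Differentiable ℝ (GG l V) := h.G4.differentiable (by norm_num)

lemma lapV : lap V = fun z => -GG l V z := funext h.eq

lemma exp0 : Differentiable ℝ (fun z => exp (V z)) := h.s0.exp
lemma K0 : Differentiable ℝ (fun z : ℂ => K l z.re) := (contDiff_re (n := 1) (contDiff_K l)).differentiable (by norm_num)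

lemma dxG : dx (GG l V) = fun z => GG l V z * (dx V z + J l z.re + 4) := by
  unfold GG
  rw [dx_mul h.K0 h.exp0, dx_re (hasDerivAt_K l), dx_comp h.s0 (fun z => Real.hasDerivAt_exp _)]
  funext z; ring

lemma dyG : dy (GG l V) = fun z => GG l V z * dy V z := by
  unfold GG
  rw [dy_mul h.K0 h.exp0, dy_re (hasDerivAt_K l), dy_comp h.s0 (fun z => Real.hasDerivAt_exp _)]
  funext z; ring

omit h in
lemma dx_neg (f : ℂ → ℝ) : dx (fun z => -f z) = fun z => -dx f z := by
  funext z; unfold dx; rw [fderiv_fun_neg]; rfl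
omit h in
lemma dy_neg (f : ℂ → ℝ) : dy (fun z => -f z) = fun z => -dy f z := by
  funext z; unfold dy; rw [fderiv_fun_neg]; rfl

lemma lapPhi : lap (dy V) = fun z => -(GG l V z * dy V z) := by
  rw [lap_dy h.s3, h.lapV, dy_neg, h.dyG]

lemma lapP : lap (dx (dy V)) = fun z =>
    -(GG l V z * (dx V z + J l z.re + 4) * dy V z + GG l V z * dx (dy V) z) := by
  rw [lap_dx h.phi3, h.lapPhi, dx_neg, dx_mul h.G0 h.phi0, h.dxG]

lemma lapQ : lap (dy (dy V)) = fun z =>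
    -(GG l V z * dy V z * dy V z + GG l V z * dy (dy V) z) := by
  rw [lap_dy h.phi3, h.lapPhi, dy_neg, dy_mul h.G0 h.phi0, h.dyG]

end Cyl

noncomputable def E0 (V : ℂ → ℝ) (z : ℂ) : ℝ := -4 * z.re + -V z
noncomputable def QQ (V : ℂ → ℝ) (z : ℂ) : ℝ := dx (dy V) z * dx (dy V) z + dy (dy V) z * dy (dy V) z
noncomputable def HH (l : ℝ) (V : ℂ → ℝ) (z : ℂ) : ℝ :=
  exp (E0 V z) * QQ V z + kap l z.re * (1 / 2 * (dy V z * dy V z))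

namespace Cyl
variable {l : ℝ} {V : ℂ → ℝ} (h : Cyl l V)
include h

lemma E2 : ContDiff ℝ 2 (E0 V) := by
  have : ContDiff ℝ 2 (fun z : ℂ => z.re) := Complex.reCLM.contDiff
  exact (contDiff_const.mul this).add h.s2.neg
lemma Ed : Differentiable ℝ (E0 V) := h.E2.differentiable (by norm_num)

omit h in
lemma lin_re : ∀ t : ℝ, HasDerivAt (fun t => -4 * t) (-4) t := fun t => by
  simpa using (hasDerivAt_id t).const_mul (-4)

lemma re0 : Differentiable ℝ (fun z : ℂ => -4 * z.re) := Complex.reCLM.differentiable.const_mul (-4)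
lemma dxE : dx (E0 V) = fun z => -4 + -dx V z := by
  unfold E0
  rw [dx_add h.re0 h.s0.fun_neg, dx_re lin_re, dx_neg]
lemma dyE : dy (E0 V) = fun z => 0 + -dy V z := by
  unfold E0
  rw [dy_add h.re0 h.s0.fun_neg, dy_re lin_re, dy_neg]
lemma lapE (z : ℂ) : lap (E0 V) z = GG l V z := by
  have hx : Differentiable ℝ (dx V) := (cd_dx (f := V) 1 (by exact_mod_cast h.s2)).differentiable (by norm_num)
  unfold lap
  rw [h.dxE, h.dyE, dx_add (differentiable_const _) hx.fun_neg, dy_add (differentiable_const _) h.phi0.fun_neg, dx_neg (dx V), dy_neg (dy V)]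
  have e := h.eq z
  unfold lap at e
  have c1 : dx (fun _ : ℂ => (-4:ℝ)) z = 0 := by simp [dx]
  have c2 : dy (fun _ : ℂ => (0:ℝ)) z = 0 := by simp [dy]
  simp only [c1, c2]
  unfold GG; linarith

lemma Q2 : ContDiff ℝ 2 (QQ V) := (h.p2.mul h.p2).add (h.q2.mul h.q2)
lemma Q0 : Differentiable ℝ (QQ V) := h.Q2.differentiable (by norm_num)
lemma dxQ : dx (QQ V) = fun z => 2 * (dx (dy V) z * dx (dx (dy V)) z + dy (dy V) z * dy (dx (dy V)) z) := by
  unfold QQ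
  rw [dx_add (h.p0.fun_mul h.p0) (h.q0.fun_mul h.q0), dx_mul h.p0 h.p0, dx_mul h.q0 h.q0, dx_dy_comm h.phi2]
  funext z; ring
lemma dyQ : dy (QQ V) = fun z => 2 * (dx (dy V) z * dy (dx (dy V)) z + dy (dy V) z * dy (dy (dy V)) z) := by
  unfold QQ
  rw [dy_add (h.p0.fun_mul h.p0) (h.q0.fun_mul h.q0), dy_mul h.p0 h.p0, dy_mul h.q0 h.q0]
  funext z; ring
lemma lapQQ (z : ℂ) : lap (QQ V) z = 2 * (dx (dx (dy V)) z ^ 2 + 2 * dy (dx (dy V)) z ^ 2 + dy (dy (dy V)) z ^ 2)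
    + 2 * (dx (dy V) z * lap (dx (dy V)) z + dy (dy V) z * lap (dy (dy V)) z) := by
  unfold QQ
  rw [lap_add (h.p2.mul h.p2) (h.q2.mul h.q2), lap_mul h.p2 h.p2, lap_mul h.q2 h.q2, dx_dy_comm h.phi2]
  ring

lemma H2 : ContDiff ℝ 2 (HH l V) :=
  (h.E2.exp.mul h.Q2).add ((contDiff_re (contDiff_kap l)).mul (contDiff_const.mul (h.phi2.mul h.phi2)))

lemma ex2 : ContDiff ℝ 2 (fun z => exp (E0 V z)) := h.E2.exp
lemma k2 : ContDiff ℝ 2 (fun z : ℂ => kap l z.re) := contDiff_re (contDiff_kap l)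
lemma f2 : ContDiff ℝ 2 (fun z : ℂ => 1 / 2 * (dy V z * dy V z)) := contDiff_const.mul (h.phi2.mul h.phi2)

lemma d_f : dx (fun z : ℂ => 1 / 2 * (dy V z * dy V z)) = (fun z => dy V z * dx (dy V) z) ∧
    dy (fun z : ℂ => 1 / 2 * (dy V z * dy V z)) = (fun z => dy V z * dy (dy V) z) := by
  have c1 : dx (fun _ : ℂ => (1/2:ℝ)) = fun _ => 0 := by funext z; simp [dx]
  have c2 : dy (fun _ : ℂ => (1/2:ℝ)) = fun _ => 0 := by funext z; simp [dy]
  constructor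
  · rw [dx_mul (differentiable_const _) (h.phi0.fun_mul h.phi0), c1, dx_mul h.phi0 h.phi0]
    funext z; ring
  · rw [dy_mul (differentiable_const _) (h.phi0.fun_mul h.phi0), c2, dy_mul h.phi0 h.phi0]
    funext z; ring

lemma lap_f (z : ℂ) : lap (fun z : ℂ => 1 / 2 * (dy V z * dy V z)) z =
    dx (dy V) z ^ 2 + dy (dy V) z ^ 2 + dy V z * lap (dy V) z := by
  unfold lap
  rw [h.d_f.1, h.d_f.2, dx_mul h.phi0 h.p0, dy_mul h.phi0 h.q0]
  ring

lemma lap_k (z : ℂ) : lap (fun z : ℂ => kap l z.re) z = kap l z.re * (J l z.re ^ 2 + J2 l z.re) := by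
  unfold lap
  have c2 : dy (fun _ : ℂ => (0:ℝ)) = fun _ => 0 := by funext z; simp [dy]
  rw [dx_re (hasDerivAt_kap l), dy_re (hasDerivAt_kap l), c2,
    dx_re (g := fun t => kap l t * J l t) (fun t => (hasDerivAt_kap l t).fun_mul (hasDerivAt_J l t))]
  ring

lemma dxH (z : ℂ) : dx (HH l V) z = exp (E0 V z) * ((-4 + -dx V z) * QQ V z
    + 2 * (dx (dy V) z * dx (dx (dy V)) z + dy (dy V) z * dy (dx (dy V)) z))
    + kap l z.re * (J l z.re * (1/2 * (dy V z * dy V z)) + dy V z * dx (dy V) z) := by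
  have a1 := h.ex2.differentiable (by norm_num)
  have a2 := h.k2.differentiable (by norm_num)
  have a3 := h.f2.differentiable (by norm_num)
  unfold HH
  rw [dx_add (a1.fun_mul h.Q0) (a2.fun_mul a3), dx_mul a1 h.Q0, dx_mul a2 a3, h.d_f.1, dx_re (hasDerivAt_kap l),
    h.dxQ, dx_comp h.Ed (fun z => Real.hasDerivAt_exp _), h.dxE]
  ring

lemma dyH (z : ℂ) : dy (HH l V) z = exp (E0 V z) * ((-dy V z) * QQ V z
    + 2 * (dx (dy V) z * dy (dx (dy V)) z + dy (dy V) z * dy (dy (dy V)) z))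
    + kap l z.re * (dy V z * dy (dy V) z) := by
  have a1 := h.ex2.differentiable (by norm_num)
  have a2 := h.k2.differentiable (by norm_num)
  have a3 := h.f2.differentiable (by norm_num)
  unfold HH
  rw [dy_add (a1.fun_mul h.Q0) (a2.fun_mul a3), dy_mul a1 h.Q0, dy_mul a2 a3, h.d_f.2, dy_re (hasDerivAt_kap l),
    h.dyQ, dy_comp h.Ed (fun z => Real.hasDerivAt_exp _), h.dyE]
  ring

lemma lapH (z : ℂ) : lap (HH l V) z = exp (E0 V z) * lap (QQ V) z
    + 2 * exp (E0 V z) * ((-4 + -dx V z) * dx (QQ V) z + (-dy V z) * dy (QQ V) z)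
    + QQ V z * (exp (E0 V z) * (GG l V z + ((-4 + -dx V z) ^ 2 + dy V z ^ 2)))
    + kap l z.re * (dx (dy V) z ^ 2 + dy (dy V) z ^ 2 + dy V z * lap (dy V) z)
    + 2 * (kap l z.re * J l z.re * (dy V z * dx (dy V) z))
    + 1/2 * (dy V z * dy V z) * (kap l z.re * (J l z.re ^ 2 + J2 l z.re)) := by
  unfold HH
  rw [lap_add (h.ex2.mul h.Q2) (h.k2.mul h.f2), lap_mul h.ex2 h.Q2, lap_mul h.k2 h.f2, h.lap_f, h.lap_k, h.d_f.1, h.d_f.2,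
    dx_re (hasDerivAt_kap l), dy_re (hasDerivAt_kap l),
    lap_comp h.E2 (fun z => Real.hasDerivAt_exp _) (fun z => Real.hasDerivAt_exp _),
    dx_comp h.Ed (fun z => Real.hasDerivAt_exp _), dy_comp h.Ed (fun z => Real.hasDerivAt_exp _), h.lapE, h.dxE, h.dyE]
  ring

lemma kapGE (z : ℂ) : kap l z.re = GG l V z * exp (E0 V z) := by
  rw [K_eq, GG, E0, exp_add, exp_neg]
  field_simp

/-- the key identity -/
lemma key_identity (z : ℂ) :
    HH l V z * lap (HH l V) z - dx (HH l V) z ^ 2 - dy (HH l V) z ^ 2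
    = kap l z.re * J2 l z.re * dy V z ^ 2 * HH l V z / 2
      + 2 * kap l z.re * exp (E0 V z) * dy V z ^ 2 *
        ((1/2 * (dx (dx (dy V)) z - dy (dy (dy V)) z)
            - 1/2 * ((dx V z + 4 + J l z.re) * dx (dy V) z - dy V z * dy (dy V) z)) ^ 2
         + (dy (dx (dy V)) z - 1/2 * ((dx V z + 4 + J l z.re) * dy (dy V) z + dy V z * dx (dy V) z)) ^ 2) := by
  have e1 : dx (dx (dy V)) z + dy (dy (dy V)) z = -(GG l V z * dy V z) := congrFun h.lapPhi z
  have e2 : dx (dx (dy V)) z = -(GG l V z * dy V z) - dy (dy (dy V)) z := by linarith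
  rw [h.dxH, h.dyH, h.lapH, h.lapQQ, h.lapP, h.lapQ, h.lapPhi, h.dxQ, h.dyQ]
  unfold HH QQ
  simp only
  rw [h.kapGE z, e2]
  ring

end Cyl
end MF

namespace MF
/-- a convex function with no growth on either side is affine with zero slope -/
lemma convex_const {s s' s'' : ℝ → ℝ} (h1 : ∀ t, HasDerivAt s (s' t) t) (h2 : ∀ t, HasDerivAt s' (s'' t) t)
    (h3 : ∀ t, 0 ≤ s'' t) (hb : ∃ C T, ∀ t ≤ T, s t ≤ C)
    (ht : ∀ ε > 0, ∃ C T, ∀ t ≥ T, s t ≤ ε * t + C) : ∀ t, s'' t = 0 := by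
  have hm : Monotone s' := monotone_of_hasDerivAt_nonneg h2 h3
  have e0 : ∀ t, s' t = 0 := by
    intro t0
    rcases lt_trichotomy (s' t0) 0 with hc | hc | hc
    · exfalso
      obtain ⟨C, T, hC⟩ := hb
      have hanti : AntitoneOn (fun t => s t - s' t0 * t) (Set.Iic t0) := by
        apply antitoneOn_of_hasDerivWithinAt_nonpos (convex_Iic t0) (f' := fun t => s' t - s' t0 * 1)
        · exact fun t _ => ((h1 t).fun_sub ((hasDerivAt_id t).const_mul (s' t0))).continuousAt.continuousWithinAt
        · exact fun t _ => ((h1 t).fun_sub ((hasDerivAt_id t).const_mul (s' t0))).hasDerivWithinAt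
        · intro t h
          rw [interior_Iic] at h
          have := hm (le_of_lt h)
          linarith
      have key : ∀ t ≤ min T t0, s t0 - s' t0 * t0 + s' t0 * t ≤ C := by
        intro t h
        have := hanti (Set.mem_Iic.2 (h.trans (min_le_right _ _))) (Set.mem_Iic.2 le_rfl) (h.trans (min_le_right _ _))
        have h4 := hC t (h.trans (min_le_left _ _))
        simp only at this
        linarith
      have h5 := key (min (min T t0) ((C - (s t0 - s' t0 * t0) + 1) / s' t0)) (min_le_left _ _)
      have h6 : s' t0 * ((C - (s t0 - s' t0 * t0) + 1) / s' t0) ≤ s' t0 * (min (min T t0) ((C - (s t0 - s' t0 * t0) + 1) / s' t0)) :=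
        mul_le_mul_of_nonpos_left (min_le_right _ _) hc.le
      rw [mul_div_cancel₀ _ hc.ne] at h6
      linarith
    · exact hc
    · exfalso
      obtain ⟨C, T, hC⟩ := ht (s' t0 / 2) (by linarith)
      have hmo : MonotoneOn (fun t => s t - s' t0 * t) (Set.Ici t0) := by
        apply monotoneOn_of_hasDerivWithinAt_nonneg (convex_Ici t0) (f' := fun t => s' t - s' t0 * 1)
        · exact fun t _ => ((h1 t).fun_sub ((hasDerivAt_id t).const_mul (s' t0))).continuousAt.continuousWithinAt
        · exact fun t _ => ((h1 t).fun_sub ((hasDerivAt_id t).const_mul (s' t0))).hasDerivWithinAt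
        · intro t h
          rw [interior_Ici] at h
          have := hm (le_of_lt h)
          linarith
      have key : ∀ t ≥ max T t0, s t0 - s' t0 * t0 + s' t0 / 2 * t ≤ C := by
        intro t h
        have := hmo (Set.mem_Ici.2 le_rfl) (Set.mem_Ici.2 ((le_max_right _ _).trans h)) ((le_max_right _ _).trans h)
        have h4 := hC t ((le_max_left _ _).trans h)
        simp only at this
        linarith
      have hc2 : 0 < s' t0 / 2 := by linarith
      have h5 := key (max (max T t0) ((C - (s t0 - s' t0 * t0) + 1) / (s' t0 / 2))) (le_max_left _ _)
      have h6 : s' t0 / 2 * ((C - (s t0 - s' t0 * t0) + 1) / (s' t0 / 2)) ≤ s' t0 / 2 * (max (max T t0) ((C - (s t0 - s' t0 * t0) + 1) / (s' t0 / 2))) :=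
        mul_le_mul_of_nonneg_left (le_max_right _ _) hc2.le
      rw [mul_div_cancel₀ _ hc2.ne'] at h6
      linarith
  intro t
  have : s' = fun _ => 0 := funext e0
  have h := h2 t
  rw [this] at h
  exact h.unique (hasDerivAt_const t (0:ℝ))

namespace Cyl
variable {l : ℝ} {V : ℂ → ℝ} (h : Cyl l V)
include h

lemma H_nonneg (z : ℂ) : 0 ≤ HH l V z := by
  unfold HH QQ
  have := kap_pos l z.re
  have h1 := mul_self_nonneg (dx (dy V) z)
  have h2 := mul_self_nonneg (dy (dy V) z)
  have h3 := mul_self_nonneg (dy V z)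
  positivity

lemma key_ge (hl : 0 < l) (z : ℂ) : kap l z.re * J2 l z.re * dy V z ^ 2 * HH l V z / 2 ≤
    HH l V z * lap (HH l V) z - dx (HH l V) z ^ 2 - dy (HH l V) z ^ 2 := by
  rw [h.key_identity]
  have := kap_pos l z.re
  have : 0 ≤ 2 * kap l z.re * exp (E0 V z) * dy V z ^ 2 *
        ((1/2 * (dx (dx (dy V)) z - dy (dy (dy V)) z)
            - 1/2 * ((dx V z + 4 + J l z.re) * dx (dy V) z - dy V z * dy (dy V) z)) ^ 2
         + (dy (dx (dy V)) z - 1/2 * ((dx V z + 4 + J l z.re) * dy (dy V) z + dy V z * dx (dy V) z)) ^ 2) := by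
    positivity
  linarith

lemma J2_pos (hl : 0 < l) (t : ℝ) : 0 < J2 l t := by unfold J2; positivity

lemma lapH_nonneg (hl : 0 < l) (z : ℂ) : 0 ≤ lap (HH l V) z := by
  have hk := kap_pos l z.re
  have hJ := h.J2_pos hl z.re
  rcases (h.H_nonneg z).lt_or_eq with hp | hz
  · have h1 := h.key_ge hl z
    have h2 : 0 ≤ kap l z.re * J2 l z.re * dy V z ^ 2 * HH l V z / 2 := by positivity
    have h3 : 0 ≤ HH l V z * lap (HH l V) z := by nlinarith [sq_nonneg (dx (HH l V) z), sq_nonneg (dy (HH l V) z)]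
    exact nonneg_of_mul_nonneg_right h3 hp
  · have hz := hz.symm
    unfold HH QQ at hz
    have he := exp_pos (E0 V z)
    have n1 := mul_self_nonneg (dx (dy V) z)
    have n2 := mul_self_nonneg (dy (dy V) z)
    have n3 := mul_self_nonneg (dy V z)
    have m1 := mul_nonneg he.le n1
    have m2 := mul_nonneg he.le n2
    have m3 := mul_nonneg hk.le n3
    have z1 : exp (E0 V z) * (dx (dy V) z * dx (dy V) z) = 0 := by nlinarith
    have z2 : exp (E0 V z) * (dy (dy V) z * dy (dy V) z) = 0 := by nlinarith
    have z3 : kap l z.re * (dy V z * dy V z) = 0 := by nlinarith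
    have y1 : dx (dy V) z = 0 := by simpa [he.ne'] using z1
    have y2 : dy (dy V) z = 0 := by simpa [he.ne'] using z2
    have y3 : dy V z = 0 := by simpa [hk.ne'] using z3
    have q0 : QQ V z = 0 := by unfold QQ; rw [y1, y2]; ring
    rw [h.lapH, h.lapQQ, h.dxQ, h.dyQ]
    simp only [y1, y2, y3, q0]
    have : 0 ≤ exp (E0 V z) * (2 * (dx (dx (dy V)) z ^ 2 + 2 * dy (dx (dy V)) z ^ 2 + dy (dy (dy V)) z ^ 2)) := by
      positivity
    linarith

lemma H_per : Per (HH l V) := by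
  intro z
  have e0 := h.per z
  have e1 := h.per.dy z
  have e2 := h.per.dy.dx z
  have e3 := h.per.dy.dy z
  unfold HH QQ E0
  simp only [e0, e1, e2, e3]
  simp

theorem phi_zero (hl : 0 < l) (hb : ∃ C T, ∀ z : ℂ, z.re ≤ T → HH l V z ≤ C)
    (ht : ∀ ε > 0, ∃ C T, ∀ z : ℂ, T ≤ z.re → HH l V z ≤ exp (ε * z.re + C)) : ∀ z, dy V z = 0 := by
  let S : ℂ → ℝ := fun z => log (1 + HH l V z)
  have hpos : ∀ z, 0 < 1 + HH l V z := fun z => by have := h.H_nonneg z; linarith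
  have hS : ContDiff ℝ 2 S := (contDiff_const.add h.H2).log (fun z => (hpos z).ne')
  have hSp : Per S := fun z => by
    show log (1 + HH l V _) = log (1 + HH l V z)
    rw [h.H_per z]
  have hlap : ∀ z, lap S z = (HH l V z * lap (HH l V) z - dx (HH l V) z ^ 2 - dy (HH l V) z ^ 2 + lap (HH l V) z)
      / (1 + HH l V z) ^ 2 := by
    intro z
    have := lap_comp (f := HH l V) (g := fun x => log (1 + x)) (g' := fun x => (1 + x)⁻¹) (g'' := fun x => -1 / (1 + x) ^ 2) h.H2
      (fun z => by simpa using ((hasDerivAt_id (HH l V z)).const_add 1).log (hpos z).ne')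
      (fun z => by simpa using ((hasDerivAt_id (HH l V z)).const_add 1).fun_inv (hpos z).ne') z
    rw [show lap S z = _ from this]
    have := (hpos z).ne'
    field_simp
    ring
  have hnn : ∀ z, kap l z.re * J2 l z.re * dy V z ^ 2 * HH l V z / 2 / (1 + HH l V z) ^ 2 ≤ lap S z := by
    intro z
    rw [hlap z]
    apply div_le_div_of_nonneg_right _ (sq_nonneg _)
    have := h.key_ge hl z
    have := h.lapH_nonneg hl z
    linarith
  have hn0 : ∀ z, 0 ≤ kap l z.re * J2 l z.re * dy V z ^ 2 * HH l V z / 2 / (1 + HH l V z) ^ 2 := by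
    intro z
    have := kap_pos l z.re
    have := h.J2_pos hl z.re
    have := h.H_nonneg z
    positivity
  have hS0 : ∀ z, 0 ≤ lap S z := fun z => (hn0 z).trans (hnn z)
  have hc : ∀ t, circ (lap S) t = 0 := by
    refine convex_const (s := circ S) (fun t => circ_hasDerivAt (hS.of_le (by norm_num)) t)
      (fun t => circ_hasDerivAt2 hS hSp t) (fun t => circ_nonneg t fun z _ => hS0 z) ?_ ?_
    · obtain ⟨C, T, hC⟩ := hb
      refine ⟨2 * π * log (1 + C), T, fun t ht => ?_⟩
      rw [← circ_const (log (1 + C)) t]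
      apply circ_mono hS.continuous continuous_const
      intro z hz
      apply log_le_log (hpos z)
      have := hC z (hz ▸ ht)
      linarith
    · intro ε hε
      obtain ⟨C, T, hC⟩ := ht (ε / (2 * π)) (by positivity)
      refine ⟨2 * π * (|C| + log 2), max T 0, fun t ht => ?_⟩
      have e : ε * t + 2 * π * (|C| + log 2) = 2 * π * (ε / (2 * π) * t + |C| + log 2) := by
        field_simp; ring
      rw [e, ← circ_const _ t]
      apply circ_mono hS.continuous continuous_const
      intro z hz
      have ht0 : 0 ≤ t := (le_max_right _ _).trans ht
      have h1 := hC z (by rw [hz]; exact (le_max_left _ _).trans ht)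
      rw [hz] at h1
      have h2 : 0 ≤ ε / (2 * π) * t + |C| := by positivity
      have h3 : exp (ε / (2 * π) * t + C) ≤ exp (ε / (2 * π) * t + |C|) := exp_le_exp.2 (by linarith [le_abs_self C])
      have h4 := one_le_exp h2
      show log (1 + HH l V z) ≤ _
      rw [log_le_iff_le_exp (hpos z), exp_add, exp_log (by norm_num)]
      linarith
  have hl0 : ∀ z, lap S z = 0 := by
    intro z
    refine circ_eq_zero (continuous_lap hS) ?_ hS0 z.re (hc z.re) z rfl
    intro w
    show dx (dx S) _ + dy (dy S) _ = dx (dx S) _ + dy (dy S) _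
    rw [hSp.dx.dx w, hSp.dy.dy w]
  intro z
  by_contra hne
  have h1 := hnn z
  rw [hl0 z] at h1
  have hk := kap_pos l z.re
  have hJ := h.J2_pos hl z.re
  have hH : 0 < HH l V z := by
    unfold HH QQ
    have := mul_self_nonneg (dx (dy V) z)
    have := mul_self_nonneg (dy (dy V) z)
    have : 0 < dy V z * dy V z := mul_self_pos.2 hne
    positivity
  have : 0 < kap l z.re * J2 l z.re * dy V z ^ 2 * HH l V z / 2 / (1 + HH l V z) ^ 2 := by positivity
  linarith

end Cyl
end MF

namespace MF

structure Pl (ρ l : ℝ) (v : ℂ → ℝ) : Prop where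
  smooth : ContDiff ℝ 4 v
  eq : ∀ z, lap v z = -((1 + ‖z‖ ^ 2) ^ l * exp (v z))
  int : Integrable (fun z : ℂ => (1 + ‖z‖ ^ 2) ^ l * exp (v z))
  mass : ∫ z : ℂ, (1 + ‖z‖ ^ 2) ^ l * exp (v z) = 8 * π * ρ
  gx : dx v 0 = 0
  gy : dy v 0 = 0

lemma contDiff_weight {n : WithTop ℕ∞} (l : ℝ) : ContDiff ℝ n (fun z : ℂ => (1 + ‖z‖ ^ 2) ^ l) :=
  ContDiff.rpow_const_of_ne (contDiff_const.add (contDiff_norm_sq ℝ)) (fun z => by positivity)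

/-- regularity -/
lemma reg4 {l : ℝ} {v : ℂ → ℝ} (hv : ContDiff ℝ 2 v)
    (heq : ∀ z, lap v z = -((1 + ‖z‖ ^ 2) ^ l * exp (v z))) : ContDiff ℝ 4 v := by
  have e : lap v = fun z => -((1 + ‖z‖ ^ 2) ^ l * exp (v z)) := funext heq
  have h3 : ContDiff ℝ 3 v := by
    have := elliptic (n := 2) hv (by norm_num) (by
      rw [e]; exact ((contDiff_weight l).mul (by exact_mod_cast hv.exp)).neg)
    exact_mod_cast this
  have := elliptic (n := 3) hv (by norm_num) (by
      rw [e]; exact ((contDiff_weight l).mul (by exact_mod_cast h3.exp)).neg)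
  exact_mod_cast this

namespace Pl
variable {ρ l : ℝ} {v : ℂ → ℝ} (h : Pl ρ l v)
include h

lemma G_eq (z : ℂ) : GG l (fun z => v (Complex.exp z)) z =
    exp (2 * z.re) * ((1 + ‖Complex.exp z‖ ^ 2) ^ l * exp (v (Complex.exp z))) := by
  unfold GG K
  rw [Complex.norm_exp, ← exp_nat_mul]
  push_cast
  ring

lemma cyl : Cyl l (fun z => v (Complex.exp z)) where
  smooth := contDiff_exp_comp h.smooth
  per := per_exp v
  eq := fun z => by
    rw [lap_exp (h.smooth.of_le (by norm_num)), h.eq]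
    have := h.G_eq z
    unfold GG at this
    rw [this]; ring

lemma flux_deriv (t : ℝ) : HasDerivAt (circ (dx (fun z => v (Complex.exp z))))
    (-circ (GG l (fun z => v (Complex.exp z))) t) t := by
  have := circ_hasDerivAt2 h.cyl.s2 h.cyl.per t
  rw [h.cyl.lapV] at this
  refine HasDerivAt.congr_deriv this ?_
  rw [show (fun z => -GG l (fun z => v (Complex.exp z)) z) = fun z => (-1) * GG l (fun z => v (Complex.exp z)) z by funext z; ring, circ_mul]
  ring

lemma flux_top : Filter.Tendsto (circ (dx (fun z => v (Complex.exp z)))) Filter.atTop (nhds (-(8 * π * ρ))) := by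
  obtain ⟨hi, hm⟩ := polar_circ h.int
  rw [h.mass] at hm
  set b : ℝ → ℝ := fun r => r * circ (fun z => (1 + ‖Complex.exp z‖ ^ 2) ^ l * exp (v (Complex.exp z))) (log r)
  set A := circ (dx (fun z => v (Complex.exp z))) with hA
  let f : ℝ → ℝ := fun r => if r ≤ 0 then 0 else A (log r)
  have hf : ∀ r ∈ Set.Ioi (0:ℝ), f =ᶠ[nhds r] fun r => A (log r) := by
    intro r hr
    filter_upwards [Ioi_mem_nhds hr] with s hs
    simp only [f]
    rw [if_neg (not_le.2 hs)]
  have hd : ∀ r ∈ Set.Ioi (0:ℝ), HasDerivAt f (-b r) r := by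
    intro r hr
    have hr0 : 0 < r := hr
    have h1 := (h.flux_deriv (log r)).comp r (hasDerivAt_log hr0.ne')
    refine HasDerivAt.congr_of_eventuallyEq ?_ (hf r hr)
    refine HasDerivAt.congr_deriv h1 ?_
    have : circ (GG l (fun z => v (Complex.exp z))) (log r)
        = r ^ 2 * circ (fun z => (1 + ‖Complex.exp z‖ ^ 2) ^ l * exp (v (Complex.exp z))) (log r) := by
      rw [← circ_mul]
      unfold circ
      congr 1
      funext θ
      rw [h.G_eq]
      simp only [Complex.add_re, Complex.ofReal_re, Complex.mul_re, Complex.ofReal_im, Complex.I_re, Complex.I_im]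
      rw [show (2 * (log r + (θ * 0 - 0 * 1))) = (2:ℕ) * log r by push_cast; ring, exp_nat_mul, exp_log hr0]
    rw [this]
    simp only [b]
    field_simp
  have hfi : IntegrableOn (fun r => -b r) (Set.Ioi 0) := hi.neg
  have hlim := tendsto_limUnder_of_hasDerivAt_of_integrableOn_Ioi hd hfi
  have hc : ContinuousWithinAt f (Set.Ici 0) 0 := by
    rw [← continuousWithinAt_Ioi_iff_Ici]
    show Filter.Tendsto f _ (nhds (f 0))
    have f0 : f 0 = 0 := by simp [f]
    rw [f0]
    have h2 : Filter.Tendsto (fun r => A (log r)) (nhdsWithin 0 (Set.Ioi 0)) (nhds 0) :=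
      (circ_dx_exp_tendsto (h.smooth.of_le (by norm_num))).comp tendsto_log_nhdsGT_zero
    refine h2.congr' ?_
    filter_upwards [self_mem_nhdsWithin] with r hr
    exact ((hf r hr).eq_of_nhds).symm
  have h3 := integral_Ioi_of_hasDerivAt_of_tendsto hc hd hfi hlim
  have h4 : ∫ r in Set.Ioi (0:ℝ), -b r = -(8 * π * ρ) := by rw [integral_neg, ← hm]
  have f0 : f 0 = 0 := by simp [f]
  rw [h4, f0, sub_zero] at h3
  rw [← h3] at hlim
  have h5 := hlim.comp Real.tendsto_exp_atTop
  refine h5.congr fun t => ?_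
  simp only [f, Function.comp]
  rw [if_neg (not_le.2 (exp_pos t)), log_exp]

lemma flux_bot : Filter.Tendsto (circ (dx (fun z => v (Complex.exp z)))) Filter.atBot (nhds 0) :=
  circ_dx_exp_tendsto (h.smooth.of_le (by norm_num))

end Pl
end MF

namespace MF

lemma lin_bound {g : ℂ → ℝ} (hg : ContDiff ℝ 1 g) (h0 : g 0 = 0) :
    ∃ C : ℝ, 0 ≤ C ∧ ∀ w : ℂ, ‖w‖ ≤ 1 → |g w| ≤ C * ‖w‖ := by
  obtain ⟨C, hC⟩ := (isCompact_closedBall (0:ℂ) 1).exists_bound_of_continuousOn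
    (hg.continuous_fderiv (by norm_num)).continuousOn
  have hC0 : 0 ≤ C := (norm_nonneg _).trans (hC 0 (by simp))
  refine ⟨C, hC0, fun w hw => ?_⟩
  have := (convex_closedBall (0:ℂ) 1).norm_image_sub_le_of_norm_fderiv_le (𝕜 := ℝ) (f := g)
    (fun x _ => (hg.differentiable (by norm_num)) x) hC (x := 0) (y := w) (by simp) (by simpa using hw)
  simpa [h0] using this

lemma bdd_bound {g : ℂ → ℝ} (hg : Continuous g) :
    ∃ C : ℝ, 0 ≤ C ∧ ∀ w : ℂ, ‖w‖ ≤ 1 → |g w| ≤ C := by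
  obtain ⟨C, hC⟩ := (isCompact_closedBall (0:ℂ) 1).exists_bound_of_continuousOn hg.continuousOn
  exact ⟨C, (norm_nonneg _).trans (hC 0 (by simp)), fun w hw => hC w (by simpa using hw)⟩

lemma abs_mul_le' {a b A B : ℝ} (ha : |a| ≤ A) (hb : |b| ≤ B) : -(A * B) ≤ a * b ∧ a * b ≤ A * B := by
  rw [← abs_le, abs_mul]
  exact mul_le_mul ha hb (abs_nonneg _) ((abs_nonneg _).trans ha)

lemma real_bounds {x y a b c d e R C : ℝ} (hx : |x| ≤ R) (hy : |y| ≤ R) (ha : |a| ≤ C * R) (hb : |b| ≤ C * R)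
    (hc : |c| ≤ C) (hd : |d| ≤ C) (he : |e| ≤ C) :
    |-y * a + x * b| ≤ 6 * C * R ^ 2 ∧ |-(x * a + y * b) + y ^ 2 * c - 2 * x * y * d + x ^ 2 * e| ≤ 6 * C * R ^ 2
    ∧ |(-y * a + x * b) - x * y * c + (x ^ 2 - y ^ 2) * d + x * y * e| ≤ 6 * C * R ^ 2 := by
  have hR : 0 ≤ R := (abs_nonneg _).trans hx
  have hC : 0 ≤ C := (abs_nonneg _).trans hc
  have hCR : 0 ≤ C * R ^ 2 := by positivity
  obtain ⟨p1, p2⟩ := abs_mul_le' hx ha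
  obtain ⟨p3, p4⟩ := abs_mul_le' hx hb
  obtain ⟨p5, p6⟩ := abs_mul_le' hy ha
  obtain ⟨p7, p8⟩ := abs_mul_le' hy hb
  have hxy : |x * y| ≤ R * R := abs_le.2 (abs_mul_le' hx hy)
  have hxx : |x * x| ≤ R * R := abs_le.2 (abs_mul_le' hx hx)
  have hyy : |y * y| ≤ R * R := abs_le.2 (abs_mul_le' hy hy)
  obtain ⟨q1, q2⟩ := abs_mul_le' hxy hc
  obtain ⟨q3, q4⟩ := abs_mul_le' hxy hd
  obtain ⟨q5, q6⟩ := abs_mul_le' hxy he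
  obtain ⟨r1, r2⟩ := abs_mul_le' hxx hd
  obtain ⟨r3, r4⟩ := abs_mul_le' hxx he
  obtain ⟨s1, s2⟩ := abs_mul_le' hyy hc
  obtain ⟨s3, s4⟩ := abs_mul_le' hyy hd
  refine ⟨abs_le.2 ⟨?_, ?_⟩, abs_le.2 ⟨?_, ?_⟩, abs_le.2 ⟨?_, ?_⟩⟩ <;> ring_nf at * <;> linarith

namespace Pl
variable {ρ l : ℝ} {v : ℂ → ℝ} (h : Pl ρ l v)
include h

lemma H_bot (hl : 0 < l) : ∃ C T, ∀ z : ℂ, z.re ≤ T → HH l (fun z => v (Complex.exp z)) z ≤ C := by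
  have v2 : ContDiff ℝ 2 v := h.smooth.of_le (by norm_num)
  have x1 : ContDiff ℝ 1 (dx v) := cd_dx 1 (by exact_mod_cast v2)
  have y1 : ContDiff ℝ 1 (dy v) := cd_dy 1 (by exact_mod_cast v2)
  obtain ⟨C1, c1, b1⟩ := lin_bound x1 h.gx
  obtain ⟨C2, c2, b2⟩ := lin_bound y1 h.gy
  obtain ⟨C3, c3, b3⟩ := bdd_bound (cd_dx (f := dx v) 0 (by exact_mod_cast x1)).continuous
  obtain ⟨C4, c4, b4⟩ := bdd_bound (cd_dy (f := dx v) 0 (by exact_mod_cast x1)).continuous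
  obtain ⟨C5, c5, b5⟩ := bdd_bound (cd_dy (f := dy v) 0 (by exact_mod_cast y1)).continuous
  obtain ⟨C6, c6, b6⟩ := bdd_bound h.smooth.continuous
  set C := C1 + C2 + C3 + C4 + C5 with hC
  refine ⟨exp C6 * (72 * C ^ 2) + 2 ^ l * (18 * C ^ 2), 0, fun z hz => ?_⟩
  set w := Complex.exp z with hw
  have hR : ‖w‖ = exp z.re := Complex.norm_exp z
  have hR1 : ‖w‖ ≤ 1 := by rw [hR]; exact exp_le_one_iff.2 hz
  have hR0 := norm_nonneg w
  obtain ⟨k1, k2, k3⟩ := real_bounds (Complex.abs_re_le_norm w) (Complex.abs_im_le_norm w)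
    (a := dx v w) (b := dy v w) (c := dx (dx v) w) (d := dy (dx v) w) (e := dy (dy v) w) (C := C)
    ((b1 w hR1).trans (by gcongr; linarith)) ((b2 w hR1).trans (by gcongr; linarith))
    ((b3 w hR1).trans (by linarith)) ((b4 w hR1).trans (by linarith)) ((b5 w hR1).trans (by linarith))
  obtain ⟨-, e2, e3⟩ := second_exp v2 z
  have e1 := congrFun (dy_exp (h.smooth.differentiable (by norm_num))) z
  rw [← hw] at e2 e3
  rw [← hw] at e1
  rw [← e1] at k1
  rw [← e2] at k2
  rw [← e3] at k3
  have hR2 : ‖w‖ ^ 2 = exp (2 * z.re) := by rw [hR, ← exp_nat_mul]; norm_cast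
  rw [hR2] at k1 k2 k3
  set V : ℂ → ℝ := fun z => v (Complex.exp z) with hV
  have m1 : dy V z * dy V z ≤ 36 * C ^ 2 * exp (4 * z.re) := by
    have := (abs_mul_le' k1 k1).2
    refine this.trans (le_of_eq ?_)
    rw [show 4 * z.re = 2 * z.re + 2 * z.re by ring, exp_add]; ring
  have m2 : dy (dy V) z * dy (dy V) z ≤ 36 * C ^ 2 * exp (4 * z.re) := by
    have := (abs_mul_le' k2 k2).2
    refine this.trans (le_of_eq ?_)
    rw [show 4 * z.re = 2 * z.re + 2 * z.re by ring, exp_add]; ring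
  have m3 : dx (dy V) z * dx (dy V) z ≤ 36 * C ^ 2 * exp (4 * z.re) := by
    have := (abs_mul_le' k3 k3).2
    refine this.trans (le_of_eq ?_)
    rw [show 4 * z.re = 2 * z.re + 2 * z.re by ring, exp_add]; ring
  unfold HH QQ E0
  have hVz : -V z ≤ C6 := by
    have := (abs_le.1 (b6 w hR1)).1
    simp only [hV, ← hw]; linarith
  have n1 : exp (-4 * z.re + -V z) * (dx (dy V) z * dx (dy V) z + dy (dy V) z * dy (dy V) z) ≤ exp C6 * (72 * C ^ 2) := by
    have hle : dx (dy V) z * dx (dy V) z + dy (dy V) z * dy (dy V) z ≤ 72 * C ^ 2 * exp (4 * z.re) := by linarith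
    calc _ ≤ exp (-4 * z.re + -V z) * (72 * C ^ 2 * exp (4 * z.re)) := by gcongr
      _ = exp (-V z) * (72 * C ^ 2) := by
        rw [exp_add, show -4 * z.re = -(4 * z.re) by ring, exp_neg (4 * z.re)]; field_simp
      _ ≤ _ := by gcongr
  have n2 : kap l z.re * (1 / 2 * (dy V z * dy V z)) ≤ 2 ^ l * (18 * C ^ 2) := by
    have hk : kap l z.re ≤ exp (-2 * z.re) * 2 ^ l := by
      unfold kap
      gcongr
      have : exp (2 * z.re) ≤ 1 := exp_le_one_iff.2 (by linarith)
      linarith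
    calc _ ≤ (exp (-2 * z.re) * 2 ^ l) * (1 / 2 * (36 * C ^ 2 * exp (4 * z.re))) := by
          apply mul_le_mul hk (by linarith) (by have := mul_self_nonneg (dy V z); positivity) (by positivity)
      _ = exp (2 * z.re) * (2 ^ l * (18 * C ^ 2)) := by
          rw [show 4 * z.re = 2 * z.re + 2 * z.re by ring, exp_add, show -2 * z.re = -(2 * z.re) by ring, exp_neg]
          field_simp; ring
      _ ≤ 1 * (2 ^ l * (18 * C ^ 2)) := by
          gcongr; exact exp_le_one_iff.2 (by linarith)
      _ = _ := one_mul _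
  linarith

end Pl
end MF

namespace MF

lemma ball_le_const {G : ℂ → ℝ} (hG : Continuous G) (hp : Per G) (h0 : ∀ z, 0 ≤ G z) (y : ℂ) {c : ℝ}
    (h : ∀ t, y.re - 1 ≤ t → t ≤ y.re + 1 → circ G t ≤ c) :
    ∫ z in Metric.closedBall (0:ℂ) 1, G (y + z) ≤ 2 * c := by
  refine (ball_le_circ hG hp h0 y).trans ?_
  have h1 : ∫ t in (y.re - 1)..(y.re + 1), circ G t ≤ ∫ t in (y.re - 1)..(y.re + 1), c := by
    apply intervalIntegral.integral_mono_on (by linarith) ((circ_continuous hG).intervalIntegrable _ _) (by simp)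
    exact fun t ht => h t ht.1 ht.2
  refine h1.trans (le_of_eq ?_)
  rw [intervalIntegral.integral_const, smul_eq_mul]; ring

lemma per_abs {f : ℂ → ℝ} (hp : Per f) : Per (fun z => |f z|) := fun z => by
  show |f _| = |f _|
  rw [hp z]

lemma re_ball {z y : ℂ} {r : ℝ} (h : z ∈ Metric.closedBall y r) : y.re - r ≤ z.re ∧ z.re ≤ y.re + r := by
  have h1 : ‖z - y‖ ≤ r := by simpa [dist_eq_norm] using h
  have h2 := (Complex.abs_re_le_norm (z - y)).trans h1
  rw [Complex.sub_re, abs_le] at h2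
  constructor <;> linarith

namespace Cyl
variable {l : ℝ} {V : ℂ → ℝ} (h : Cyl l V)
include h

lemma G_pos (z : ℂ) : 0 < GG l V z := mul_pos (K_pos _ _) (exp_pos _)

lemma G_per : Per (GG l V) := fun z => by
  unfold GG
  rw [h.per z]; simp

lemma flux_deriv (t : ℝ) : HasDerivAt (circ (dx V)) (-circ (GG l V) t) t := by
  have := circ_hasDerivAt2 h.s2 h.per t
  rw [h.lapV] at this
  refine HasDerivAt.congr_deriv this ?_
  rw [show (fun z => -GG l V z) = fun z => (-1) * GG l V z by funext z; ring, circ_mul]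
  ring

lemma lapG_ge (hl : 0 < l) (z : ℂ) : -(GG l V z) ^ 2 ≤ lap (GG l V) z := by
  have hx : Differentiable ℝ (dx V) := (cd_dx (f := V) 1 (by exact_mod_cast h.s2)).differentiable (by norm_num)
  have hJd : Differentiable ℝ (fun z : ℂ => J l z.re) := fun z =>
    ((hasDerivAt_J l z.re).differentiableAt.comp z Complex.reCLM.differentiableAt : _)
  have c1 : dx (fun _ : ℂ => (4:ℝ)) = fun _ => 0 := by funext z; simp [dx]
  have e : lap (GG l V) z = GG l V z * ((dx V z + J l z.re + 4) ^ 2 + dy V z ^ 2 + J2 l z.re + lap V z) := by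
    unfold lap
    rw [h.dxG, h.dyG, dx_mul h.G0 ((hx.fun_add hJd).fun_add (differentiable_const _)), dy_mul h.G0 h.phi0,
      h.dxG, h.dyG, dx_add (hx.fun_add hJd) (differentiable_const _), dx_add hx hJd, dx_re (hasDerivAt_J l), c1]
    ring
  rw [e, h.lapV]
  have hG := h.G_pos z
  have hJ := h.J2_pos hl z.re
  have : 0 ≤ GG l V z * ((dx V z + J l z.re + 4) ^ 2 + dy V z ^ 2 + J2 l z.re) := by positivity
  nlinarith

variable {M : ℝ} (hl : 0 < l) (ftop : Filter.Tendsto (circ (dx V)) Filter.atTop (nhds (-M)))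
  (fbot : Filter.Tendsto (circ (dx V)) Filter.atBot (nhds 0))
include hl ftop fbot

lemma flux_anti : Antitone (circ (dx V)) :=
  antitone_of_hasDerivAt_nonpos h.flux_deriv (fun t => by
    have := circ_nonneg (S := GG l V) t (fun z _ => (h.G_pos z).le)
    show -circ (GG l V) t ≤ 0
    linarith)

lemma flux_mem (t : ℝ) : -M ≤ circ (dx V) t ∧ circ (dx V) t ≤ 0 :=
  ⟨(h.flux_anti hl ftop fbot).le_of_tendsto ftop t, (h.flux_anti hl ftop fbot).ge_of_tendsto fbot t⟩

lemma G_small (δ : ℝ) (hδ : 0 < δ) : ∃ T, ∀ z : ℂ, T ≤ z.re → GG l V z ≤ δ := by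
  set m := min (δ * π / 8) (π / 32) with hm
  have hpi := pi_pos
  have hm0 : 0 < m := lt_min (by positivity) (by positivity)
  have h1 : ∀ᶠ t in Filter.atTop, circ (dx V) t < -M + m := ftop.eventually_lt_const (by linarith)
  obtain ⟨T, hT⟩ := Filter.eventually_atTop.1 h1
  refine ⟨T + 1, fun z hz => ?_⟩
  have h2 : ∫ w in Metric.closedBall (0:ℂ) 1, GG l V (z + w) ≤ m := by
    refine (ball_le_circ h.G2.continuous h.G_per (fun z => (h.G_pos z).le) z).trans ?_
    have h3 : ∫ t in (z.re - 1)..(z.re + 1), -circ (GG l V) t = circ (dx V) (z.re + 1) - circ (dx V) (z.re - 1) :=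
      intervalIntegral.integral_eq_sub_of_hasDerivAt (fun t _ => h.flux_deriv t)
        ((circ_continuous h.G2.continuous).neg.intervalIntegrable _ _)
    rw [intervalIntegral.integral_neg] at h3
    have h4 := (h.flux_mem hl ftop fbot (z.re + 1)).1
    have h5 := hT (z.re - 1) (by linarith)
    linarith
  have h6 := eps_reg h.G2 h.G_pos (h.lapG_ge hl) z h2 ((min_le_right _ _).trans_lt (by linarith))
  refine h6.trans ?_
  have : 8 / π * m ≤ 8 / π * (δ * π / 8) := by gcongr; exact min_le_left _ _
  refine this.trans (le_of_eq ?_)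
  field_simp

lemma circ_V_lin (t : ℝ) : |circ V t| ≤ |circ V 0| + M * |t| := by
  have hM : 0 ≤ M := by
    have := h.flux_mem hl ftop fbot 0
    linarith [this.1, this.2]
  have hd : ∀ t, HasDerivAt (circ V) (circ (dx V) t) t := fun t => circ_hasDerivAt h.s1 t
  have := (convex_univ (𝕜 := ℝ) (E := ℝ)).norm_image_sub_le_of_norm_hasDerivWithin_le (f := circ V)
    (f' := circ (dx V)) (C := M) (x := 0) (y := t) (fun x _ => (hd x).hasDerivWithinAt)
    (fun x _ => by
      rw [Real.norm_eq_abs, abs_le]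
      have := h.flux_mem hl ftop fbot x
      constructor <;> linarith) trivial trivial
  simp only [Real.norm_eq_abs, sub_zero] at this
  have h2 := abs_sub_abs_le_abs_sub (circ V t) (circ V 0)
  linarith

lemma phi_lin : ∃ C T, 0 ≤ C ∧ 0 ≤ T ∧ ∀ z : ℂ, T ≤ z.re → |dy V z| ≤ C * (1 + z.re) := by
  obtain ⟨T, hT⟩ := h.G_small hl ftop fbot 1 one_pos
  obtain ⟨C, hC, hgrad⟩ := grad_est
  have hM : 0 ≤ M := by
    have := h.flux_mem hl ftop fbot 0
    linarith [this.1, this.2]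
  have hV : ∀ z : ℂ, max T 0 ≤ z.re → V z ≤ 0 := by
    intro z hz
    have h1 := hT z ((le_max_left _ _).trans hz)
    have h0 : 0 ≤ z.re := (le_max_right _ _).trans hz
    have hK : 1 ≤ K l z.re := by
      unfold K
      have a := one_le_exp (show 0 ≤ 2 * z.re by linarith)
      have b : 1 ≤ (1 + exp (2 * z.re)) ^ l := one_le_rpow (by linarith [exp_pos (2 * z.re)]) hl.le
      nlinarith
    have h2 : exp (V z) ≤ 1 := by
      unfold GG at h1
      have := exp_pos (V z)
      nlinarith
    exact exp_le_one_iff.1 h2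
  set D := |circ V 0| + M with hD
  have hD0 : 0 ≤ D := by positivity
  have hcirc : ∀ t, max T 0 ≤ t → circ (fun z => |V z|) t ≤ D * (1 + t) := by
    intro t ht
    have ht0 : 0 ≤ t := (le_max_right _ _).trans ht
    have e : circ (fun z => |V z|) t ≤ circ (fun z => (-1) * V z) t := by
      have hc : Continuous V := h.s1.continuous
      refine circ_mono (S := fun z => |V z|) (T := fun z => (-1) * V z) (by fun_prop) (by fun_prop) t ?_
      intro z hz
      show |V z| ≤ -1 * V z
      rw [abs_of_nonpos (hV z (hz ▸ ht))]; linarith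
    rw [circ_mul] at e
    have h3 := h.circ_V_lin hl ftop fbot t
    rw [abs_of_nonneg ht0] at h3
    have h4 := (abs_le.1 h3).1
    have := abs_nonneg (circ V 0)
    nlinarith
  refine ⟨C * (1 + 4 * D), max T 0 + 1, by positivity, by positivity, fun z hz => ?_⟩
  have hz0 : 1 ≤ z.re := by linarith [le_max_right T 0]
  have h5 := (hgrad V h.s2 z 1 (fun w hw => by
    rw [h.lapV]
    simp only [abs_neg]
    rw [abs_of_pos (h.G_pos w)]
    exact hT w (by linarith [(re_ball hw).1, le_max_left T 0]))).2
  have h6 := ball_le_const (G := fun z => |V z|) h.s1.continuous.abs (per_abs h.per) (fun z => abs_nonneg _) z (c := D * (2 + z.re)) (by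
    intro t h1 h2
    refine (hcirc t (by linarith)).trans ?_
    exact mul_le_mul_of_nonneg_left (by linarith) hD0)
  refine h5.trans ?_
  have : 1 + 2 * (D * (2 + z.re)) ≤ (1 + 4 * D) * (1 + z.re) := by nlinarith
  calc _ ≤ C * (1 + 2 * (D * (2 + z.re))) := by gcongr
    _ ≤ C * ((1 + 4 * D) * (1 + z.re)) := by gcongr
    _ = _ := by ring

end Cyl
end MF

namespace MF

lemma sqrt_decay {E E' E'' P : ℝ → ℝ} {κ T C : ℝ} (hκ : 0 < κ) (hC : 0 ≤ C)
    (h1 : ∀ t, HasDerivAt E (E' t) t) (h2 : ∀ t, HasDerivAt E' (E'' t) t)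
    (hE : ∀ t, 0 ≤ E t) (hP : ∀ t, 0 ≤ P t)
    (h3 : ∀ t ≥ T, 2 * P t + 2 * κ ^ 2 * E t ≤ E'' t)
    (hcs : ∀ t, E' t ^ 2 ≤ 4 * E t * P t)
    (h4 : ∀ t ≥ T, E t ≤ (C * (1 + |t|)) ^ 2) :
    ∀ t ≥ T, √(E t) ≤ √(E T) * exp (-κ * (t - T)) := by
  intro t ht
  refine le_of_forall_pos_le_add (fun η hη => ?_)
  have hq : ∀ t, 0 < E t + η ^ 2 := fun t => by have := hE t; positivity
  set N : ℝ → ℝ := fun t => √(E t + η ^ 2) with hN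
  have hN0 : ∀ t, 0 < N t := fun t => sqrt_pos.2 (hq t)
  have hNsq : ∀ t, N t ^ 2 = E t + η ^ 2 := fun t => sq_sqrt (hq t).le
  have hNη : ∀ t, η ≤ N t := fun t => le_sqrt_of_sq_le (by linarith [hE t])
  have d1 : ∀ t, HasDerivAt N (E' t / (2 * N t)) t := fun t => ((h1 t).add_const _).sqrt (hq t).ne'
  have d2 : ∀ t, HasDerivAt (fun t => E' t / (2 * N t)) (E'' t / (2 * N t) - E' t ^ 2 / (4 * N t ^ 3)) t := by
    intro t
    have h0 := (hN0 t).ne'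
    refine HasDerivAt.congr_deriv ((h2 t).fun_div ((d1 t).const_mul 2) (by positivity)) ?_
    field_simp
    ring
  have key := ode_decay (f := fun t => N t - η) (T := T) (C := C) hκ (fun t => (d1 t).sub_const η) d2 (by
    intro t ht
    have n0 := hN0 t
    have a : κ ^ 2 * (N t - η) ≤ κ ^ 2 * E t / N t := by
      rw [le_div_iff₀ n0]
      have := hNsq t
      have := hNη t
      have : (N t - η) * N t ≤ E t := by nlinarith
      nlinarith [sq_nonneg κ]
    have b : E' t ^ 2 / (4 * N t ^ 3) ≤ P t / N t := by
      rw [div_le_div_iff₀ (by positivity) n0]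
      have : E' t ^ 2 ≤ 4 * N t ^ 2 * P t := by
        refine (hcs t).trans ?_
        have := hP t
        rw [hNsq t]
        nlinarith [mul_nonneg (sq_nonneg η) this]
      calc E' t ^ 2 * N t ≤ 4 * N t ^ 2 * P t * N t := by gcongr
        _ = _ := by ring
    have c : P t / N t + κ ^ 2 * E t / N t ≤ E'' t / (2 * N t) := by
      rw [← add_div, div_le_div_iff₀ n0 (by positivity)]
      have := h3 t ht
      nlinarith
    linarith) (by
    intro t ht
    have : N t ≤ C * (1 + |t|) + η := by
      apply sqrt_le_iff.2 ⟨by positivity, ?_⟩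
      have := h4 t ht
      have : 0 ≤ C * (1 + |t|) * η := by positivity
      nlinarith
    show N t - η ≤ _
    linarith) t ht
  have a : √(E t) ≤ N t := sqrt_le_sqrt (by nlinarith [sq_nonneg η])
  have b : N T ≤ √(E T) + η := by
    apply sqrt_le_iff.2 ⟨by positivity, ?_⟩
    have := sq_sqrt (hE T)
    have : 0 ≤ √(E T) * η := by positivity
    nlinarith
  have c : (N T - η) * exp (-κ * (t - T)) ≤ √(E T) * exp (-κ * (t - T)) := by gcongr; linarith
  linarith

namespace Cyl
variable {l : ℝ} {V : ℂ → ℝ} (h : Cyl l V)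
include h
variable {M : ℝ} (hl : 0 < l) (ftop : Filter.Tendsto (circ (dx V)) Filter.atTop (nhds (-M)))
  (fbot : Filter.Tendsto (circ (dx V)) Filter.atBot (nhds 0))
include hl ftop fbot

lemma E_decay {κ : ℝ} (hκ : 0 < κ) (hκ1 : κ < 1) : ∃ C T, 0 ≤ C ∧ 0 ≤ T ∧ ∀ t ≥ T,
    circ (fun z => |dy V z|) t ≤ C * exp (-κ * t) := by
  obtain ⟨C, T1, hC, hT1, hlin⟩ := h.phi_lin hl ftop fbot
  obtain ⟨T2, hsm⟩ := h.G_small hl ftop fbot (1 - κ ^ 2) (by nlinarith)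
  set T := max T1 T2
  have hφ : Continuous (dy V) := h.phi1.continuous
  have hφx : Continuous (dx (dy V)) := h.p2.continuous
  have hφy : Continuous (dy (dy V)) := h.q2.continuous
  have hG : Continuous (GG l V) := h.G2.continuous
  have hE : ∀ t, 0 ≤ circ (fun z => dy V z ^ 2) t := fun t => circ_nonneg t (fun z _ => sq_nonneg _)
  have hP : ∀ t, 0 ≤ circ (fun z => dx (dy V) z ^ 2) t := fun t => circ_nonneg t (fun z _ => sq_nonneg _)
  have hper : Per (dy V) := h.per.dy
  have e2 : ContDiff ℝ 2 (fun z => dy V z * dy V z) := h.phi2.mul h.phi2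
  have eqE : (fun z => dy V z ^ 2) = fun z => dy V z * dy V z := by funext z; ring
  have hpp : Per (fun z => dy V z * dy V z) := fun z => by
    show dy V _ * dy V _ = _
    rw [hper z]
  have eqE' : dx (fun z => dy V z * dy V z) = fun z => 2 * (dy V z * dx (dy V) z) := by
    rw [dx_mul h.phi0 h.phi0]; funext z; ring
  have main := sqrt_decay (E := circ (fun z => dy V z ^ 2)) (E' := circ (dx (fun z => dy V z * dy V z)))
    (E'' := circ (lap (fun z => dy V z * dy V z))) (P := circ (fun z => dx (dy V) z ^ 2)) (T := T) (κ := κ)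
    (C := √(2 * π) * C) hκ (by positivity)
    (fun t => by rw [eqE]; exact circ_hasDerivAt (e2.of_le (by norm_num)) t)
    (fun t => circ_hasDerivAt2 e2 hpp t) hE hP (by
      intro t ht
      have w := circ_wirtinger h.phi1 hper (circ_dy h.s1 h.per t)
      have : circ (fun z => (2 * dx (dy V) z ^ 2 + 2 * dy (dy V) z ^ 2) + (-2 * (1 - κ ^ 2)) * dy V z ^ 2) t
          ≤ circ (lap (fun z => dy V z * dy V z)) t := by
        refine circ_mono (S := fun z => (2 * dx (dy V) z ^ 2 + 2 * dy (dy V) z ^ 2) + (-2 * (1 - κ ^ 2)) * dy V z ^ 2)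
          (by fun_prop) (continuous_lap e2) t ?_
        intro z hz
        rw [lap_mul h.phi2 h.phi2, h.lapPhi]
        have g := hsm z (by rw [hz]; exact (le_max_right _ _).trans ht)
        have := mul_le_mul_of_nonneg_right g (sq_nonneg (dy V z))
        simp only
        nlinarith
      rw [circ_add (by fun_prop) (by fun_prop), circ_add (by fun_prop) (by fun_prop), circ_mul, circ_mul, circ_mul] at this
      linarith) (by
      intro t
      rw [eqE', circ_mul]
      have := circ_cs hφ hφx t
      nlinarith) (by
      intro t ht
      have ht0 : 0 ≤ t := hT1.trans ((le_max_left _ _).trans ht)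
      have : circ (fun z => dy V z ^ 2) t ≤ circ (fun _ => (C * (1 + t)) ^ 2) t := by
        refine circ_mono (by fun_prop) (by fun_prop) t ?_
        intro z hz
        have := hlin z (by rw [hz]; exact (le_max_left _ _).trans ht)
        rw [hz] at this
        exact sq_le_sq' (abs_le.1 this).1 (abs_le.1 this).2
      rw [circ_const] at this
      rw [abs_of_nonneg ht0, mul_assoc, mul_pow, sq_sqrt (by positivity)]
      exact this)
  refine ⟨√(2 * π) * (√(circ (fun z => dy V z ^ 2) T) * exp (κ * T)), T, by positivity, hT1.trans (le_max_left _ _), fun t ht => ?_⟩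
  refine (circ_abs_sq hφ t).trans ?_
  rw [sqrt_mul (by positivity)]
  have := main t ht
  calc _ ≤ √(2 * π) * (√(circ (fun z => dy V z ^ 2) T) * exp (-κ * (t - T))) := by gcongr
    _ = _ := by
      rw [show -κ * (t - T) = κ * T + -κ * t by ring, exp_add]; ring
end Cyl
end MF

namespace MF
namespace Cyl
variable {l : ℝ} {V : ℂ → ℝ} (h : Cyl l V)
include h
variable {M : ℝ} (hl : 0 < l) (ftop : Filter.Tendsto (circ (dx V)) Filter.atTop (nhds (-M)))
  (fbot : Filter.Tendsto (circ (dx V)) Filter.atBot (nhds 0))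
include hl ftop fbot

lemma V_asym {ε : ℝ} (hε : 0 < ε) : ∃ C T, 0 ≤ T ∧ ∀ z : ℂ, T ≤ z.re →
    |2 * π * V z + M * z.re| ≤ 2 * π * (ε * z.re + C) := by
  obtain ⟨C1, T1, hC1, hT1, h1⟩ := h.E_decay hl ftop fbot (κ := 1/2) (by norm_num) (by norm_num)
  have h2 : ∀ᶠ t in Filter.atTop, circ (dx V) t < -M + 2 * π * ε := ftop.eventually_lt_const (by have := pi_pos; nlinarith)
  obtain ⟨T2, hT2⟩ := Filter.eventually_atTop.1 h2
  set T := max T1 T2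
  have hT0 : 0 ≤ T := hT1.trans (le_max_left _ _)
  refine ⟨C1 + |circ V T + M * T| / (2 * π), T, hT0, fun z hz => ?_⟩
  have hz0 : 0 ≤ z.re := hT0.trans hz
  have hd : ∀ t, HasDerivAt (fun t => circ V t + M * t) (circ (dx V) t + M) t := fun t => by
    simpa using (circ_hasDerivAt h.s1 t).fun_add ((hasDerivAt_id t).const_mul M)
  have h3 := (convex_Ici (𝕜 := ℝ) T).norm_image_sub_le_of_norm_hasDerivWithin_le (f := fun t => circ V t + M * t)
    (f' := fun t => circ (dx V) t + M) (C := 2 * π * ε) (x := T) (y := z.re) (fun x _ => (hd x).hasDerivWithinAt)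
    (fun x hx => by
      rw [Real.norm_eq_abs, abs_le]
      have a := h.flux_mem hl ftop fbot x
      have b := hT2 x ((le_max_right _ _).trans hx)
      have : 0 ≤ 2 * π * ε := by positivity
      constructor <;> linarith) Set.self_mem_Ici hz
  simp only [Real.norm_eq_abs] at h3
  rw [abs_of_nonneg (by linarith : 0 ≤ z.re - T)] at h3
  have h4 := circ_osc h.s1 h.per z
  have h5 := h1 z.re ((le_max_left _ _).trans hz)
  have h6 : C1 * exp (-(1/2) * z.re) ≤ C1 := by
    have : exp (-(1/2) * z.re) ≤ 1 := exp_le_one_iff.2 (by linarith)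
    nlinarith
  have hpi : 0 < 2 * π := by positivity
  have h7 : 2 * π * circ (fun w => |dy V w|) z.re ≤ 2 * π * C1 := by
    gcongr; exact h5.trans h6
  have h8 : 2 * π * ε * (z.re - T) ≤ 2 * π * ε * z.re := by
    gcongr; linarith
  have h9 : 2 * π * (ε * z.re + (C1 + |circ V T + M * T| / (2 * π))) = 2 * π * ε * z.re + 2 * π * C1 + |circ V T + M * T| := by
    field_simp; ring
  rw [h9]
  have e : 2 * π * V z + M * z.re = (2 * π * V z - circ V z.re) + ((circ V z.re + M * z.re - (circ V T + M * T)) + (circ V T + M * T)) := by ring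
  rw [e]
  refine (abs_add_le _ _).trans ?_
  have := abs_add_le (circ V z.re + M * z.re - (circ V T + M * T)) (circ V T + M * T)
  linarith

lemma V_asym' (hM : M = 2 * π * (2 * l + 4)) {ε : ℝ} (hε : 0 < ε) : ∃ C T, 0 ≤ T ∧ ∀ z : ℂ, T ≤ z.re →
    |V z + (2 * l + 4) * z.re| ≤ ε * z.re + C := by
  obtain ⟨C, T, hT, hh⟩ := h.V_asym hl ftop fbot hε
  refine ⟨C, T, hT, fun z hz => ?_⟩
  have := hh z hz
  have hpi : 0 < 2 * π := by positivity
  rw [hM, show 2 * π * V z + 2 * π * (2 * l + 4) * z.re = 2 * π * (V z + (2 * l + 4) * z.re) by ring, abs_mul,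
    abs_of_pos hpi] at this
  exact le_of_mul_le_mul_left this hpi

omit h ftop fbot in
lemma pow_le_exp {t : ℝ} (ht : 0 ≤ t) : (1 + exp (2 * t)) ^ l ≤ 2 ^ l * exp (2 * l * t) := by
  have h1 : 1 ≤ exp (2 * t) := one_le_exp (by linarith)
  calc (1 + exp (2 * t)) ^ l ≤ (2 * exp (2 * t)) ^ l := by
        apply rpow_le_rpow (by positivity) (by linarith) hl.le
    _ = _ := by
      rw [mul_rpow (by norm_num) (exp_pos _).le, ← exp_mul]
      ring_nf

lemma G_asym (hM : M = 2 * π * (2 * l + 4)) {ε : ℝ} (hε : 0 < ε) : ∃ C T, 0 ≤ C ∧ 0 ≤ T ∧ ∀ z : ℂ, T ≤ z.re →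
    GG l V z ≤ C * exp ((-2 + ε) * z.re) := by
  obtain ⟨C, T, hT, hh⟩ := h.V_asym' hl ftop fbot hM hε
  refine ⟨2 ^ l * exp C, T, by positivity, hT, fun z hz => ?_⟩
  have h1 := (abs_le.1 (hh z hz)).2
  have h2 := pow_le_exp hl (hT.trans hz)
  have h3 : exp (V z) ≤ exp ((-(2 * l + 4) + ε) * z.re + C) := exp_le_exp.2 (by linarith)
  unfold GG K
  calc _ ≤ exp (2 * z.re) * (2 ^ l * exp (2 * l * z.re)) * exp ((-(2 * l + 4) + ε) * z.re + C) := by gcongr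
    _ = 2 ^ l * (exp (2 * z.re) * exp (2 * l * z.re) * exp ((-(2 * l + 4) + ε) * z.re + C)) := by ring
    _ = 2 ^ l * (exp C * exp ((-2 + ε) * z.re)) := by
      rw [← exp_add, ← exp_add, ← exp_add]; ring_nf
    _ = _ := by ring

lemma grad_decay (hM : M = 2 * π * (2 * l + 4)) {ε : ℝ} (hε : 0 < ε) (hε1 : ε < 1) :
    ∃ C T, 0 ≤ C ∧ 0 ≤ T ∧ ∀ z : ℂ, T ≤ z.re →
    |dx (dy V) z| ≤ C * exp (-(1 - ε) * z.re) ∧ |dy (dy V) z| ≤ C * exp (-(1 - ε) * z.re) := by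
  obtain ⟨C1, T1, hC1, hT1, h1⟩ := h.G_asym hl ftop fbot hM hε
  obtain ⟨C2, T2, hC2, hT2, h2⟩ := h.phi_lin hl ftop fbot
  obtain ⟨C3, T3, hC3, hT3, h3⟩ := h.E_decay hl ftop fbot (κ := 1 - ε) (by linarith) (by linarith)
  obtain ⟨C, hC, hgrad⟩ := grad_est
  set T := max T1 (max T2 T3) with hT
  have t1 : T1 ≤ T := le_max_left _ _
  have t2 : T2 ≤ T := (le_max_left _ _).trans (le_max_right _ _)
  have t3 : T3 ≤ T := (le_max_right _ _).trans (le_max_right _ _)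
  refine ⟨C * (C1 * C2 * exp 1 + 2 * (C3 * exp 1)), T + 1, by positivity, by linarith, fun z hz => ?_⟩
  have hexp : ∀ s, z.re - 1 ≤ s → exp (-(1 - ε) * s) ≤ exp 1 * exp (-(1 - ε) * z.re) := by
    intro s hs
    rw [← exp_add]
    apply exp_le_exp.2
    nlinarith
  have h4 := hgrad (dy V) h.phi2 z (C1 * C2 * (exp 1 * exp (-(1 - ε) * z.re))) (by
    intro w hw
    have hw1 := (re_ball hw).1
    have hw0 : 0 ≤ w.re := by linarith
    rw [h.lapPhi]
    simp only [abs_neg, abs_mul]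
    rw [abs_of_pos (h.G_pos w)]
    calc _ ≤ (C1 * exp ((-2 + ε) * w.re)) * (C2 * (1 + w.re)) := by
          gcongr
          · exact h1 w (by linarith)
          · exact h2 w (by linarith)
      _ ≤ (C1 * exp ((-2 + ε) * w.re)) * (C2 * exp w.re) := by
          gcongr; linarith [add_one_le_exp w.re]
      _ = C1 * C2 * (exp ((-2 + ε) * w.re) * exp w.re) := by ring
      _ = C1 * C2 * exp (-(1 - ε) * w.re) := by rw [← exp_add]; ring_nf
      _ ≤ _ := by gcongr; exact hexp _ hw1)
  have h5 := ball_le_const (G := fun z => |dy V z|) h.phi1.continuous.abs (per_abs h.per.dy) (fun z => abs_nonneg _) z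
    (c := C3 * (exp 1 * exp (-(1 - ε) * z.re))) (by
    intro t ha hb
    refine (h3 t (by linarith)).trans ?_
    gcongr
    exact hexp _ ha)
  have h6 : C * (C1 * C2 * (exp 1 * exp (-(1 - ε) * z.re)) + ∫ w in Metric.closedBall (0:ℂ) 1, |dy V (z + w)|)
      ≤ C * (C1 * C2 * exp 1 + 2 * (C3 * exp 1)) * exp (-(1 - ε) * z.re) := by
    rw [mul_assoc C]
    gcongr
    linarith
  exact ⟨h4.1.trans h6, h4.2.trans h6⟩

lemma H_top (hl1 : l ≤ 1) (hM : M = 2 * π * (2 * l + 4)) :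
    ∀ ε > 0, ∃ C T, ∀ z : ℂ, T ≤ z.re → HH l V z ≤ exp (ε * z.re + C) := by
  intro ε' hε'
  obtain ⟨ε, hε, hε1, hεε⟩ : ∃ ε : ℝ, 0 < ε ∧ ε < 1 ∧ 3 * ε ≤ ε' := by
    refine ⟨min (ε' / 3) (1/2), by positivity, ?_, ?_⟩
    · exact (min_le_right _ _).trans_lt (by norm_num)
    · linarith [min_le_left (ε' / 3) (1/2)]
  obtain ⟨C1, T1, hT1, h1⟩ := h.V_asym' hl ftop fbot hM hε
  obtain ⟨C, T2, hC, hT2, h2⟩ := h.grad_decay hl ftop fbot hM hε hε1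
  refine ⟨log (2 * C ^ 2 * exp C1 + 4 * π ^ 2 * C ^ 2 + 1), max T1 T2, fun z hz => ?_⟩
  have z1 : T1 ≤ z.re := (le_max_left _ _).trans hz
  have z2 : T2 ≤ z.re := (le_max_right _ _).trans hz
  have z0 : 0 ≤ z.re := hT1.trans z1
  have hpi := pi_pos
  obtain ⟨a, b⟩ := h2 z z2
  set D := C * exp (-(1 - ε) * z.re) with hD
  have hD0 : 0 ≤ D := by positivity
  have hD2 : D ^ 2 = C ^ 2 * exp (-2 * (1 - ε) * z.re) := by
    rw [hD, mul_pow, ← exp_nat_mul]; push_cast; ring_nf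
  have c : |dy V z| ≤ 2 * π * D := by
    have o := circ_osc h.phi1 h.per.dy z
    rw [circ_dy h.s1 h.per, sub_zero, abs_mul, abs_of_pos (by positivity : 0 < 2 * π)] at o
    have o2 := le_of_mul_le_mul_left o (by positivity)
    refine o2.trans ?_
    have : circ (fun w => |dy (dy V) w|) z.re ≤ circ (fun _ => D) z.re := by
      refine circ_mono h.q2.continuous.abs continuous_const _ ?_
      intro w hw
      have := (h2 w (by rw [hw]; exact z2)).2
      rwa [hw] at this
    rwa [circ_const] at this
  have q : QQ V z ≤ 2 * D ^ 2 := by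
    unfold QQ
    have := sq_le_sq' (abs_le.1 a).1 (abs_le.1 a).2
    have := sq_le_sq' (abs_le.1 b).1 (abs_le.1 b).2
    nlinarith
  have c2 : dy V z * dy V z ≤ 4 * π ^ 2 * D ^ 2 := by
    have := sq_le_sq' (abs_le.1 c).1 (abs_le.1 c).2
    nlinarith
  have e0 : exp (E0 V z) ≤ exp C1 * exp ((2 + ε) * z.re) := by
    rw [← exp_add]
    apply exp_le_exp.2
    unfold E0
    have := (abs_le.1 (h1 z z1)).1
    nlinarith
  have k0 : kap l z.re ≤ 2 := by
    unfold kap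
    have := pow_le_exp hl z0
    calc _ ≤ exp (-2 * z.re) * (2 ^ l * exp (2 * l * z.re)) := by gcongr
      _ ≤ exp (-2 * z.re) * (2 ^ (1:ℝ) * exp (2 * 1 * z.re)) := by
        gcongr
        norm_num
      _ = 2 * (exp (-2 * z.re) * exp (2 * 1 * z.re)) := by rw [rpow_one]; ring
      _ = 2 := by rw [← exp_add]; ring_nf; simp
  have hQ0 : 0 ≤ QQ V z := by unfold QQ; nlinarith [mul_self_nonneg (dx (dy V) z), mul_self_nonneg (dy (dy V) z)]
  have hX : 1 ≤ exp (3 * ε * z.re) := one_le_exp (by positivity)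
  have hY : exp (-2 * (1 - ε) * z.re) ≤ exp (3 * ε * z.re) := exp_le_exp.2 (by nlinarith)
  have p1 : exp (E0 V z) * QQ V z ≤ 2 * C ^ 2 * exp C1 * exp (3 * ε * z.re) := by
    calc _ ≤ (exp C1 * exp ((2 + ε) * z.re)) * (2 * D ^ 2) := by gcongr
      _ = 2 * C ^ 2 * exp C1 * (exp ((2 + ε) * z.re) * exp (-2 * (1 - ε) * z.re)) := by rw [hD2]; ring
      _ = _ := by rw [← exp_add]; ring_nf
  have p2 : kap l z.re * (1 / 2 * (dy V z * dy V z)) ≤ 4 * π ^ 2 * C ^ 2 * exp (3 * ε * z.re) := by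
    calc _ ≤ 2 * (1 / 2 * (4 * π ^ 2 * D ^ 2)) := by
          have := mul_self_nonneg (dy V z)
          gcongr
      _ = 4 * π ^ 2 * C ^ 2 * exp (-2 * (1 - ε) * z.re) := by rw [hD2]; ring
      _ ≤ _ := by gcongr
  rw [exp_add, exp_log (by positivity)]
  unfold HH
  have hZ : exp (3 * ε * z.re) ≤ exp (ε' * z.re) := exp_le_exp.2 (by nlinarith)
  calc _ ≤ (2 * C ^ 2 * exp C1 + 4 * π ^ 2 * C ^ 2 + 1) * exp (3 * ε * z.re) := by nlinarith
    _ ≤ (2 * C ^ 2 * exp C1 + 4 * π ^ 2 * C ^ 2 + 1) * exp (ε' * z.re) := by gcongr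
    _ = _ := by ring
end Cyl

/-- radial symmetry -/
lemma Pl.radial {ρ l : ℝ} {v : ℂ → ℝ} (h : Pl ρ l v) (hl : l = 2 * (ρ - 1)) (h1 : 1 < ρ) (h2 : ρ ≤ 3 / 2) :
    ∀ z, dy (fun z => v (Complex.exp z)) z = 0 := by
  have l0 : 0 < l := by linarith
  refine h.cyl.phi_zero l0 (h.H_bot l0) ?_
  exact h.cyl.H_top l0 h.flux_top h.flux_bot (by linarith) (by rw [hl]; ring)
end MF

namespace MF
open MeasureTheory Real Filter Topology

noncomputable def sg (t : ℝ) : ℝ := exp (2 * t) / (1 + exp (2 * t))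

lemma sg_pos (t : ℝ) : 0 < sg t := by unfold sg; positivity
lemma one_sub_sg (t : ℝ) : 1 - sg t = 1 / (1 + exp (2 * t)) := by unfold sg; field_simp; ring
lemma sg_lt (t : ℝ) : sg t < 1 := by
  have : 0 < 1 - sg t := by rw [one_sub_sg]; positivity
  linarith
lemma sg_deriv (t : ℝ) : HasDerivAt sg (2 * (sg t * (1 - sg t))) t := by
  have hp : 0 < 1 + exp (2 * t) := by positivity
  refine HasDerivAt.congr_deriv ((hasDerivAt_exp2 2 t).fun_div ((hasDerivAt_exp2 2 t).const_add 1) hp.ne') ?_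
  rw [one_sub_sg]; unfold sg; field_simp; ring

lemma exp2_bot : Tendsto (fun t : ℝ => exp (2 * t)) atBot (𝓝 0) :=
  tendsto_exp_atBot.comp (tendsto_id.const_mul_atBot (by norm_num))

lemma sg_bot : Tendsto sg atBot (𝓝 0) := by
  have := exp2_bot.div (exp2_bot.const_add 1) (by norm_num)
  rw [zero_div] at this
  exact this

lemma sg_top : Tendsto sg atTop (𝓝 1) := by
  have h1 : Tendsto (fun t : ℝ => 1 + exp (2 * t)) atTop atTop :=
    tendsto_atTop_add_const_left _ _ (tendsto_exp_atTop.comp (tendsto_id.const_mul_atTop (by norm_num)))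
  have h2 := (h1.inv_tendsto_atTop).const_sub 1
  refine Tendsto.congr (fun t => ?_) (by simpa using h2)
  have := one_sub_sg t
  show 1 - (1 + exp (2 * t))⁻¹ = sg t
  rw [one_div] at this
  linarith

lemma ode_unique {ρ : ℝ} (h1 : 1 < ρ) (h2 : ρ ≤ 3 / 2) {m q : ℝ → ℝ}
    (dm : ∀ t, HasDerivAt m (q t) t)
    (dq : ∀ t, HasDerivAt q (q t * (2 + 4 * (ρ - 1) * sg t - m t)) t)
    (mb : Tendsto m atBot (𝓝 0)) (mt : Tendsto m atTop (𝓝 (4 * ρ)))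
    (qb : Tendsto q atBot (𝓝 0)) (qt : Tendsto q atTop (𝓝 0))
    (hm : ∀ t, 0 ≤ m t ∧ m t ≤ 4 * ρ) : ∀ t, m t = 4 * ρ * sg t := by
  set p : ℝ → ℝ := fun t => sg t * (1 - sg t) with hp
  have hs0 := sg_pos
  have hs1 := sg_lt
  have hp0 : ∀ t, 0 < p t := fun t => mul_pos (hs0 t) (by linarith [hs1 t])
  have ds : ∀ t, HasDerivAt sg (2 * p t) t := sg_deriv
  have dp : ∀ t, HasDerivAt p (2 * p t * (1 - 2 * sg t)) t := fun t => by
    refine HasDerivAt.congr_deriv ((ds t).fun_mul ((ds t).const_sub 1)) ?_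
    ring
  have pb : Tendsto p atBot (𝓝 0) := by simpa using sg_bot.mul (sg_bot.const_sub 1)
  have pt : Tendsto p atTop (𝓝 0) := by simpa using sg_top.mul (sg_top.const_sub 1)
  set y : ℝ → ℝ := fun t => m t - 4 * ρ * sg t with hy
  set y' : ℝ → ℝ := fun t => q t - 8 * ρ * p t with hy'
  have dy1 : ∀ t, HasDerivAt y (y' t) t := fun t => by
    refine HasDerivAt.congr_deriv ((dm t).fun_sub ((ds t).const_mul (4 * ρ))) ?_
    simp only [hy']; ring
  have dy2 : ∀ t, HasDerivAt y' (y' t * (2 - 4 * sg t) - y t * (8 * ρ * p t + y' t)) t := fun t => by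
    refine HasDerivAt.congr_deriv ((dq t).fun_sub ((dp t).const_mul (8 * ρ))) ?_
    simp only [hy', hy]; ring
  have yb : Tendsto y atBot (𝓝 0) := by simpa using mb.sub (sg_bot.const_mul (4 * ρ))
  have yt : Tendsto y atTop (𝓝 0) := by simpa using mt.sub (sg_top.const_mul (4 * ρ))
  have yqb : Tendsto y' atBot (𝓝 0) := by simpa using qb.sub (pb.const_mul (8 * ρ))
  have yqt : Tendsto y' atTop (𝓝 0) := by simpa using qt.sub (pt.const_mul (8 * ρ))
  have hyB : ∀ t, |y t| ≤ 4 * ρ := fun t => by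
    have a := hm t
    have b := hs0 t
    have c := hs1 t
    rw [abs_le]
    constructor <;> simp only [hy] <;> nlinarith
  set B := 4 * ρ with hB
  set Y : ℝ → ℝ := fun t => ((2 - 4 * sg t) * y t - y t ^ 2 / 2 - y' t) / (4 * (ρ - 1)) with hY
  have hρ : 4 * (ρ - 1) ≠ 0 := by have : 0 < ρ - 1 := by linarith
                                  positivity
  have dY : ∀ t, HasDerivAt Y (2 * p t * y t) t := fun t => by
    refine HasDerivAt.congr_deriv ((((((ds t).const_mul 4).const_sub 2).fun_mul (dy1 t)).fun_sub
      (((dy1 t).fun_pow 2).div_const 2)).fun_sub (dy2 t) |>.div_const (4 * (ρ - 1))) ?_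
    rw [div_eq_iff hρ]
    ring
  have Yb : Tendsto Y atBot (𝓝 0) := by
    have := ((((sg_bot.const_mul 4).const_sub 2).mul yb).sub ((yb.pow 2).div_const 2)).sub yqb |>.div_const (4 * (ρ - 1))
    simpa using this
  have Yt : Tendsto Y atTop (𝓝 0) := by
    have := ((((sg_top.const_mul 4).const_sub 2).mul yt).sub ((yt.pow 2).div_const 2)).sub yqt |>.div_const (4 * (ρ - 1))
    simpa using this
  -- bounds on Y
  have mono1 : Monotone (fun t => B * sg t - Y t) :=
    monotone_of_hasDerivAt_nonneg (fun t => ((ds t).const_mul B).fun_sub (dY t)) (fun t => by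
      show 0 ≤ B * (2 * p t) - 2 * p t * y t
      have := (abs_le.1 (hyB t)).2
      have := hp0 t
      nlinarith)
  have mono2 : Monotone (fun t => B * sg t + Y t) :=
    monotone_of_hasDerivAt_nonneg (fun t => ((ds t).const_mul B).fun_add (dY t)) (fun t => by
      show 0 ≤ B * (2 * p t) + 2 * p t * y t
      have := (abs_le.1 (hyB t)).1
      have := hp0 t
      nlinarith)
  have bd1 : ∀ t, |Y t| ≤ B * sg t := fun t => by
    have a := mono1.le_of_tendsto (by simpa using (sg_bot.const_mul B).sub Yb) t
    have b := mono2.le_of_tendsto (by simpa using (sg_bot.const_mul B).add Yb) t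
    rw [abs_le]
    constructor <;> linarith
  have bd2 : ∀ t, |Y t| ≤ B * (1 - sg t) := fun t => by
    have a := mono1.ge_of_tendsto (by simpa using (sg_top.const_mul B).sub Yt) t
    have b := mono2.ge_of_tendsto (by simpa using (sg_top.const_mul B).add Yt) t
    rw [abs_le]
    constructor <;> linarith
  have Ysq : ∀ t, Y t ^ 2 / p t ≤ 4 * B ^ 2 * p t := fun t => by
    rw [div_le_iff₀ (hp0 t)]
    have hB0 : 0 < B := by positivity
    have a : |Y t| ≤ 2 * B * p t := by
      have s0 := hs0 t
      have s1 := hs1 t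
      have b1 := bd1 t
      have b2 := bd2 t
      rcases le_total (sg t) (1/2) with h | h
      · refine b1.trans ?_
        simp only [hp]
        nlinarith [mul_pos hB0 s0]
      · refine b2.trans ?_
        simp only [hp]
        nlinarith [mul_pos hB0 (by linarith : 0 < 1 - sg t)]
    have := sq_le_sq' (abs_le.1 a).1 (abs_le.1 a).2
    linarith
  have Zlim : ∀ F : Filter ℝ, Tendsto p F (𝓝 0) → Tendsto (fun t => Y t ^ 2 / p t) F (𝓝 0) := by
    intro F hF
    refine squeeze_zero (fun t => div_nonneg (sq_nonneg _) (hp0 t).le) Ysq ?_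
    simpa using hF.const_mul (4 * B ^ 2)
  set W : ℝ → ℝ := fun t => y t * y' t - (1 - 2 * sg t) * y t ^ 2 + y t ^ 3 / 3 + 8 * (Y t * y t)
    - 4 * ((1 - 2 * sg t) * (Y t ^ 2 / p t)) with hW
  set D : ℝ → ℝ := fun t => (y' t + 4 * Y t) ^ 2 + 8 * p t * (y t - (1 - 2 * sg t) * Y t / p t) ^ 2
    + 2 * p t * (6 - 4 * ρ) * y t ^ 2 with hD
  have dW : ∀ t, HasDerivAt W (D t) t := fun t => by
    have p0 := (hp0 t).ne'
    have e := (ds t).const_mul 2 |>.const_sub 1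
    refine HasDerivAt.congr_deriv ((((((dy1 t).fun_mul (dy2 t)).fun_sub (e.fun_mul ((dy1 t).fun_pow 2))).fun_add
      (((dy1 t).fun_pow 3).div_const 3)).fun_add (((dY t).fun_mul (dy1 t)).const_mul 8)).fun_sub
      ((e.fun_mul (((dY t).fun_pow 2).fun_div (dp t) p0)).const_mul 4)) ?_
    simp only [hD]
    field_simp
    ring
  have Wb : Tendsto W atBot (𝓝 0) := by
    have e := (sg_bot.const_mul 2).const_sub 1
    have := ((((yb.mul yqb).sub (e.mul (yb.pow 2))).add ((yb.pow 3).div_const 3)).add ((Yb.mul yb).const_mul 8)).sub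
      ((e.mul (Zlim _ pb)).const_mul 4)
    simpa using this
  have Wt : Tendsto W atTop (𝓝 0) := by
    have e := (sg_top.const_mul 2).const_sub 1
    have := ((((yt.mul yqt).sub (e.mul (yt.pow 2))).add ((yt.pow 3).div_const 3)).add ((Yt.mul yt).const_mul 8)).sub
      ((e.mul (Zlim _ pt)).const_mul 4)
    simpa using this
  have D1 : ∀ t, 0 ≤ 2 * p t * (6 - 4 * ρ) * y t ^ 2 := fun t => by
    have := hp0 t
    have : 0 ≤ 6 - 4 * ρ := by linarith
    positivity
  have Wm : Monotone W := monotone_of_hasDerivAt_nonneg dW (fun t => by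
    show 0 ≤ D t
    have := hp0 t
    have := D1 t
    simp only [hD]
    positivity)
  have W0 : ∀ t, W t = 0 := fun t => le_antisymm (Wm.ge_of_tendsto Wt t) (Wm.le_of_tendsto Wb t)
  have D0 : ∀ t, D t = 0 := fun t => by
    have : W = fun _ => 0 := funext W0
    have h := dW t
    rw [this] at h
    exact h.unique (hasDerivAt_const t 0)
  have yY : ∀ t, y t = (1 - 2 * sg t) * (Y t / p t) := fun t => by
    have d := D0 t
    have a := hp0 t
    have b := D1 t
    simp only [hD] at d
    have : 8 * p t * (y t - (1 - 2 * sg t) * Y t / p t) ^ 2 = 0 := by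
      have c : 0 ≤ 8 * p t * (y t - (1 - 2 * sg t) * Y t / p t) ^ 2 := by positivity
      nlinarith [sq_nonneg (y' t + 4 * Y t)]
    have h3 := (mul_eq_zero.1 this).resolve_left (by positivity)
    have h4 := pow_eq_zero_iff (two_ne_zero) |>.1 h3
    rw [mul_div_assoc] at h4
    linarith
  have dc : ∀ t, HasDerivAt (fun t => Y t / p t) 0 t := fun t => by
    have p0 := (hp0 t).ne'
    refine HasDerivAt.congr_deriv ((dY t).fun_div (dp t) p0) ?_
    rw [yY t]
    field_simp
    ring
  have hc : ∀ t, Y t / p t = Y 0 / p 0 := fun t =>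
    is_const_of_deriv_eq_zero (f := fun t => Y t / p t) (fun t => (dc t).differentiableAt) (fun t => (dc t).deriv) t 0
  have c0 : Y 0 / p 0 = 0 := by
    have l1 : Tendsto (fun t => (1 - 2 * sg t) * (Y 0 / p 0)) atBot (𝓝 ((1 - 2 * 0) * (Y 0 / p 0))) :=
      ((sg_bot.const_mul 2).const_sub 1).mul_const _
    have l2 : y = fun t => (1 - 2 * sg t) * (Y 0 / p 0) := funext fun t => by rw [yY t, hc t]
    rw [← l2] at l1
    have := tendsto_nhds_unique l1 yb
    linarith
  intro t
  have := yY t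
  rw [hc t, c0, mul_zero] at this
  simp only [hy] at this
  linarith
end MF

namespace MF
open MeasureTheory Real Filter Topology

lemma circ_re (F : ℝ → ℝ) (t : ℝ) : circ (fun z => F z.re) t = 2 * π * F t := by
  simp [circ]

theorem Pl.final {ρ l : ℝ} {v : ℂ → ℝ} (h : Pl ρ l v) (hl : l = 2 * (ρ - 1)) (h1 : 1 < ρ) (h2 : ρ ≤ 3 / 2) :
    ∀ z, v z = -2 * ρ * log (1 + ‖z‖ ^ 2) + log (8 * ρ) := by
  have l0 : 0 < l := by linarith
  have hpi : 0 < 2 * π := by positivity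
  have hrad := h.radial hl h1 h2
  have hc := h.cyl
  have ftop := h.flux_top
  have fbot := h.flux_bot
  have hvc : Continuous v := h.smooth.continuous
  set V : ℂ → ℝ := fun z => v (Complex.exp z) with hV
  set g : ℝ → ℝ := fun t => circ V t / (2 * π) with hg
  have hVg : ∀ z : ℂ, V z = g z.re := by
    intro z
    have := circ_osc hc.s1 hc.per z
    have e : (fun w => |dy V w|) = fun _ => 0 := by funext w; rw [hrad w, abs_zero]
    rw [e, circ_const] at this
    have := abs_nonpos_iff.1 (this.trans (by simp))
    simp only [hg]
    field_simp
    linarith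
  set m : ℝ → ℝ := fun t => -circ (dx V) t / (2 * π) with hm
  set q : ℝ → ℝ := fun t => K l t * exp (g t) with hq
  have hG : ∀ z, GG l V z = q z.re := fun z => by unfold GG; rw [hVg z]
  have dg : ∀ t, HasDerivAt g (-m t) t := fun t => by
    refine HasDerivAt.congr_deriv ((circ_hasDerivAt hc.s1 t).div_const (2 * π)) ?_
    simp only [hm]; ring
  have dm : ∀ t, HasDerivAt m (q t) t := fun t => by
    refine HasDerivAt.congr_deriv ((hc.flux_deriv t).fun_neg.div_const (2 * π)) ?_
    rw [show GG l V = fun z => q z.re from funext hG, circ_re]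
    field_simp
  have dq : ∀ t, HasDerivAt q (q t * (2 + 4 * (ρ - 1) * sg t - m t)) t := fun t => by
    refine HasDerivAt.congr_deriv ((hasDerivAt_K l t).fun_mul (dg t).exp) ?_
    simp only [hq]
    unfold J sg
    rw [hl]; ring
  have mb : Tendsto m atBot (𝓝 0) := by simpa using fbot.neg.div_const (2 * π)
  have mt : Tendsto m atTop (𝓝 (4 * ρ)) := by
    have := ftop.neg.div_const (2 * π)
    rwa [show - -(8 * π * ρ) / (2 * π) = 4 * ρ by field_simp; ring] at this
  have qpos : ∀ t, 0 < q t := fun t => mul_pos (K_pos _ _) (exp_pos _)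
  have qt : Tendsto q atTop (𝓝 0) := by
    rw [Metric.tendsto_atTop]
    intro ε hε
    obtain ⟨T, hT⟩ := hc.G_small l0 ftop fbot (ε / 2) (by positivity)
    refine ⟨T, fun t ht => ?_⟩
    have := hT (t : ℂ) (by simpa using ht)
    rw [hG, Complex.ofReal_re] at this
    rw [Real.dist_eq, sub_zero, abs_of_pos (qpos t)]
    linarith
  have exp0 : Tendsto (fun t : ℝ => Complex.exp (t : ℂ)) atBot (𝓝 0) := by
    have : Tendsto (fun t : ℝ => ((rexp t : ℝ) : ℂ)) atBot (𝓝 ((0 : ℝ) : ℂ)) :=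
      (Complex.continuous_ofReal.tendsto 0).comp tendsto_exp_atBot
    simpa using this
  have gb : Tendsto g atBot (𝓝 (v 0)) := by
    have : Tendsto (fun t : ℝ => v (Complex.exp (t : ℂ))) atBot (𝓝 (v 0)) := (hvc.tendsto 0).comp exp0
    refine this.congr (fun t => ?_)
    have := hVg (t : ℂ)
    rwa [Complex.ofReal_re] at this
  have qb : Tendsto q atBot (𝓝 0) := by
    have a := exp2_bot
    have b : Tendsto (fun t : ℝ => (1 + exp (2 * t)) ^ l) atBot (𝓝 ((1 + 0) ^ l)) :=
      (a.const_add 1).rpow_const (Or.inl (by norm_num))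
    have c := (a.mul b).mul ((continuous_exp.tendsto _).comp gb)
    rw [zero_mul, zero_mul] at c
    exact c
  have hmem : ∀ t, 0 ≤ m t ∧ m t ≤ 4 * ρ := fun t => by
    have := hc.flux_mem l0 ftop fbot t
    simp only [hm]
    refine ⟨div_nonneg (by linarith [this.2]) hpi.le, ?_⟩
    rw [div_le_iff₀ hpi]
    linarith [this.1]
  have key := ode_unique h1 h2 dm dq mb mt qb qt hmem
  have hqe : ∀ t, q t = 8 * ρ * (sg t * (1 - sg t)) := fun t => by
    have a := dm t
    rw [show m = fun t => 4 * ρ * sg t from funext key] at a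
    rw [a.unique ((sg_deriv t).const_mul (4 * ρ))]
    ring
  have hge : ∀ t, g t = -2 * ρ * log (1 + exp (2 * t)) + log (8 * ρ) := fun t => by
    have hp : 0 < 1 + exp (2 * t) := by positivity
    have a := congrArg log (hqe t)
    rw [one_sub_sg] at a
    simp only [hq] at a
    unfold K sg at a
    rw [log_mul (by positivity) (by positivity), log_mul (by positivity) (by positivity), log_exp, log_exp,
      log_rpow hp, log_mul (x := 8 * ρ) (by positivity) (by positivity),
      log_mul (x := exp (2 * t) / (1 + exp (2 * t))) (by positivity) (by positivity),
      log_div (by positivity) (by positivity), log_div (by positivity) (by positivity), log_exp, log_one] at a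
    rw [hl] at a
    linarith
  have hne : ∀ z : ℂ, z ≠ 0 → v z = -2 * ρ * log (1 + ‖z‖ ^ 2) + log (8 * ρ) := by
    intro z hz
    have a := hVg (Complex.log z)
    simp only [hV] at a
    rw [Complex.exp_log hz, hge, Complex.log_re, mul_comm 2, exp_mul, exp_log (norm_pos_iff.2 hz)] at a
    rw [a]
    norm_num
  intro z
  by_cases hz : z = 0
  · subst hz
    have t1 : Tendsto g atBot (𝓝 (-2 * ρ * log (1 + 0) + log (8 * ρ))) := by
      have : Tendsto (fun t => -2 * ρ * log (1 + exp (2 * t)) + log (8 * ρ)) atBot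
          (𝓝 (-2 * ρ * log (1 + 0) + log (8 * ρ))) :=
        (((exp2_bot.const_add 1).log (by norm_num)).const_mul (-2 * ρ)).add_const _
      exact this.congr (fun t => (hge t).symm)
    rw [tendsto_nhds_unique gb t1]
    simp
  · exact hne z hz
end MF

namespace MF

noncomputable def LL : ℂ ≃ₗᵢ[ℝ] EuclideanSpace ℝ (Fin 2) := Complex.orthonormalBasisOneI.repr

lemma LL_one : LL 1 = EuclideanSpace.single 0 1 := by
  have := Complex.orthonormalBasisOneI.repr_self 0
  simp only [Complex.coe_orthonormalBasisOneI, Matrix.cons_val_zero] at this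
  exact this
lemma LL_I : LL Complex.I = EuclideanSpace.single 1 1 := by
  have := Complex.orthonormalBasisOneI.repr_self 1
  simp only [Complex.coe_orthonormalBasisOneI, Matrix.cons_val_one, Matrix.cons_val_zero] at this
  exact this

lemma fderiv_LL (f : EuclideanSpace ℝ (Fin 2) → ℝ) (z h : ℂ) :
    fderiv ℝ (fun z => f (LL z)) z h = fderiv ℝ f (LL z) (LL h) := by
  have := LL.toContinuousLinearEquiv.comp_right_fderiv (f := f) (x := z)
  have h2 := congrArg (fun A => A h) this
  exact h2

lemma dx_LL (f : EuclideanSpace ℝ (Fin 2) → ℝ) :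
    dx (fun z => f (LL z)) = fun z => fderiv ℝ f (LL z) (EuclideanSpace.single 0 1) := by
  funext z
  unfold dx
  rw [fderiv_LL, LL_one]

lemma dy_LL (f : EuclideanSpace ℝ (Fin 2) → ℝ) :
    dy (fun z => f (LL z)) = fun z => fderiv ℝ f (LL z) (EuclideanSpace.single 1 1) := by
  funext z
  unfold dy
  rw [fderiv_LL, LL_I]

lemma lap_LL (f : EuclideanSpace ℝ (Fin 2) → ℝ) (z : ℂ) :
    lap (fun z => f (LL z)) z = planeLaplacian f (LL z) := by
  unfold lap planeLaplacian
  rw [dx_LL, dy_LL, dx_LL (fun y => fderiv ℝ f y (EuclideanSpace.single 0 1)),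
    dy_LL (fun y => fderiv ℝ f y (EuclideanSpace.single 1 1)), Fin.sum_univ_two]
end MF

/-- If `1 < ρ ≤ 3/2`, `l = 2(ρ-1)`, and `v` is a `C²` solution of
`Δv + (1+|y|²)^l e^v = 0` on `ℝ²` with total mass `∫ (1+|y|²)^l e^v = 8πρ`
and `∇v(0) = 0`, then `v(y) = -2ρ log(1+|y|²) + log(8ρ)`. -/
theorem uniqueness_critical_at_origin (ρ l : ℝ) (hρ1 : 1 < ρ) (hρ2 : ρ ≤ 3 / 2)
    (hl : l = 2 * (ρ - 1))
    (v : EuclideanSpace ℝ (Fin 2) → ℝ) (hv : ContDiff ℝ 2 v)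
    (hpde : ∀ y : EuclideanSpace ℝ (Fin 2),
      planeLaplacian v y + (1 + ‖y‖ ^ 2) ^ l * Real.exp (v y) = 0)
    (hint : Integrable (fun y : EuclideanSpace ℝ (Fin 2) =>
      (1 + ‖y‖ ^ 2) ^ l * Real.exp (v y)))
    (hmass : ∫ y : EuclideanSpace ℝ (Fin 2),
      (1 + ‖y‖ ^ 2) ^ l * Real.exp (v y) = 8 * Real.pi * ρ)
    (hgrad : fderiv ℝ v 0 = 0) :
    ∀ y : EuclideanSpace ℝ (Fin 2),
      v y = -2 * ρ * Real.log (1 + ‖y‖ ^ 2) + Real.log (8 * ρ) := by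
  have mp : MeasurePreserving MF.LL := MF.LL.measurePreserving
  have me : MeasurableEmbedding MF.LL := MF.LL.toHomeomorph.measurableEmbedding
  have hw2 : ContDiff ℝ 2 (fun z => v (MF.LL z)) := hv.comp MF.LL.toContinuousLinearEquiv.contDiff
  have heq : ∀ z, MF.lap (fun z => v (MF.LL z)) z = -((1 + ‖z‖ ^ 2) ^ l * Real.exp (v (MF.LL z))) := by
    intro z
    rw [MF.lap_LL]
    have := hpde (MF.LL z)
    rw [MF.LL.norm_map] at this
    linarith
  have P : MF.Pl ρ l (fun z => v (MF.LL z)) :=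
    { smooth := MF.reg4 hw2 heq
      eq := heq
      int := by
        have := (mp.integrable_comp_emb me).2 hint
        simpa [Function.comp_def, MF.LL.norm_map] using this
      mass := by
        have := mp.integral_comp me (fun y : EuclideanSpace ℝ (Fin 2) => (1 + ‖y‖ ^ 2) ^ l * Real.exp (v y))
        rw [hmass] at this
        simpa [MF.LL.norm_map] using this
      gx := by
        rw [MF.dx_LL]; simp [hgrad]
      gy := by
        rw [MF.dy_LL]; simp [hgrad] }
  intro y
  have := P.final hl hρ1 hρ2 (MF.LL.symm y)
  simpa using this
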